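/- For all positive integers α, all integers b ≥ 2, and all integers k ≥ 0: lim_{N→∞} (1/log N) · Σ_{1 ≤ |n| ≤ N} ζ(−k + 2πin/log b) · e^{2πin·log α/log b}/n^{k+1} equals −(−1)^{(k+1)/2}·(2π)^{k+1}·B_{k+1}/((k+1)!·(log b)^{k+1}) if k is odd, and equals 0 if k is even, where B_{k+1} is the (k+1)-st Bernoulli number. -/

import Mathlib

namespace Z6
open MeasureTheory Set Filter Topology

theorem vdC1 {f f' f'' : ℝ → ℝ} {a b μ : ℝ} (hab : a ≤ b) (hμ : 0 < μ)
    (hf : ∀ x, HasDerivAt f (f' x) x) (hf' : ∀ x, HasDerivAt f' (f'' x) x)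
    (hc : Continuous f'') (hpos : ∀ x ∈ Icc a b, 0 ≤ f'' x) (hm : ∀ x ∈ Icc a b, μ ≤ f' x) :
    ‖∫ x in a..b, Complex.exp (Complex.I * f x)‖ ≤ 3 / μ := by
  have hcf' : Continuous f' := continuous_iff_continuousAt.2 fun x => (hf' x).continuousAt
  have hcf : Continuous f := continuous_iff_continuousAt.2 fun x => (hf x).continuousAt
  have hne : ∀ x ∈ Icc a b, f' x ≠ 0 := fun x hx => by linarith [hm x hx]
  have hneC : ∀ x ∈ Icc a b, (Complex.I * (f' x : ℂ)) ≠ 0 := fun x hx =>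
    mul_ne_zero Complex.I_ne_zero (by exact_mod_cast hne x hx)
  -- u = 1/(i f'), v = exp(i f)
  have key := intervalIntegral.integral_mul_deriv_eq_deriv_mul_of_hasDerivWithinAt
    (a := a) (b := b)
    (u := fun x => (Complex.I * (f' x : ℂ))⁻¹)
    (u' := fun x => -(Complex.I * (f'' x : ℂ)) / (Complex.I * (f' x : ℂ)) ^ 2)
    (v := fun x => Complex.exp (Complex.I * f x))
    (v' := fun x => Complex.exp (Complex.I * f x) * (Complex.I * f' x))
    (by
      intro x hx
      rw [uIcc_of_le hab] at hx
      exact (((hf' x).ofReal_comp.const_mul Complex.I).fun_inv (hneC x hx)).hasDerivWithinAt)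
    (by
      intro x hx
      exact (((hf x).ofReal_comp.const_mul Complex.I).cexp).hasDerivWithinAt)
    (by
      apply ContinuousOn.intervalIntegrable
      rw [uIcc_of_le hab]
      apply ContinuousOn.div
      · fun_prop
      · fun_prop
      · intro x hx; exact pow_ne_zero _ (hneC x hx))
    (by apply Continuous.intervalIntegrable; fun_prop)
  have e1 : ∫ x in a..b, Complex.exp (Complex.I * f x) = ∫ x in a..b,
      (Complex.I * (f' x : ℂ))⁻¹ * (Complex.exp (Complex.I * f x) * (Complex.I * f' x)) := by
    apply intervalIntegral.integral_congr
    intro x hx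
    rw [uIcc_of_le hab] at hx
    have := hneC x hx
    simp only
    rw [mul_comm (Complex.exp _), ← mul_assoc, inv_mul_cancel₀ this, one_mul]
  rw [e1, key]
  have hexp : ∀ x, ‖Complex.exp (Complex.I * (f x : ℂ))‖ = 1 := by
    intro x; rw [mul_comm]; exact Complex.norm_exp_ofReal_mul_I _
  have hB : ∀ x ∈ Icc a b, ‖(Complex.I * (f' x : ℂ))⁻¹ * Complex.exp (Complex.I * f x)‖ ≤ 1 / μ := by
    intro x hx
    rw [norm_mul, hexp, mul_one, norm_inv, norm_mul, Complex.norm_I, one_mul, Complex.norm_real,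
      Real.norm_eq_abs, abs_of_pos (by linarith [hm x hx]), one_div]
    exact inv_anti₀ hμ (hm x hx)
  have hI : ‖∫ x in a..b, -(Complex.I * (f'' x : ℂ)) / (Complex.I * (f' x : ℂ)) ^ 2 *
      Complex.exp (Complex.I * f x)‖ ≤ 1 / μ := by
    have h1 : ‖∫ x in a..b, -(Complex.I * (f'' x : ℂ)) / (Complex.I * (f' x : ℂ)) ^ 2 *
      Complex.exp (Complex.I * f x)‖ ≤ ∫ x in a..b, f'' x / (f' x) ^ 2 := by
      apply intervalIntegral.norm_integral_le_of_norm_le hab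
      · refine Eventually.of_forall fun x hx => ?_
        have hx' : x ∈ Icc a b := Ioc_subset_Icc_self hx
        rw [norm_mul, hexp, mul_one, norm_div, norm_neg, norm_pow, norm_mul, norm_mul,
          Complex.norm_I, one_mul, one_mul, Complex.norm_real, Complex.norm_real,
          Real.norm_eq_abs, Real.norm_eq_abs, sq_abs, abs_of_nonneg (hpos x hx')]
      · apply ContinuousOn.intervalIntegrable
        rw [uIcc_of_le hab]
        apply ContinuousOn.div
        · fun_prop
        · fun_prop
        · intro x hx; exact pow_ne_zero _ (hne x hx)
    have h2 : ∫ x in a..b, f'' x / (f' x) ^ 2 = -(f' b)⁻¹ - -(f' a)⁻¹ := by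
      apply intervalIntegral.integral_eq_sub_of_hasDerivAt (f := fun x => -(f' x)⁻¹)
      · intro x hx
        rw [uIcc_of_le hab] at hx
        have := ((hf' x).fun_inv (hne x hx)).fun_neg
        convert this using 1; ring
      · apply ContinuousOn.intervalIntegrable
        rw [uIcc_of_le hab]
        apply ContinuousOn.div
        · fun_prop
        · fun_prop
        · intro x hx; exact pow_ne_zero _ (hne x hx)
    have h3 : 0 < (f' b)⁻¹ := inv_pos.2 (by linarith [hm b (right_mem_Icc.2 hab)])
    have h4 : (f' a)⁻¹ ≤ 1/μ := by
      rw [one_div]; exact inv_anti₀ hμ (hm a (left_mem_Icc.2 hab))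
    linarith
  have := hB a (left_mem_Icc.2 hab)
  have := hB b (right_mem_Icc.2 hab)
  calc _ ≤ 1/μ + 1/μ + 1/μ := by
        refine (norm_sub_le _ _).trans (add_le_add ((norm_sub_le _ _).trans (add_le_add ?_ ?_)) hI)
        · assumption
        · assumption
    _ = 3/μ := by ring

theorem norm_int_exp_le {f : ℝ → ℝ} {a b : ℝ} (hab : a ≤ b) :
    ‖∫ x in a..b, Complex.exp (Complex.I * f x)‖ ≤ b - a := by
  have := intervalIntegral.norm_integral_le_of_norm_le_const (a := a) (b := b) (C := 1)
    (f := fun x => Complex.exp (Complex.I * f x)) (by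
      intro x _; rw [mul_comm]; exact (Complex.norm_exp_ofReal_mul_I _).le)
  rwa [one_mul, abs_of_nonneg (by linarith)] at this

theorem vdC2a {f f' f'' : ℝ → ℝ} {a b l : ℝ} (hab : a ≤ b) (hl : 0 < l)
    (hf : ∀ x, HasDerivAt f (f' x) x) (hf' : ∀ x, HasDerivAt f' (f'' x) x)
    (hc : Continuous f'') (hpos : ∀ x ∈ Icc a b, l ≤ f'' x) (h0 : 0 ≤ f' a) :
    ‖∫ x in a..b, Complex.exp (Complex.I * f x)‖ ≤ 4 / √l := by
  have hs : 0 < √l := Real.sqrt_pos.2 hl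
  have hsq : √l * √l = l := Real.mul_self_sqrt hl.le
  have hcf : Continuous f := continuous_iff_continuousAt.2 fun x => (hf x).continuousAt
  by_cases h : b ≤ a + 1/√l
  · refine (norm_int_exp_le hab).trans ?_
    have : 1/√l ≤ 4/√l := by gcongr; norm_num
    linarith
  · push Not at h
    have hp : 0 < 1/√l := by positivity
    have hlow : ∀ x ∈ Icc (a+1/√l) b, √l ≤ f' x := by
      intro x hx
      have hax : a ≤ x := by linarith [hx.1]
      have := Convex.mul_sub_le_image_sub_of_le_deriv (convex_Icc a b) (f := f') (C := l)
        (fun y _ => (hf' y).continuousAt.continuousWithinAt)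
        (fun y _ => (hf' y).differentiableAt.differentiableWithinAt)
        (fun y hy => by rw [(hf' y).deriv]; exact hpos y (interior_subset hy))
        a (left_mem_Icc.2 hab) x ⟨hax, hx.2⟩ hax
      have h2 : l * (1/√l) ≤ l * (x - a) := by
        apply mul_le_mul_of_nonneg_left _ hl.le; linarith [hx.1]
      have h3 : l * (1/√l) = √l := by field_simp; nlinarith
      linarith
    have hint : ∀ c d, IntervalIntegrable (fun x => Complex.exp (Complex.I * f x)) volume c d :=
      fun c d => by apply Continuous.intervalIntegrable; fun_prop
    rw [← intervalIntegral.integral_add_adjacent_intervals (hint a (a+1/√l)) (hint _ b)]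
    have h1 := norm_int_exp_le (f := f) (a := a) (b := a+1/√l) (by linarith)
    have h2 := vdC1 (a := a+1/√l) (b := b) h.le hs hf hf' hc
      (fun x hx => hl.le.trans (hpos x ⟨by linarith [hx.1], hx.2⟩)) hlow
    calc _ ≤ (1/√l) + 3/√l := by
          refine (norm_add_le _ _).trans (add_le_add (by linarith) h2)
      _ = _ := by ring

theorem vdC2 {f f' f'' : ℝ → ℝ} {a b l : ℝ} (hab : a ≤ b) (hl : 0 < l)
    (hf : ∀ x, HasDerivAt f (f' x) x) (hf' : ∀ x, HasDerivAt f' (f'' x) x)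
    (hc : Continuous f'') (hpos : ∀ x ∈ Icc a b, l ≤ f'' x) :
    ‖∫ x in a..b, Complex.exp (Complex.I * f x)‖ ≤ 8 / √l := by
  have hs : 0 < √l := Real.sqrt_pos.2 hl
  have hcf : Continuous f := continuous_iff_continuousAt.2 fun x => (hf x).continuousAt
  have hcf' : Continuous f' := continuous_iff_continuousAt.2 fun x => (hf' x).continuousAt
  -- left version
  have left : ∀ c ∈ Icc a b, f' c ≤ 0 → ‖∫ x in a..c, Complex.exp (Complex.I * f x)‖ ≤ 4 / √l := by
    intro c hcI h0
    have := vdC2a (f := fun x => f (-x)) (f' := fun x => - f' (-x)) (f'' := fun x => f'' (-x))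
      (a := -c) (b := -a) (l := l) (by linarith [hcI.1]) hl
      (fun x => by have := (hf (-x)).comp x (hasDerivAt_neg x); rw [mul_neg_one] at this; exact this)
      (fun x => by have := ((hf' (-x)).comp x (hasDerivAt_neg x)).neg; rw [mul_neg_one, neg_neg] at this; exact this)
      (by fun_prop)
      (fun x hx => hpos _ ⟨by linarith [hx.2], by linarith [hx.1, hcI.2]⟩)
      (by simpa using h0)
    rwa [intervalIntegral.integral_comp_neg (fun x => Complex.exp (Complex.I * f x)), neg_neg,
      neg_neg] at this
  have h48 : 4/√l ≤ 8/√l := by gcongr; norm_num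
  by_cases h1 : 0 ≤ f' a
  · exact (vdC2a hab hl hf hf' hc hpos h1).trans h48
  by_cases h2 : f' b ≤ 0
  · exact (left b (right_mem_Icc.2 hab) h2).trans h48
  push Not at h1 h2
  obtain ⟨c, hcI, hc0⟩ := intermediate_value_Icc hab hcf'.continuousOn ⟨h1.le, h2.le⟩
  have hint : ∀ c d, IntervalIntegrable (fun x => Complex.exp (Complex.I * f x)) volume c d :=
      fun c d => by apply Continuous.intervalIntegrable; fun_prop
  rw [← intervalIntegral.integral_add_adjacent_intervals (hint a c) (hint c b)]
  have := left c hcI hc0.le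
  have := vdC2a hcI.2 hl hf hf' hc (fun x hx => hpos x ⟨hcI.1.trans hx.1, hx.2⟩) hc0.ge
  calc _ ≤ 4/√l + 4/√l := (norm_add_le _ _).trans (add_le_add (by assumption) (by assumption))
    _ = _ := by ring

theorem sin_pi_pos {w : ℝ} (h0 : 0 < w) (h1 : w ≤ 1/2) : 0 < Real.sin (Real.pi * w) := by
  apply Real.sin_pos_of_pos_of_lt_pi
  · positivity
  · nlinarith [Real.pi_pos]

theorem sin_pi_ge {w : ℝ} (h0 : 0 ≤ w) (h1 : w ≤ 1/2) : 2 * w ≤ Real.sin (Real.pi * w) := by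
  have := Real.mul_le_sin (x := Real.pi * w) (by positivity) (by nlinarith [Real.pi_pos])
  calc 2 * w = 2 / Real.pi * (Real.pi * w) := by field_simp
    _ ≤ _ := this

/-- amplitude lemma -/
theorem AM {e : ℝ → ℂ} (he : Continuous e) {a b B : ℝ} (ha : 0 < a) (hab : a ≤ b) (hb : b ≤ 1/2)
    (hB : ∀ t ∈ Icc a b, ‖∫ x in a..t, e x‖ ≤ B) :
    ‖∫ x in a..b, (((Real.sin (Real.pi * x))⁻¹ : ℝ) : ℂ) * e x‖ ≤ B * (Real.sin (Real.pi * a))⁻¹ := by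
  set A : ℝ → ℝ := fun x => (Real.sin (Real.pi * x))⁻¹ with hA
  set A' : ℝ → ℝ := fun x => -(Real.cos (Real.pi * x) * Real.pi) / (Real.sin (Real.pi * x))^2 with hA'
  have hs : ∀ x ∈ Icc a b, 0 < Real.sin (Real.pi * x) := fun x hx =>
    sin_pi_pos (ha.trans_le hx.1) (hx.2.trans hb)
  have hAd : ∀ x ∈ Icc a b, HasDerivAt A (A' x) x := by
    intro x hx
    have h1 : HasDerivAt (fun x => Real.pi * x) Real.pi x := by
      simpa using (hasDerivAt_id x).const_mul Real.pi
    exact (h1.sin).fun_inv (hs x hx).ne'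
  have hA'c : ContinuousOn A' (Icc a b) := by
    apply ContinuousOn.div
    · fun_prop
    · fun_prop
    · intro x hx; exact pow_ne_zero _ (hs x hx).ne'
  have hA'i : IntervalIntegrable A' volume a b := by
    apply ContinuousOn.intervalIntegrable; rwa [uIcc_of_le hab]
  have hA'n : ∀ x ∈ Icc a b, A' x ≤ 0 := by
    intro x hx
    have : 0 ≤ Real.cos (Real.pi * x) := by
      apply Real.cos_nonneg_of_neg_pi_div_two_le_of_le
      · have := Real.pi_pos; have : 0 < Real.pi * x := mul_pos this (ha.trans_le hx.1); linarith
      · nlinarith [Real.pi_pos, hx.2]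
    rw [hA']
    apply div_nonpos_of_nonpos_of_nonneg
    · have := mul_nonneg this Real.pi_pos.le; linarith
    · positivity
  have hB0 : 0 ≤ B := (norm_nonneg _).trans (hB a (left_mem_Icc.2 hab))
  set E : ℝ → ℂ := fun t => ∫ x in a..t, e x with hE
  have hEd : ∀ x, HasDerivAt E (e x) x := fun x => he.integral_hasStrictDerivAt a x |>.hasDerivAt
  have hEc : Continuous E := continuous_iff_continuousAt.2 fun x => (hEd x).continuousAt
  have key := intervalIntegral.integral_mul_deriv_eq_deriv_mul_of_hasDerivWithinAt
    (a := a) (b := b) (u := fun x => (A x : ℂ)) (u' := fun x => (A' x : ℂ)) (v := E) (v' := e)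
    (by intro x hx; rw [uIcc_of_le hab] at hx; exact (hAd x hx).ofReal_comp.hasDerivWithinAt)
    (fun x _ => (hEd x).hasDerivWithinAt)
    (by apply ContinuousOn.intervalIntegrable; rw [uIcc_of_le hab]; exact Complex.continuous_ofReal.comp_continuousOn hA'c) (he.intervalIntegrable _ _)
  rw [key]
  have hEa : E a = 0 := by simp [hE]
  rw [hEa, mul_zero, sub_zero]
  have hI : ‖∫ x in a..b, (A' x : ℂ) * E x‖ ≤ ∫ x in a..b, (-A' x) * B := by
    apply intervalIntegral.norm_integral_le_of_norm_le hab
    · refine Eventually.of_forall fun x hx => ?_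
      have hx' := Ioc_subset_Icc_self hx
      rw [norm_mul, Complex.norm_real, Real.norm_eq_abs, abs_of_nonpos (hA'n x hx')]
      exact mul_le_mul_of_nonneg_left (hB x hx') (by linarith [hA'n x hx'])
    · exact (hA'i.neg).mul_const B
  have hI2 : ∫ x in a..b, (-A' x) * B = (A a - A b) * B := by
    rw [intervalIntegral.integral_mul_const, intervalIntegral.integral_neg,
      intervalIntegral.integral_eq_sub_of_hasDerivAt (f := A) _ hA'i]
    · ring
    · intro x hx; rw [uIcc_of_le hab] at hx; exact hAd x hx
  have hAb : 0 < A b := inv_pos.2 (hs b (right_mem_Icc.2 hab))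
  calc _ ≤ A b * B + (A a - A b) * B := by
        refine (norm_sub_le _ _).trans (add_le_add ?_ (hI.trans hI2.le))
        rw [norm_mul, Complex.norm_real, Real.norm_eq_abs, abs_of_pos hAb]
        exact mul_le_mul_of_nonneg_left (hB b (right_mem_Icc.2 hab)) hAb.le
    _ = _ := by ring

end Z6


namespace Z6
open MeasureTheory Set Filter Topology

noncomputable def Dk (N : ℕ) (u : ℝ) : ℝ :=
  1 + 2 * ∑ n ∈ Finset.range N, Real.cos (2 * Real.pi * ((n : ℝ) + 1) * u)

theorem Dk_cont (N : ℕ) : Continuous (Dk N) := by unfold Dk; fun_prop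

theorem Dk_even (N : ℕ) (u : ℝ) : Dk N (-u) = Dk N u := by
  unfold Dk
  simp only [mul_neg, Real.cos_neg]

theorem Dk_add_int (N : ℕ) (u : ℝ) (j : ℤ) : Dk N (u + j) = Dk N u := by
  unfold Dk
  congr 2
  refine Finset.sum_congr rfl fun n _ => ?_
  have : 2 * Real.pi * ((n:ℝ)+1) * (u + j) = 2 * Real.pi * ((n:ℝ)+1) * u + (((n + 1) * j : ℤ) : ℝ) * (2 * Real.pi) := by
    push_cast; ring
  rw [this, Real.cos_add_int_mul_two_pi]

theorem Dk_abs (N : ℕ) (u : ℝ) : |Dk N u| ≤ 2 * N + 1 := by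
  unfold Dk
  have : |∑ n ∈ Finset.range N, Real.cos (2 * Real.pi * ((n : ℝ) + 1) * u)| ≤ N := by
    refine (Finset.abs_sum_le_sum_abs _ _).trans ?_
    refine (Finset.sum_le_sum fun n _ => Real.abs_cos_le_one _).trans ?_
    simp
  rw [abs_le] at this ⊢
  constructor <;> linarith

theorem Dk_sin (N : ℕ) (u : ℝ) :
    Real.sin (Real.pi * u) * Dk N u = Real.sin ((2 * N + 1) * Real.pi * u) := by
  unfold Dk
  induction N with
  | zero => simp
  | succ N ih =>
    rw [Finset.sum_range_succ, mul_add 2, ← add_assoc, mul_add, ih]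
    have h1 : (2 * ((N + 1 : ℕ) : ℝ) + 1) * Real.pi * u = 2 * Real.pi * ((N:ℝ)+1) * u + Real.pi * u := by
      push_cast; ring
    have h2 : (2 * (N : ℝ) + 1) * Real.pi * u = 2 * Real.pi * ((N:ℝ)+1) * u - Real.pi * u := by
      ring
    rw [h1, h2, Real.sin_add, Real.sin_sub]; ring

theorem Dk_eq (N : ℕ) {u : ℝ} (h0 : 0 < u) (h1 : u ≤ 1/2) :
    Dk N u = (Real.sin (Real.pi * u))⁻¹ * Real.sin ((2 * N + 1) * Real.pi * u) := by
  rw [← Dk_sin, ← mul_assoc, inv_mul_cancel₀ (sin_pi_pos h0 h1).ne', one_mul]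

theorem Dk_le (N : ℕ) {u : ℝ} (h0 : 0 < u) (h1 : u ≤ 1/2) : |Dk N u| ≤ 1 / (2 * u) := by
  rw [Dk_eq N h0 h1, abs_mul]
  have h2 := sin_pi_ge h0.le h1
  have h3 := sin_pi_pos h0 h1
  rw [abs_of_pos (inv_pos.2 h3)]
  calc _ ≤ (Real.sin (Real.pi * u))⁻¹ * 1 := by
        apply mul_le_mul_of_nonneg_left (Real.abs_sin_le_one _) (inv_pos.2 h3).le
    _ ≤ _ := by rw [mul_one, one_div]; exact inv_anti₀ (by positivity) h2

theorem AMr {e : ℝ → ℝ} (he : Continuous e) {a b B : ℝ} (ha : 0 < a) (hab : a ≤ b) (hb : b ≤ 1/2)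
    (hB : ∀ t ∈ Icc a b, |∫ x in a..t, e x| ≤ B) :
    |∫ x in a..b, (Real.sin (Real.pi * x))⁻¹ * e x| ≤ B * (Real.sin (Real.pi * a))⁻¹ := by
  have := AM (e := fun x => (e x : ℂ)) (by fun_prop) ha hab hb (B := B) (by
    intro t ht
    rw [intervalIntegral.integral_ofReal, Complex.norm_real]; exact hB t ht)
  have h2 : ∫ x in a..b, (((Real.sin (Real.pi * x))⁻¹ : ℝ) : ℂ) * (e x : ℂ) =
      ((∫ x in a..b, (Real.sin (Real.pi * x))⁻¹ * e x : ℝ) : ℂ) := by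
    rw [← intervalIntegral.integral_ofReal]
    congr 1; ext x; push_cast; ring
  rwa [h2, Complex.norm_real] at this

theorem int_sin_le {l : ℝ} (hl : 0 < l) (a t : ℝ) : |∫ x in a..t, Real.sin (l * x)| ≤ 2 / l := by
  rw [intervalIntegral.integral_comp_mul_left _ hl.ne', integral_sin, smul_eq_mul, abs_mul,
    abs_of_pos (inv_pos.2 hl), inv_mul_eq_div]
  gcongr
  have h1 := Real.abs_cos_le_one (l * a)
  have h2 := Real.abs_cos_le_one (l * t)
  rw [abs_le] at *; constructor <;> linarith

theorem SI_meas (l : ℝ) : Measurable fun w : ℝ => (Real.sin (Real.pi * w))⁻¹ * Real.sin (l * w) := by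
  fun_prop

theorem SI_pt (l : ℝ) {w : ℝ} (h0 : 0 ≤ w) (h1 : w ≤ 1/2) :
    |(Real.sin (Real.pi * w))⁻¹ * Real.sin (l * w)| ≤ |l| / 2 := by
  rcases h0.eq_or_lt with rfl | h0
  · simp; positivity
  have h3 := sin_pi_pos h0 h1
  have h2 := sin_pi_ge h0.le h1
  rw [abs_mul, abs_of_pos (inv_pos.2 h3), inv_mul_eq_div, div_le_div_iff₀ h3 (by norm_num)]
  have h4 : |Real.sin (l * w)| ≤ |l| * w := by
    have := Real.abs_sin_le_abs (x := l * w)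
    rwa [abs_mul, abs_of_pos h0] at this
  nlinarith [abs_nonneg l]

theorem SI_int (l : ℝ) {a b : ℝ} (h0 : 0 ≤ a) (hab : a ≤ b) (hb : b ≤ 1/2) :
    IntervalIntegrable (fun w : ℝ => (Real.sin (Real.pi * w))⁻¹ * Real.sin (l * w)) volume a b := by
  rw [intervalIntegrable_iff_integrableOn_Ioc_of_le hab]
  apply Measure.integrableOn_of_bounded (M := |l|/2) (by simp) (SI_meas l).aestronglyMeasurable
  rw [ae_restrict_iff' measurableSet_Ioc]
  exact Eventually.of_forall fun x hx => SI_pt l (h0.trans hx.1.le) (hx.2.trans hb)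

theorem SI_pos {l d : ℝ} (hl : 0 < l) (h0 : 0 ≤ d) (h1 : d ≤ 1/2) :
    |∫ w in (0:ℝ)..d, (Real.sin (Real.pi * w))⁻¹ * Real.sin (l * w)| ≤ 2 := by
  have first : ∀ a, 0 ≤ a → a ≤ 1/2 → a ≤ 1/l →
      |∫ w in (0:ℝ)..a, (Real.sin (Real.pi * w))⁻¹ * Real.sin (l * w)| ≤ 1/2 := by
    intro a ha ha1 hal
    have := intervalIntegral.norm_integral_le_of_norm_le_const (a := 0) (b := a) (C := l/2)
      (f := fun w => (Real.sin (Real.pi * w))⁻¹ * Real.sin (l * w)) (by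
        intro x hx; rw [uIoc_of_le ha] at hx
        have := SI_pt l hx.1.le (hx.2.trans ha1)
        rwa [abs_of_pos hl] at this)
    rw [sub_zero, abs_of_nonneg ha] at this
    refine this.trans ?_
    rw [le_div_iff₀ hl] at hal
    linarith
  by_cases h : d ≤ 1/l
  · linarith [first d h0 h1 h]
  push Not at h
  have hl' : 0 < 1/l := by positivity
  rw [← intervalIntegral.integral_add_adjacent_intervals (SI_int l le_rfl hl'.le (by linarith))
    (SI_int l hl'.le h.le h1)]
  have A1 := first (1/l) hl'.le (by linarith) le_rfl
  have A2 := AMr (e := fun x => Real.sin (l * x)) (by fun_prop) hl' h.le h1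
    (fun t _ => int_sin_le hl _ _)
  have A3 : 2 / l * (Real.sin (Real.pi * (1/l)))⁻¹ ≤ 1 := by
    have := sin_pi_ge hl'.le (by linarith)
    have h5 := sin_pi_pos hl' (by linarith)
    rw [← div_eq_mul_inv, div_le_one h5]
    calc 2/l = 2 * (1/l) := by ring
      _ ≤ _ := this
  refine (abs_add_le _ _).trans ?_
  linarith

theorem SI (l : ℝ) {d : ℝ} (h0 : 0 ≤ d) (h1 : d ≤ 1/2) :
    |∫ w in (0:ℝ)..d, (Real.sin (Real.pi * w))⁻¹ * Real.sin (l * w)| ≤ 2 := by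
  rcases lt_trichotomy l 0 with h | h | h
  · have := SI_pos (l := -l) (by linarith) h0 h1
    simp only [neg_mul, Real.sin_neg, mul_neg, intervalIntegral.integral_neg, abs_neg] at this
    exact this
  · simp [h]
  · exact SI_pos h h0 h1

noncomputable def del (N : ℕ) (u : ℝ) : ℝ := (u - 1/2) + ∑ n ∈ Finset.range N,
    Real.sin (2 * Real.pi * ((n : ℝ) + 1) * u) / (Real.pi * ((n : ℝ) + 1))

theorem del_deriv (N : ℕ) (u : ℝ) : HasDerivAt (del N) (Dk N u) u := by
  unfold Dk del
  rw [Finset.mul_sum]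
  apply HasDerivAt.add
  · simpa using (hasDerivAt_id u).sub_const (1/2)
  · apply HasDerivAt.fun_sum
    intro n _
    have h1 : HasDerivAt (fun u => 2 * Real.pi * ((n : ℝ) + 1) * u) (2 * Real.pi * ((n : ℝ) + 1)) u := by
      simpa using (hasDerivAt_id u).const_mul (2 * Real.pi * ((n : ℝ) + 1))
    have := h1.sin.div_const (Real.pi * ((n : ℝ) + 1))
    have h2 : (2 * Real.cos (2 * Real.pi * ((n : ℝ) + 1) * u)) = Real.cos (2 * Real.pi * ((n : ℝ) + 1) * u) *
        (2 * Real.pi * ((n : ℝ) + 1)) / (Real.pi * ((n : ℝ) + 1)) := by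
      have : Real.pi * ((n:ℝ)+1) ≠ 0 := by positivity
      rw [eq_div_iff this]; ring
    rw [h2]
    exact this

theorem del_zero (N : ℕ) : del N 0 = -1/2 := by simp [del]; norm_num

theorem del_one_sub (N : ℕ) (u : ℝ) : del N (1 - u) = - del N u := by
  unfold del
  rw [neg_add, ← Finset.sum_neg_distrib]
  congr 1
  · ring
  · refine Finset.sum_congr rfl fun n _ => ?_
    have : 2 * Real.pi * ((n:ℝ)+1) * (1 - u) = (((n + 1 : ℕ) : ℝ)) * (2 * Real.pi) - 2 * Real.pi * ((n:ℝ)+1) * u := by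
      push_cast; ring
    rw [this, Real.sin_nat_mul_two_pi_sub]; ring

theorem del_half (N : ℕ) : del N (1/2) = 0 := by
  have := del_one_sub N (1/2)
  rw [show (1:ℝ) - 1/2 = 1/2 by norm_num] at this
  linarith

theorem del_cont (N : ℕ) : Continuous (del N) := by unfold del; fun_prop

theorem del_sub (N : ℕ) (a b : ℝ) : ∫ x in a..b, Dk N x = del N b - del N a :=
  intervalIntegral.integral_eq_sub_of_hasDerivAt (fun x _ => del_deriv N x)
    ((Dk_cont N).intervalIntegrable _ _)

theorem del_le1 (N : ℕ) {u : ℝ} (h0 : 0 ≤ u) (h1 : u ≤ 1/2) : |del N u| ≤ 3 := by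
  have h := del_sub N 0 u
  have h2 : ∫ x in (0:ℝ)..u, Dk N x =
      ∫ w in (0:ℝ)..u, (Real.sin (Real.pi * w))⁻¹ * Real.sin ((2 * N + 1) * Real.pi * w) := by
    apply intervalIntegral.integral_congr_ae
    refine Eventually.of_forall fun x hx => ?_
    rw [uIoc_of_le h0] at hx
    exact Dk_eq N hx.1 (hx.2.trans h1)
  have h3 := SI ((2 * N + 1) * Real.pi) h0 h1
  rw [← h2, h, del_zero] at h3
  rw [abs_le] at *; constructor <;> linarith

theorem del_le2 (N : ℕ) {u : ℝ} (h0 : 0 < u) (h1 : u ≤ 1/2) : |del N u| ≤ 1 / ((N + 1) * u) := by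
  have h := del_sub N u (1/2)
  have h2 : ∫ x in u..(1/2), Dk N x =
      ∫ w in u..(1/2), (Real.sin (Real.pi * w))⁻¹ * Real.sin ((2 * N + 1) * Real.pi * w) := by
    apply intervalIntegral.integral_congr_ae
    refine Eventually.of_forall fun x hx => ?_
    rw [uIoc_of_le h1] at hx
    exact Dk_eq N (h0.trans hx.1) hx.2
  have hl : 0 < (2 * (N:ℝ) + 1) * Real.pi := by positivity
  have A2 := AMr (e := fun x => Real.sin ((2 * (N:ℝ) + 1) * Real.pi * x)) (by fun_prop) h0 h1 le_rfl
    (fun t _ => int_sin_le hl _ _)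
  rw [← h2, h, del_half, zero_sub, abs_neg] at A2
  refine A2.trans ?_
  have h5 := sin_pi_pos h0 h1
  have h6 := sin_pi_ge h0.le h1
  have h7 : (Real.sin (Real.pi * u))⁻¹ ≤ 1 / (2 * u) := by
    rw [one_div]; exact inv_anti₀ (by positivity) h6
  have h8 : 2 / ((2 * (N:ℝ) + 1) * Real.pi) ≤ 2 / ((N:ℝ) + 1) := by
    have := Real.pi_gt_three
    have hN : (0:ℝ) ≤ N := N.cast_nonneg
    gcongr
    nlinarith
  calc _ ≤ 2 / ((N:ℝ) + 1) * (1 / (2 * u)) := by gcongr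
    _ = _ := by field_simp

end Z6


namespace Z6
open MeasureTheory Set Filter Topology

theorem ph_d1 (P κ ν x : ℝ) : HasDerivAt (fun w => 2 * Real.pi * P * Real.exp (κ * w) + ν * w)
    (2 * Real.pi * P * κ * Real.exp (κ * x) + ν) x := by
  have h1 : HasDerivAt (fun w => κ * w) κ x := by simpa using (hasDerivAt_id x).const_mul κ
  have h2 : HasDerivAt (fun w => ν * w) ν x := by simpa using (hasDerivAt_id x).const_mul ν
  have := (h1.exp.const_mul (2 * Real.pi * P)).add h2
  have h : 2 * Real.pi * P * κ * Real.exp (κ * x) + ν = 2 * Real.pi * P * (Real.exp (κ * x) * κ) + ν := by ring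
  rw [h]; exact this

theorem ph_d2 (P κ ν x : ℝ) : HasDerivAt (fun w => 2 * Real.pi * P * κ * Real.exp (κ * w) + ν)
    (2 * Real.pi * P * κ ^ 2 * Real.exp (κ * x)) x := by
  have h1 : HasDerivAt (fun w => κ * w) κ x := by simpa using (hasDerivAt_id x).const_mul κ
  have := (h1.exp.const_mul (2 * Real.pi * P * κ)).add_const ν
  have h : 2 * Real.pi * P * κ ^ 2 * Real.exp (κ * x) = 2 * Real.pi * P * κ * (Real.exp (κ * x) * κ) := by ring
  rw [h]; exact this

noncomputable def cL (L : ℝ) : ℝ := L ^ 2 * Real.exp (-(L/2))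

theorem cL_pos {L : ℝ} (hL : 0 < L) : 0 < cL L := by unfold cL; positivity

theorem exp_lower {L κ w : ℝ} (hL : 0 < L) (hκ : |κ| = L) (hw : |w| ≤ 1/2) :
    Real.exp (-(L/2)) ≤ Real.exp (κ * w) := by
  apply Real.exp_le_exp.2
  have : |κ * w| ≤ L * (1/2) := by rw [abs_mul, hκ]; gcongr
  linarith [neg_abs_le (κ * w)]

theorem ph_vdC2 {L κ P : ℝ} (hL : 0 < L) (hκ : |κ| = L) (hP : 0 < P) (ν : ℝ) {a b : ℝ}
    (hab : a ≤ b) (ha : -(1/2) ≤ a) (hb : b ≤ 1/2) :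
    ‖∫ w in a..b, Complex.exp (Complex.I * ((2 * Real.pi * P * Real.exp (κ * w) + ν * w : ℝ) : ℂ))‖
      ≤ 8 / √(cL L * P) := by
  apply vdC2 hab (mul_pos (cL_pos hL) hP) (ph_d1 P κ ν) (ph_d2 P κ ν) (by fun_prop)
  intro x hx
  have h1 := exp_lower hL hκ (w := x) (abs_le.2 ⟨by linarith [hx.1], by linarith [hx.2]⟩)
  have h2 : κ ^ 2 = L ^ 2 := by rw [← hκ, sq_abs]
  rw [h2, cL]
  have := Real.pi_gt_three
  calc L^2 * Real.exp (-(L/2)) * P = P * L^2 * Real.exp (-(L/2)) := by ring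
    _ ≤ (2 * Real.pi) * (P * L^2 * Real.exp (-(L/2))) := le_mul_of_one_le_left (by positivity) (by linarith)
    _ ≤ (2 * Real.pi) * (P * L^2 * Real.exp (κ * x)) := by gcongr
    _ = _ := by ring

theorem J_outer {L κ P : ℝ} (hL : 0 < L) (hκ : |κ| = L) (hP : 0 < P) (N : ℕ) {δ : ℝ}
    (hδ : 0 < δ) (hδ1 : δ ≤ 1/2) :
    ‖∫ w in δ..(1/2), Complex.exp (Complex.I * ((2 * Real.pi * P * Real.exp (κ * w) : ℝ) : ℂ)) * (Dk N w : ℂ)‖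
      ≤ 8 / √(cL L * P) * (1 / (2 * δ)) := by
  set ν : ℝ := (2 * N + 1) * Real.pi
  set e : ℝ → ℂ := fun w => Complex.exp (Complex.I * ((2 * Real.pi * P * Real.exp (κ * w) : ℝ) : ℂ)) *
    (Real.sin (ν * w) : ℂ) with he
  have h1 : ∫ w in δ..(1/2), Complex.exp (Complex.I * ((2 * Real.pi * P * Real.exp (κ * w) : ℝ) : ℂ)) * (Dk N w : ℂ)
      = ∫ w in δ..(1/2), (((Real.sin (Real.pi * w))⁻¹ : ℝ) : ℂ) * e w := by
    apply intervalIntegral.integral_congr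
    intro w hw
    rw [uIcc_of_le hδ1] at hw
    simp only [he, ν]
    rw [Dk_eq N (hδ.trans_le hw.1) hw.2]
    push_cast; ring
  rw [h1]
  have h2 : ∀ t ∈ Icc δ (1/2), ‖∫ x in δ..t, e x‖ ≤ 8 / √(cL L * P) := by
    intro t ht
    have A := ph_vdC2 hL hκ hP ν ht.1 (by linarith) ht.2
    have B := ph_vdC2 hL hκ hP (-ν) ht.1 (by linarith) ht.2
    have e2 : ∫ x in δ..t, e x = (1 / (2 * Complex.I)) *
        ((∫ w in δ..t, Complex.exp (Complex.I * ((2 * Real.pi * P * Real.exp (κ * w) + ν * w : ℝ) : ℂ))) -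
        ∫ w in δ..t, Complex.exp (Complex.I * ((2 * Real.pi * P * Real.exp (κ * w) + (-ν) * w : ℝ) : ℂ))) := by
      rw [← intervalIntegral.integral_sub, ← intervalIntegral.integral_const_mul]
      · congr 1; ext w
        simp only [he]
        rw [Complex.ofReal_sin, Complex.sin]
        have a1 : Complex.exp (Complex.I * ((2 * Real.pi * P * Real.exp (κ * w) + ν * w : ℝ) : ℂ)) =
          Complex.exp (Complex.I * ((2 * Real.pi * P * Real.exp (κ * w) : ℝ) : ℂ)) * Complex.exp (((ν * w : ℝ) : ℂ) * Complex.I) := by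
          rw [← Complex.exp_add]; congr 1; push_cast; ring
        have a2 : Complex.exp (Complex.I * ((2 * Real.pi * P * Real.exp (κ * w) + (-ν) * w : ℝ) : ℂ)) =
          Complex.exp (Complex.I * ((2 * Real.pi * P * Real.exp (κ * w) : ℝ) : ℂ)) * Complex.exp (-((ν * w : ℝ) : ℂ) * Complex.I) := by
          rw [← Complex.exp_add]; congr 1; push_cast; ring
        rw [a1, a2, one_div, mul_inv, Complex.inv_I]; ring
      · apply Continuous.intervalIntegrable; fun_prop
      · apply Continuous.intervalIntegrable; fun_prop
    rw [e2, norm_mul]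
    have e3 : ‖(1 / (2 * Complex.I))‖ = 1/2 := by simp
    rw [e3]
    have := norm_sub_le (∫ w in δ..t, Complex.exp (Complex.I * ((2 * Real.pi * P * Real.exp (κ * w) + ν * w : ℝ) : ℂ)))
      (∫ w in δ..t, Complex.exp (Complex.I * ((2 * Real.pi * P * Real.exp (κ * w) + (-ν) * w : ℝ) : ℂ)))
    linarith
  refine (AM (by rw [he]; fun_prop) hδ hδ1 le_rfl h2).trans ?_
  gcongr
  rw [one_div]; exact inv_anti₀ (by positivity) (sin_pi_ge hδ.le hδ1)

theorem exp_I_sub (x y : ℝ) : ‖Complex.exp (Complex.I * x) - Complex.exp (Complex.I * y)‖ ≤ |x - y| := by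
  have : Complex.exp (Complex.I * x) - Complex.exp (Complex.I * y) =
      Complex.exp (y * Complex.I) * (Complex.exp (Complex.I * ((x - y : ℝ) : ℂ)) - 1) := by
    rw [mul_sub, ← Complex.exp_add, mul_one]; congr 2 <;> (push_cast; ring)
  rw [this, norm_mul, Complex.norm_exp_ofReal_mul_I, one_mul]
  exact Real.norm_exp_I_mul_ofReal_sub_one_le

theorem J_inner_err {L κ P : ℝ} (hκ : |κ| = L) (hP : 0 < P) (N : ℕ) {δ : ℝ}
    (hδ : 0 < δ) (hδ1 : δ ≤ 1/2) (hδL : L * δ ≤ 1) :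
    ‖∫ w in (0:ℝ)..δ, (Complex.exp (Complex.I * ((2 * Real.pi * P * (Real.exp (κ * w) - 1) : ℝ) : ℂ)) -
      Complex.exp (Complex.I * ((2 * Real.pi * P * (κ * w) : ℝ) : ℂ))) * (Dk N w : ℂ)‖
      ≤ 4 * P * L ^ 2 * δ ^ 2 := by
  have := intervalIntegral.norm_integral_le_of_norm_le_const (a := 0) (b := δ) (C := 4 * P * L^2 * δ)
    (f := fun w : ℝ => (Complex.exp (Complex.I * ((2 * Real.pi * P * (Real.exp (κ * w) - 1) : ℝ) : ℂ)) -
      Complex.exp (Complex.I * ((2 * Real.pi * P * (κ * w) : ℝ) : ℂ))) * (Dk N w : ℂ)) (by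
    intro w hw
    rw [uIoc_of_le hδ.le] at hw
    rw [norm_mul, Complex.norm_real, Real.norm_eq_abs]
    have h1 := exp_I_sub (2 * Real.pi * P * (Real.exp (κ * w) - 1)) (2 * Real.pi * P * (κ * w))
    have h2 : |κ * w| = L * w := by rw [abs_mul, hκ, abs_of_pos hw.1]
    have hL0 : 0 ≤ L := by rw [← hκ]; exact abs_nonneg _
    have h3 : |Real.exp (κ * w) - 1 - κ * w| ≤ (κ * w) ^ 2 :=
      Real.abs_exp_sub_one_sub_id_le (by rw [h2]; nlinarith [hw.2])
    rw [← sq_abs, h2] at h3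
    rw [← mul_sub, abs_mul, abs_of_pos (by positivity)] at h1
    have h4 := Dk_le N hw.1 (hw.2.trans hδ1)
    have h5 := Real.pi_lt_four
    have hw0 := hw.1
    calc _ ≤ (2 * 4 * P * (L * w)^2) * (1 / (2 * w)) := by
          gcongr
          refine h1.trans ?_
          gcongr
      _ = 4 * P * L^2 * w := by field_simp; try ring
      _ ≤ _ := by gcongr; exact hw.2)
  rw [sub_zero, abs_of_pos hδ] at this
  refine this.trans (le_of_eq (by ring))

theorem J_lin (N : ℕ) (q : ℝ) {δ : ℝ} (hδ : 0 < δ) (hδ1 : δ ≤ 1/2) :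
    |∫ w in (0:ℝ)..δ, 2 * Real.cos (q * w) * Dk N w| ≤ 4 := by
  set ν : ℝ := (2 * N + 1) * Real.pi
  have h : ∫ w in (0:ℝ)..δ, 2 * Real.cos (q * w) * Dk N w =
      (∫ w in (0:ℝ)..δ, (Real.sin (Real.pi * w))⁻¹ * Real.sin ((ν + q) * w)) +
      ∫ w in (0:ℝ)..δ, (Real.sin (Real.pi * w))⁻¹ * Real.sin ((ν - q) * w) := by
    rw [← intervalIntegral.integral_add (SI_int _ le_rfl hδ.le hδ1) (SI_int _ le_rfl hδ.le hδ1)]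
    apply intervalIntegral.integral_congr_ae
    refine Eventually.of_forall fun w hw => ?_
    rw [uIoc_of_le hδ.le] at hw
    rw [Dk_eq N hw.1 (hw.2.trans hδ1), show (ν + q) * w = ν * w + q * w by ring,
      show (ν - q) * w = ν * w - q * w by ring, Real.sin_add, Real.sin_sub]
    simp only [ν]
    ring
  rw [h]
  have := SI (ν + q) hδ.le hδ1
  have := SI (ν - q) hδ.le hδ1
  exact (abs_add_le _ _).trans (by linarith)

noncomputable def Jf (L P : ℝ) (N : ℕ) : ℂ := ∫ w in (-(1/2):ℝ)..(1/2),
  Complex.exp (Complex.I * ((2 * Real.pi * P * Real.exp (L * w) : ℝ) : ℂ)) * (Dk N w : ℂ)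

theorem J_unif {L P : ℝ} (hL : 0 < L) (hP : 1 ≤ P) (N : ℕ) :
    ‖Jf L P N‖ ≤ 16 * (1 + L) / √(cL L) + 2 * L ^ 2 + 4 := by
  have hP0 : 0 < P := by linarith
  set E : ℝ → ℝ → ℂ := fun κ w => Complex.exp (Complex.I * ((2 * Real.pi * P * Real.exp (κ * w) : ℝ) : ℂ)) * (Dk N w : ℂ) with hE
  have hEc : ∀ κ, Continuous (E κ) := fun κ => by
    have := Dk_cont N
    simp only [hE]; fun_prop
  have hEi : ∀ κ a b, IntervalIntegrable (E κ) volume a b := fun κ a b => (hEc κ).intervalIntegrable _ _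
  set δ : ℝ := 1 / (2 * (1 + L) * √P) with hδd
  have hsP : 1 ≤ √P := by rw [Real.one_le_sqrt]; exact hP
  have hδ : 0 < δ := by positivity
  have hδ1 : δ ≤ 1/2 := by
    rw [hδd]
    apply one_div_le_one_div_of_le (by norm_num)
    nlinarith
  have hδL : L * δ ≤ 1 := by
    rw [hδd, mul_one_div, div_le_one (by positivity)]
    nlinarith
  have hPδ : 4 * P * L^2 * δ^2 ≤ L^2 := by
    have : δ^2 = 1 / (4 * (1+L)^2 * P) := by
      rw [hδd, div_pow, mul_pow, Real.sq_sqrt hP0.le]; ring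
    rw [this]
    have : 4 * P * L^2 * (1 / (4 * (1+L)^2 * P)) = L^2 / (1+L)^2 := by field_simp
    rw [this]
    apply div_le_self (by positivity)
    nlinarith
  have h0 : Jf L P N = (∫ w in (0:ℝ)..(1/2), E L w) + ∫ w in (0:ℝ)..(1/2), E (-L) w := by
    rw [Jf, ← intervalIntegral.integral_add_adjacent_intervals (hEi L (-(1/2)) 0) (hEi L 0 (1/2)), add_comm]
    congr 1
    have := intervalIntegral.integral_comp_neg (E (-L)) (a := -(1/2)) (b := 0)
    rw [neg_zero, neg_neg] at this
    rw [← this]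
    congr 1; ext w
    simp only [hE, Dk_even, neg_mul_neg]
  have hsplit : ∀ κ, ∫ w in (0:ℝ)..(1/2), E κ w = (∫ w in (0:ℝ)..δ, E κ w) + ∫ w in δ..(1/2), E κ w :=
    fun κ => (intervalIntegral.integral_add_adjacent_intervals (hEi κ _ _) (hEi κ _ _)).symm
  have hout : ∀ κ, |κ| = L → ‖∫ w in δ..(1/2), E κ w‖ ≤ 8 * (1 + L) / √(cL L) := by
    intro κ hκ
    refine (J_outer hL hκ hP0 N hδ hδ1).trans (le_of_eq ?_)
    rw [Real.sqrt_mul (cL_pos hL).le, hδd]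
    have : √(cL L) ≠ 0 := (Real.sqrt_pos.2 (cL_pos hL)).ne'
    field_simp
  set Z : ℝ → ℝ → ℂ := fun κ w => (Complex.exp (Complex.I * ((2 * Real.pi * P * (Real.exp (κ * w) - 1) : ℝ) : ℂ)) -
      Complex.exp (Complex.I * ((2 * Real.pi * P * (κ * w) : ℝ) : ℂ))) * (Dk N w : ℂ) with hZ
  have hZi : ∀ κ a b, IntervalIntegrable (Z κ) volume a b := fun κ a b => by
    have := Dk_cont N
    apply Continuous.intervalIntegrable; simp only [hZ]; fun_prop
  have hin : (∫ w in (0:ℝ)..δ, E L w) + (∫ w in (0:ℝ)..δ, E (-L) w) =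
      Complex.exp (((2 * Real.pi * P : ℝ) : ℂ) * Complex.I) * ((∫ w in (0:ℝ)..δ, Z L w) + (∫ w in (0:ℝ)..δ, Z (-L) w) +
        ((∫ w in (0:ℝ)..δ, 2 * Real.cos (2 * Real.pi * P * L * w) * Dk N w : ℝ) : ℂ)) := by
    have := Dk_cont N
    rw [← intervalIntegral.integral_ofReal, ← intervalIntegral.integral_add (hEi _ _ _) (hEi _ _ _),
      ← intervalIntegral.integral_add (hZi _ _ _) (hZi _ _ _), ← intervalIntegral.integral_add
      ((hZi _ _ _).add (hZi _ _ _)) (by apply Continuous.intervalIntegrable; fun_prop),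
      ← intervalIntegral.integral_const_mul]
    congr 1; ext w
    simp only [hE, hZ]
    have hcos : ((2 * Real.cos (2 * Real.pi * P * L * w) * Dk N w : ℝ) : ℂ) =
      (Complex.exp (Complex.I * ((2 * Real.pi * P * (L * w) : ℝ) : ℂ)) +
        Complex.exp (Complex.I * ((2 * Real.pi * P * (-L * w) : ℝ) : ℂ))) * (Dk N w : ℂ) := by
      rw [Complex.ofReal_mul, Complex.ofReal_mul, Complex.ofReal_cos, Complex.cos]
      push_cast
      congr 1
      rw [mul_div_cancel₀ _ (by norm_num)]
      congr 2 <;> ring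
    have hx : ∀ κ, Complex.exp (Complex.I * ((2 * Real.pi * P * Real.exp (κ * w) : ℝ) : ℂ)) =
      Complex.exp (((2 * Real.pi * P : ℝ) : ℂ) * Complex.I) *
        Complex.exp (Complex.I * ((2 * Real.pi * P * (Real.exp (κ * w) - 1) : ℝ) : ℂ)) := by
      intro κ
      rw [← Complex.exp_add]; congr 1; push_cast; ring
    rw [hcos, hx L, hx (-L)]
    ring
  have hinb : ‖(∫ w in (0:ℝ)..δ, E L w) + (∫ w in (0:ℝ)..δ, E (-L) w)‖ ≤ 2 * L^2 + 4 := by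
    rw [hin, norm_mul, Complex.norm_exp_ofReal_mul_I, one_mul]
    have a1 := (J_inner_err (abs_of_pos hL) hP0 N hδ hδ1 hδL).trans hPδ
    have a2 := (J_inner_err (κ := -L) (L := L) (by rw [abs_neg, abs_of_pos hL]) hP0 N hδ hδ1 hδL).trans hPδ
    have a3 := J_lin N (2 * Real.pi * P * L) hδ hδ1
    calc _ ≤ L^2 + L^2 + 4 := by
          refine (norm_add_le _ _).trans (add_le_add ((norm_add_le _ _).trans (add_le_add a1 a2)) ?_)
          rw [Complex.norm_real]; exact a3
      _ = _ := by ring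
  rw [h0, hsplit, hsplit]
  have b1 := hout L (abs_of_pos hL)
  have b2 := hout (-L) (by rw [abs_neg, abs_of_pos hL])
  calc _ = ‖((∫ w in (0:ℝ)..δ, E L w) + (∫ w in (0:ℝ)..δ, E (-L) w)) + (∫ w in δ..(1/2), E L w) + ∫ w in δ..(1/2), E (-L) w‖ := by
        congr 1; ring
    _ ≤ (2 * L^2 + 4) + 8 * (1 + L) / √(cL L) + 8 * (1 + L) / √(cL L) :=
        (norm_add_le _ _).trans (add_le_add ((norm_add_le _ _).trans (add_le_add hinb b1)) b2)
    _ = _ := by ring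

theorem ph_vdC1 {L P : ℝ} (hL : 0 < L) (hP : 0 < P) {n : ℝ}
    (hn : 2 * |n| ≤ P * L * Real.exp (-(L/2))) :
    ‖∫ w in (-(1/2):ℝ)..(1/2), Complex.exp (Complex.I * ((2 * Real.pi * P * Real.exp (L * w) + 2 * Real.pi * n * w : ℝ) : ℂ))‖
      ≤ 3 / (P * L * Real.exp (-(L/2))) := by
  apply vdC1 (by norm_num) (by positivity) (ph_d1 P L (2 * Real.pi * n)) (ph_d2 P L (2 * Real.pi * n)) (by fun_prop)
  · intro x _; positivity
  intro x hx
  have h1 := exp_lower hL (abs_of_pos hL) (w := x) (abs_le.2 ⟨by linarith [hx.1], by linarith [hx.2]⟩)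
  have h2 : P * L * Real.exp (-(L/2)) ≤ P * L * Real.exp (L * x) := by gcongr
  have h3 := neg_abs_le n
  have h4 := Real.pi_gt_three
  set X := P * L * Real.exp (L * x)
  have hX : 0 < P * L * Real.exp (-(L/2)) := by positivity
  have : 2 * Real.pi * P * L * Real.exp (L * x) + 2 * Real.pi * n = 2 * Real.pi * (X + n) := by
    simp only [X]; ring
  rw [this]
  nlinarith

theorem J_high {L P : ℝ} (hL : 0 < L) (hP : 0 < P) (N : ℕ)
    (hn : 2 * N ≤ P * L * Real.exp (-(L/2))) :
    ‖Jf L P N‖ ≤ (2 * N + 1) * (3 / (P * L * Real.exp (-(L/2)))) := by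
  set B := 3 / (P * L * Real.exp (-(L/2)))
  set F : ℝ → ℂ := fun n => ∫ w in (-(1/2):ℝ)..(1/2), Complex.exp (Complex.I * ((2 * Real.pi * P * Real.exp (L * w) + 2 * Real.pi * n * w : ℝ) : ℂ)) with hF
  have h1 : Jf L P N = F 0 + ∑ n ∈ Finset.range N, (F ((n:ℝ)+1) + F (-((n:ℝ)+1))) := by
    have hc : ∀ n a b, IntervalIntegrable (fun w : ℝ => Complex.exp (Complex.I * ((2 * Real.pi * P * Real.exp (L * w) + 2 * Real.pi * n * w : ℝ) : ℂ))) volume a b :=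
      fun n a b => by apply Continuous.intervalIntegrable; fun_prop
    have hs : ∑ n ∈ Finset.range N, (F ((n:ℝ)+1) + F (-((n:ℝ)+1))) = ∫ w in (-(1/2):ℝ)..(1/2),
       ∑ n ∈ Finset.range N, (Complex.exp (Complex.I * ((2 * Real.pi * P * Real.exp (L * w) + 2 * Real.pi * ((n:ℝ)+1) * w : ℝ) : ℂ))
        + Complex.exp (Complex.I * ((2 * Real.pi * P * Real.exp (L * w) + 2 * Real.pi * (-((n:ℝ)+1)) * w : ℝ) : ℂ))) := by
      rw [intervalIntegral.integral_finsetSum]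
      · refine Finset.sum_congr rfl fun n _ => ?_
        rw [intervalIntegral.integral_add (hc _ _ _) (hc _ _ _)]
      · intro n _; exact (hc _ _ _).add (hc _ _ _)
    rw [hs, hF, ← intervalIntegral.integral_add (hc _ _ _) (by apply Continuous.intervalIntegrable; fun_prop), Jf]
    congr 1; ext w
    simp only [Dk]
    rw [Complex.ofReal_add, mul_add, Finset.mul_sum, Complex.ofReal_sum, Finset.mul_sum]
    congr 1
    · simp
    · refine Finset.sum_congr rfl fun n _ => ?_
      have a0 : ((2 * Real.cos (2 * Real.pi * ((n:ℝ)+1) * w) : ℝ) : ℂ) = Complex.exp (((2 * Real.pi * ((n:ℝ)+1) * w : ℝ) : ℂ) * Complex.I) + Complex.exp (-((2 * Real.pi * ((n:ℝ)+1) * w : ℝ) : ℂ) * Complex.I) := by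
        rw [Complex.ofReal_mul, Complex.ofReal_cos, Complex.cos]; push_cast; ring
      rw [a0]
      have a1 : Complex.exp (Complex.I * ((2 * Real.pi * P * Real.exp (L * w) + 2 * Real.pi * ((n:ℝ)+1) * w : ℝ) : ℂ)) =
          Complex.exp (Complex.I * ((2 * Real.pi * P * Real.exp (L * w) : ℝ) : ℂ)) * Complex.exp (((2 * Real.pi * ((n:ℝ)+1) * w : ℝ) : ℂ) * Complex.I) := by
          rw [← Complex.exp_add]; congr 1; push_cast; ring
      have a2 : Complex.exp (Complex.I * ((2 * Real.pi * P * Real.exp (L * w) + 2 * Real.pi * (-((n:ℝ)+1)) * w : ℝ) : ℂ)) =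
          Complex.exp (Complex.I * ((2 * Real.pi * P * Real.exp (L * w) : ℝ) : ℂ)) * Complex.exp (-((2 * Real.pi * ((n:ℝ)+1) * w : ℝ) : ℂ) * Complex.I) := by
          rw [← Complex.exp_add]; congr 1; push_cast; ring
      rw [a1, a2]; ring
  have hb : ∀ n : ℝ, |n| ≤ N → ‖F n‖ ≤ B := fun n hn' => ph_vdC1 hL hP (by linarith)
  rw [h1]
  refine (norm_add_le _ _).trans ?_
  have h2 : ‖∑ n ∈ Finset.range N, (F ((n:ℝ)+1) + F (-((n:ℝ)+1)))‖ ≤ N * (2 * B) := by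
    refine (norm_sum_le _ _).trans ((Finset.sum_le_card_nsmul _ _ (2 * B) ?_).trans (by simp))
    intro n hn'
    have hn2 : |(n:ℝ)+1| ≤ N := by
      rw [abs_of_pos (by positivity)]
      exact_mod_cast Finset.mem_range.1 hn'
    have := hb _ hn2
    have := hb (-((n:ℝ)+1)) (by rwa [abs_neg])
    exact (norm_add_le _ _).trans (by linarith)
  have := hb 0 (by simp)
  linarith

theorem J_bound {L : ℝ} (hL : 0 < L) : ∃ C : ℝ, 0 < C ∧ ∀ P : ℝ, 1 ≤ P → ∀ N : ℕ, 1 ≤ N →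
    ‖Jf L P N‖ ≤ C * √(N / P) := by
  set c := L * Real.exp (-(L/2)) with hc
  have hc0 : 0 < c := by positivity
  set U := 16 * (1 + L) / √(cL L) + 2 * L ^ 2 + 4 with hU
  have hU0 : 0 < U := by
    have := Real.sqrt_pos.2 (cL_pos hL); positivity
  refine ⟨U * √(2/c) + 9 / c * √(c/2+1), by positivity, fun P hP N hN => ?_⟩
  have hN0 : (1:ℝ) ≤ N := by exact_mod_cast hN
  have hP0 : 0 < P := by linarith
  rw [add_mul]
  by_cases h : 2 * N ≤ P * L * Real.exp (-(L/2))
  · have h1 := J_high hL hP0 N h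
    rw [mul_assoc, ← hc] at h h1
    have h2 : (N:ℝ)/P ≤ √(c/2+1) * √(N/P) := by
      have h3 : (N:ℝ)/P ≤ c/2+1 := by rw [div_le_iff₀ hP0]; nlinarith
      have h4 : (0:ℝ) ≤ N/P := by positivity
      calc (N:ℝ)/P = √(N/P) * √(N/P) := (Real.mul_self_sqrt h4).symm
        _ ≤ _ := by gcongr
    have h5 : (2 * (N:ℝ) + 1) * (3 / (P * c)) ≤ 9 / c * (N / P) := by
      have : 9 / c * (N / P) = (3 * N) * (3 / (P * c)) := by field_simp; norm_num
      rw [this]; gcongr; linarith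
    have h6 : 0 ≤ U * √(2/c) * √(N/P) := by positivity
    calc _ ≤ 9 / c * (N/P) := h1.trans h5
      _ ≤ 9 / c * (√(c/2+1) * √(N/P)) := by gcongr
      _ ≤ _ := by rw [mul_assoc (9/c)]; linarith
  · push Not at h
    have h1 := J_unif hL hP N
    rw [mul_assoc, ← hc] at h
    have h2 : 1 ≤ √(2/c) * √(N/P) := by
      rw [← Real.sqrt_mul (by positivity), Real.one_le_sqrt]
      rw [div_mul_div_comm, le_div_iff₀ (by positivity)]
      linarith
    have h3 : 0 ≤ 9 / c * √(c/2+1) * √(N/P) := by positivity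
    calc _ ≤ U * 1 := by rw [mul_one]; exact h1
      _ ≤ U * (√(2/c) * √(N/P)) := by gcongr
      _ ≤ _ := by rw [mul_assoc U]; linarith

end Z6


namespace Z6
open MeasureTheory Set Filter Topology

noncomputable def Bf (K : ℕ) (y : ℝ) : ℝ := bernoulliFun K (Int.fract y)

noncomputable def ee (x : ℝ) : ℂ := Complex.exp (Complex.I * ((2 * Real.pi * x : ℝ) : ℂ))

theorem ee_cont : Continuous ee := by unfold ee; fun_prop

theorem ee_norm (x : ℝ) : ‖ee x‖ = 1 := by
  unfold ee; rw [mul_comm]; exact Complex.norm_exp_ofReal_mul_I _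

theorem ee_add (x y : ℝ) : ee (x + y) = ee x * ee y := by
  unfold ee; rw [← Complex.exp_add]; congr 1; push_cast; ring

theorem ee_int (n : ℤ) : ee n = 1 := by
  unfold ee
  rw [Complex.exp_eq_one_iff]
  exact ⟨n, by push_cast; ring⟩

theorem ee_fract (m : ℤ) (y : ℝ) : ee (m * Int.fract y) = ee (m * y) := by
  have : (m:ℝ) * y = m * Int.fract y + ((m * ⌊y⌋ : ℤ) : ℝ) := by
    conv_lhs => rw [← Int.floor_add_fract y]
    push_cast; ring
  rw [this, ee_add, ee_int, mul_one]

theorem Bf_bdd (K : ℕ) : ∃ C : ℝ, 0 < C ∧ ∀ y, |Bf K y| ≤ C := by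
  obtain ⟨C, hC⟩ := (isCompact_Icc (a := (0:ℝ)) (b := 1)).exists_bound_of_continuousOn
    (continuous_bernoulliFun K).continuousOn
  refine ⟨max C 1, by positivity, fun y => (hC _ ⟨Int.fract_nonneg y, (Int.fract_lt_one y).le⟩).trans (le_max_left _ _)⟩

theorem Bf_meas (K : ℕ) : Measurable (Bf K) :=
  (continuous_bernoulliFun K).measurable.comp measurable_fract

noncomputable def cc (K : ℕ) (m : ℕ) : ℂ := -(K.factorial : ℂ) / (2 * Real.pi * Complex.I * m) ^ K
noncomputable def cd (K : ℕ) (m : ℕ) : ℂ := -(K.factorial : ℂ) / (-(2 * Real.pi * Complex.I * m)) ^ K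

noncomputable def SF (K X : ℕ) (y : ℝ) : ℂ := ∑ m ∈ Finset.range X, (cc K m * ee (m * y) + cd K m * ee (-(m * y)))

theorem cc_bd (K : ℕ) (m : ℕ) : ‖cc K m‖ = K.factorial / (2 * Real.pi * m) ^ K ∧
    ‖cd K m‖ = K.factorial / (2 * Real.pi * m) ^ K := by
  have := Real.pi_pos
  constructor
  · simp [cc, abs_of_pos this]
  · simp [cd, abs_of_pos this]

theorem cc_le {K : ℕ} (hK : 1 ≤ K) (m : ℕ) : (K.factorial : ℝ) / (2 * Real.pi * m) ^ K ≤ K.factorial / m := by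
  rcases Nat.eq_zero_or_pos m with rfl | hm
  · simp; rw [zero_pow (by omega)]; simp
  have hm' : (1:ℝ) ≤ m := by exact_mod_cast hm
  have := Real.pi_gt_three
  gcongr
  have h1 : (m:ℝ) ≤ 2 * Real.pi * m := by nlinarith
  exact h1.trans (le_self_pow₀ (by linarith) (by omega))

theorem SF_one (N : ℕ) (y : ℝ) (u : ℝ) (hu : u = Int.fract y) :
    SF 1 (N+1) y = (((u - 1/2) - del N u : ℝ) : ℂ) := by
  rw [SF, Finset.sum_range_succ']
  have h0 : cc 1 0 * ee ((0:ℕ) * y) + cd 1 0 * ee (-((0:ℕ) * y)) = 0 := by simp [cc, cd]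
  rw [h0, add_zero, del, sub_add_cancel_left, Complex.ofReal_neg, Complex.ofReal_sum, ← Finset.sum_neg_distrib]
  refine Finset.sum_congr rfl fun n _ => ?_
  have e1 := ee_fract ((n+1 : ℕ) : ℤ) y
  have e2 := ee_fract (-((n+1 : ℕ) : ℤ)) y
  rw [← hu] at e1 e2
  have e3 : ee (((n+1:ℕ):ℝ) * y) = Complex.exp (((2 * Real.pi * ((n:ℝ)+1) * u : ℝ) : ℂ) * Complex.I) := by
    rw [show ((n+1:ℕ):ℝ) * y = (((n+1 : ℕ) : ℤ) : ℝ) * y by push_cast; ring, ← e1, ee]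
    congr 1; push_cast; ring
  have e4 : ee (-(((n+1:ℕ):ℝ) * y)) = Complex.exp (-((2 * Real.pi * ((n:ℝ)+1) * u : ℝ) : ℂ) * Complex.I) := by
    rw [show -(((n+1:ℕ):ℝ) * y) = ((-((n+1 : ℕ) : ℤ) : ℤ) : ℝ) * y by push_cast; ring, ← e2, ee]
    congr 1; push_cast; ring
  rw [e3, e4, Complex.ofReal_div, Complex.ofReal_sin, Complex.sin, cc, cd]
  have hn : (n:ℂ) + 1 ≠ 0 := by exact_mod_cast Nat.succ_ne_zero n
  have hp : (Real.pi : ℂ) ≠ 0 := by exact_mod_cast Real.pi_ne_zero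
  have hI := Complex.I_ne_zero
  have hI2 := Complex.I_sq
  push_cast
  field_simp
  rw [hI2]
  simp
  ring

theorem del_le1' (N : ℕ) {u : ℝ} (h0 : 0 ≤ u) (h1 : u ≤ 1) : |del N u| ≤ 3 := by
  rcases le_total u (1/2) with h | h
  · exact del_le1 N h0 h
  · have := del_le1 N (u := 1 - u) (by linarith) (by linarith)
    rwa [del_one_sub, abs_neg] at this

theorem del_tendsto {u : ℝ} (h0 : 0 < u) (h1 : u < 1) : Tendsto (fun N => del N u) atTop (𝓝 0) := by
  have key : ∀ v : ℝ, 0 < v → v ≤ 1/2 → Tendsto (fun N => del N v) atTop (𝓝 0) := by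
    intro v hv hv1
    apply squeeze_zero_norm (fun N => del_le2 N hv hv1)
    have := (tendsto_one_div_add_atTop_nhds_zero_nat (𝕜 := ℝ)).mul_const (1/v)
    rw [zero_mul] at this
    refine this.congr fun N => ?_
    rw [div_mul_div_comm, one_mul]
  rcases le_total u (1/2) with h | h
  · exact key u h0 h
  · have := (key (1-u) (by linarith) (by linarith)).neg
    simpa [del_one_sub] using this

theorem SF_bdd {K : ℕ} (hK : 1 ≤ K) : ∃ C : ℝ, 0 < C ∧ ∀ X y, ‖SF K X y‖ ≤ C := by
  rcases hK.eq_or_lt with rfl | hK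
  · refine ⟨4, by norm_num, fun X y => ?_⟩
    rcases X with _ | N
    · simp [SF]
    · rw [SF_one N y _ rfl, Complex.norm_real, Real.norm_eq_abs]
      have h0 := Int.fract_nonneg y
      have h1 := (Int.fract_lt_one y).le
      have := abs_le.1 (del_le1' N h0 h1)
      rw [abs_le]; constructor <;> linarith [this.1, this.2]
  · have hs : Summable (fun m : ℕ => 2 * ((K.factorial : ℝ) * (1 / (m:ℝ)^K))) :=
      ((Real.summable_one_div_nat_pow.2 (by omega)).mul_left _).mul_left _
    refine ⟨∑' m : ℕ, 2 * ((K.factorial : ℝ) * (1 / (m:ℝ)^K)) + 1, by positivity, fun X y => ?_⟩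
    have : ‖SF K X y‖ ≤ ∑ m ∈ Finset.range X, 2 * ((K.factorial : ℝ) * (1 / (m:ℝ)^K)) := by
      refine (norm_sum_le _ _).trans (Finset.sum_le_sum fun m _ => ?_)
      refine (norm_add_le _ _).trans ?_
      rw [norm_mul, norm_mul, ee_norm, ee_norm, (cc_bd K m).1, (cc_bd K m).2, mul_one, ← two_mul]
      gcongr
      rcases Nat.eq_zero_or_pos m with rfl | hm
      · simp; rw [zero_pow (by omega)]; simp
      have hm' : (1:ℝ) ≤ m := by exact_mod_cast hm
      have := Real.pi_gt_three
      rw [mul_one_div]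
      gcongr
      nlinarith
    have h2 := hs.sum_le_tsum (Finset.range X) (fun m _ => by positivity)
    linarith

theorem SF_tendsto {K : ℕ} (hK : 1 ≤ K) {y : ℝ} (hy : Int.fract y ≠ 0) :
    Tendsto (fun X => SF K X y) atTop (𝓝 (Bf K y : ℂ)) := by
  rcases hK.eq_or_lt with rfl | hK
  · rw [← tendsto_add_atTop_iff_nat 1]
    have h0 := (Int.fract_nonneg y).lt_of_ne' hy
    have h := (del_tendsto h0 (Int.fract_lt_one y)).const_sub (Int.fract y - 1/2)
    rw [sub_zero] at h
    have h2 := (Complex.continuous_ofReal.tendsto _).comp h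
    rw [Bf, bernoulliFun_one]
    refine h2.congr fun N => ?_
    rw [SF_one N y _ rfl]; rfl
  · have h := (hasSum_one_div_nat_pow_mul_fourier hK (x := Int.fract y)
      ⟨Int.fract_nonneg y, (Int.fract_lt_one y).le⟩).tendsto_sum_nat
    have hI := Complex.I_ne_zero
    have hp : (Real.pi : ℂ) ≠ 0 := by exact_mod_cast Real.pi_ne_zero
    have hf : (K.factorial : ℂ) ≠ 0 := by exact_mod_cast K.factorial_ne_zero
    have h2 := h.const_mul (-(K.factorial : ℂ) / (2 * Real.pi * Complex.I) ^ K)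
    have e : (-(K.factorial : ℂ) / (2 * Real.pi * Complex.I) ^ K) *
       (-(2 * Real.pi * Complex.I) ^ K / (K.factorial : ℂ) * (bernoulliFun K (Int.fract y) : ℂ)) = (Bf K y : ℂ) := by
      rw [Bf]; field_simp
    rw [e] at h2
    refine h2.congr fun X => ?_
    rw [SF, Finset.mul_sum]
    refine Finset.sum_congr rfl fun m _ => ?_
    have e1 : fourier (m:ℤ) ((Int.fract y : ℝ) : UnitAddCircle) = ee (m * y) := by
      have := ee_fract m y
      push_cast at this
      rw [fourier_coe_apply, ← this, ee]; congr 1; push_cast; ring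
    have e2 : fourier (-(m:ℤ)) ((Int.fract y : ℝ) : UnitAddCircle) = ee (-(m * y)) := by
      have := ee_fract (-m) y
      push_cast at this
      rw [fourier_coe_apply, ← neg_mul, ← this, ee]; congr 1; push_cast; ring
    rw [e1, e2, cc, cd, neg_pow (2 * (Real.pi:ℂ) * Complex.I * m), mul_pow (2 * (Real.pi:ℂ) * Complex.I)]
    have h1 : ((-1:ℂ)^K) * (-1)^K = 1 := by rw [← mul_pow]; simp
    have h3 : ((-1:ℂ)^K)⁻¹ = (-1)^K := inv_eq_of_mul_eq_one_left h1
    simp only [div_eq_mul_inv, mul_inv, h3]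
    ring

theorem FB {K : ℕ} (hK : 1 ≤ K) : ∃ C : ℝ, 0 < C ∧ ∀ (φ : ℝ → ℝ) (G : ℝ → ℂ) (a b D : ℝ), Continuous φ →
    Continuous G → (∀ᵐ w, Int.fract (φ w) ≠ 0) → 0 ≤ D →
    (∀ m : ℕ, 1 ≤ m → ‖∫ w in a..b, ee (m * φ w) * G w‖ ≤ D / √m) →
    (∀ m : ℕ, 1 ≤ m → ‖∫ w in a..b, ee (-(m * φ w)) * G w‖ ≤ D / √m) →
    ‖∫ w in a..b, (Bf K (φ w) : ℂ) * G w‖ ≤ C * D := by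
  obtain ⟨C1, hC1, hS⟩ := SF_bdd hK
  have hs : Summable (fun m : ℕ => 2 * ((K.factorial : ℝ) * (1 / (m:ℝ)^(3/2:ℝ)))) :=
      ((Real.summable_one_div_nat_rpow.2 (by norm_num)).mul_left _).mul_left _
  refine ⟨∑' m : ℕ, 2 * ((K.factorial : ℝ) * (1 / (m:ℝ)^(3/2:ℝ))) + 1, by positivity, ?_⟩
  intro φ G a b D hφ hG hae hD h1 h2
  have hec := ee_cont
  have hSc : ∀ X, Continuous (fun w => SF K X (φ w)) := fun X => by unfold SF; fun_prop
  have lim : Tendsto (fun X => ∫ w in a..b, SF K X (φ w) * G w) atTop (𝓝 (∫ w in a..b, (Bf K (φ w) : ℂ) * G w)) := by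
    apply intervalIntegral.tendsto_integral_filter_of_dominated_convergence (fun w => C1 * ‖G w‖)
    · refine Eventually.of_forall fun X => ?_
      have := hSc X
      exact Continuous.aestronglyMeasurable (by fun_prop)
    · refine Eventually.of_forall fun X => Eventually.of_forall fun w _ => ?_
      rw [norm_mul]; gcongr; exact hS _ _
    · apply Continuous.intervalIntegrable; fun_prop
    · filter_upwards [hae] with w hw _
      exact (SF_tendsto hK hw).mul_const _
  refine le_of_tendsto lim.norm (Eventually.of_forall fun X => ?_)
  have e : ∫ w in a..b, SF K X (φ w) * G w = ∑ m ∈ Finset.range X,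
     (cc K m * (∫ w in a..b, ee (m * φ w) * G w) + cd K m * ∫ w in a..b, ee (-(m * φ w)) * G w) := by
    simp only [← intervalIntegral.integral_const_mul]
    have i1 : ∀ m : ℕ, IntervalIntegrable (fun w => cc K m * (ee (m * φ w) * G w)) volume a b := fun m => by
      apply Continuous.intervalIntegrable; fun_prop
    have i2 : ∀ m : ℕ, IntervalIntegrable (fun w => cd K m * (ee (-(m * φ w)) * G w)) volume a b := fun m => by
      apply Continuous.intervalIntegrable; fun_prop
    simp only [← intervalIntegral.integral_add (i1 _) (i2 _)]
    rw [← intervalIntegral.integral_finsetSum (fun m _ => (i1 m).add (i2 m))]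
    congr 1; ext w
    rw [SF, Finset.sum_mul]
    refine Finset.sum_congr rfl fun m _ => by ring
  rw [e]
  have : ‖∑ m ∈ Finset.range X, (cc K m * (∫ w in a..b, ee (m * φ w) * G w) + cd K m * ∫ w in a..b, ee (-(m * φ w)) * G w)‖
      ≤ ∑ m ∈ Finset.range X, 2 * ((K.factorial : ℝ) * (1 / (m:ℝ)^(3/2:ℝ))) * D := by
    refine (norm_sum_le _ _).trans (Finset.sum_le_sum fun m _ => ?_)
    rcases Nat.eq_zero_or_pos m with rfl | hm
    · have : K ≠ 0 := by omega
      simp [cc, cd, this]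
    refine (norm_add_le _ _).trans ?_
    rw [norm_mul, norm_mul, (cc_bd K m).1, (cc_bd K m).2]
    have c := cc_le hK m
    have hm' : (0:ℝ) < m := by exact_mod_cast hm
    have e3 : (m:ℝ)^(3/2:ℝ) = m * √m := by
      rw [show (3/2:ℝ) = 1 + 1/2 by norm_num, Real.rpow_add hm', Real.rpow_one, Real.sqrt_eq_rpow]
    have g1 : (K.factorial : ℝ) / (2 * Real.pi * m) ^ K * ‖∫ w in a..b, ee (m * φ w) * G w‖ ≤ K.factorial / m * (D / √m) := by
      gcongr; exact h1 m hm
    have g2 : (K.factorial : ℝ) / (2 * Real.pi * m) ^ K * ‖∫ w in a..b, ee (-(m * φ w)) * G w‖ ≤ K.factorial / m * (D / √m) := by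
      gcongr; exact h2 m hm
    refine (add_le_add g1 g2).trans (le_of_eq ?_)
    rw [e3]; field_simp; try ring
  refine this.trans ?_
  rw [← Finset.sum_mul]
  gcongr
  have := hs.sum_le_tsum (Finset.range X) (fun m _ => by positivity)
  linarith

end Z6


namespace Z6
open MeasureTheory Set Filter Topology

theorem ae_frac {L M : ℝ} (hL : L ≠ 0) (hM : M ≠ 0) : ∀ᵐ w : ℝ, Int.fract (M * Real.exp (L * w)) ≠ 0 := by
  have hc : (range ((↑) : ℤ → ℝ)).Countable := countable_range _
  have hinj : Function.Injective (fun w : ℝ => M * Real.exp (L * w)) := by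
    intro x y h
    have := Real.exp_injective (mul_left_cancel₀ hM h)
    exact mul_left_cancel₀ hL this
  have h2 := hc.preimage hinj
  have h3 := h2.measure_zero volume
  rw [ae_iff]
  refine measure_mono_null ?_ h3
  intro w hw
  simp only [ne_eq, not_not, mem_ofPred_eq] at hw
  rw [Int.fract_eq_iff] at hw
  obtain ⟨_, _, z, hz⟩ := hw
  exact ⟨z, by simpa using hz.symm⟩

theorem ee_neg (x : ℝ) : ee (-x) = (starRingEnd ℂ) (ee x) := by
  unfold ee; rw [← Complex.exp_conj, map_mul, Complex.conj_I, Complex.conj_ofReal]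
  congr 1; push_cast; ring

theorem conj_int (f : ℝ → ℂ) (a b : ℝ) : ∫ w in a..b, (starRingEnd ℂ) (f w) = (starRingEnd ℂ) (∫ w in a..b, f w) := by
  simp only [intervalIntegral, map_sub, integral_conj]

theorem High {L : ℝ} (hL : 0 < L) {K : ℕ} (hK : 1 ≤ K) : ∃ C : ℝ, 0 < C ∧ ∀ M : ℝ, 1 ≤ M → ∀ N : ℕ, 1 ≤ N →
    ‖∫ w in (-(1/2):ℝ)..(1/2), (Bf K (M * Real.exp (L * w)) : ℂ) * (Dk N w : ℂ)‖ ≤ C * √(N / M) := by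
  obtain ⟨C1, hC1, h1⟩ := FB hK
  obtain ⟨C2, hC2, h2⟩ := J_bound hL
  refine ⟨C1 * C2, by positivity, fun M hM N hN => ?_⟩
  have := Dk_cont N
  have hM0 : 0 < M := by linarith
  have key : ∀ m : ℕ, 1 ≤ m → ‖∫ w in (-(1/2):ℝ)..(1/2), ee (m * (M * Real.exp (L * w))) * (Dk N w : ℂ)‖ ≤ C2 * √(N/M) / √m := by
    intro m hm
    have hm' : (1:ℝ) ≤ m := by exact_mod_cast hm
    have e : ∫ w in (-(1/2):ℝ)..(1/2), ee (m * (M * Real.exp (L * w))) * (Dk N w : ℂ) = Jf L (m * M) N := by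
      rw [Jf]; congr 1; ext w; rw [ee]; congr 4; ring
    rw [e]
    refine (h2 (m * M) (by nlinarith) N hN).trans (le_of_eq ?_)
    rw [mul_div_assoc, ← Real.sqrt_div (by positivity)]
    congr 2; field_simp
  rw [mul_assoc]
  apply h1 (fun w => M * Real.exp (L * w)) (fun w => (Dk N w : ℂ)) _ _ _ (by fun_prop) (by fun_prop)
    (ae_frac hL.ne' hM0.ne') (by positivity) key
  intro m hm
  rw [← RCLike.norm_conj, ← conj_int]
  refine le_trans (le_of_eq ?_) (key m hm)
  congr 2; ext w
  rw [map_mul, ← ee_neg, neg_neg, Complex.conj_ofReal]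

theorem Tail {L : ℝ} (hL : 0 < L) {K : ℕ} (hK : 1 ≤ K) : ∃ C : ℝ, 0 < C ∧ ∀ M : ℝ, 0 < M → ∀ ν a b : ℝ,
    -(1/2) ≤ a → a ≤ b → b ≤ 1/2 →
    ‖∫ w in a..b, (Bf K (M * Real.exp (L * w)) : ℂ) * ee (ν * w)‖ ≤ C / √M := by
  obtain ⟨C1, hC1, h1⟩ := FB hK
  refine ⟨C1 * (8 / √(cL L)), by have := Real.sqrt_pos.2 (cL_pos hL); positivity, fun M hM ν a b ha hab hb => ?_⟩
  have hec := ee_cont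
  have key : ∀ ν : ℝ, ∀ m : ℕ, 1 ≤ m → ‖∫ w in a..b, ee (m * (M * Real.exp (L * w))) * ee (ν * w)‖ ≤ 8 / √(cL L) / √M / √m := by
    intro ν m hm
    have hm' : (1:ℝ) ≤ m := by exact_mod_cast hm
    have := ph_vdC2 hL (abs_of_pos hL) (P := m * M) (by positivity) (2 * Real.pi * ν) hab ha hb
    refine le_trans (le_of_eq ?_) (this.trans (le_of_eq ?_))
    · congr 2; ext w; rw [← ee_add, ee]; congr 3; ring
    · rw [Real.sqrt_mul (cL_pos hL).le, Real.sqrt_mul (by positivity)]; ring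
  rw [mul_div_assoc]
  apply h1 (fun w => M * Real.exp (L * w)) (fun w => ee (ν * w)) _ _ _ (by fun_prop) (by fun_prop)
    (ae_frac hL.ne' hM.ne') (by positivity) (key ν)
  intro m hm
  rw [← RCLike.norm_conj, ← conj_int]
  refine le_trans (le_of_eq ?_) (key (-ν) m hm)
  congr 2; ext w
  rw [map_mul, ← ee_neg, neg_neg, ← ee_neg, neg_mul]

end Z6


namespace Z6
open MeasureTheory Set Filter Topology

theorem II_bdd {𝕜 : Type*} [RCLike 𝕜] {f g : ℝ → 𝕜} {C : ℝ} (hf : Measurable f) (hb : ∀ x, ‖f x‖ ≤ C) (hg : Continuous g)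
    (a b : ℝ) : IntervalIntegrable (fun w => f w * g w) volume a b :=
  ⟨(hg.intervalIntegrable a b).1.bdd_mul (c := C) hf.aestronglyMeasurable (Eventually.of_forall hb),
   (hg.intervalIntegrable a b).2.bdd_mul (c := C) hf.aestronglyMeasurable (Eventually.of_forall hb)⟩

theorem del_L1 (N : ℕ) : ∫ w in (0:ℝ)..(1/2), |del N w| ≤ (3/2 + Real.log (N+1)) / (N+1) := by
  have hN : (0:ℝ) < (N:ℝ) + 1 := by positivity
  set δ : ℝ := 1 / (2 * ((N:ℝ)+1)) with hδd
  have hδ : 0 < δ := by positivity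
  have hδ1 : δ ≤ 1/2 := by
    rw [hδd]; apply one_div_le_one_div_of_le (by norm_num); linarith [(Nat.cast_nonneg N : (0:ℝ) ≤ N)]
  have hc := (del_cont N).abs
  rw [← intervalIntegral.integral_add_adjacent_intervals (b := δ) (hc.intervalIntegrable _ _) (hc.intervalIntegrable _ _)]
  have a1 : ∫ w in (0:ℝ)..δ, |del N w| ≤ ∫ w in (0:ℝ)..δ, (3:ℝ) := by
    apply intervalIntegral.integral_mono_on hδ.le (hc.intervalIntegrable _ _) (by simp)
    intro x hx; exact del_le1 N hx.1 (hx.2.trans hδ1)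
  have a2 : ∫ w in δ..(1/2), |del N w| ≤ ∫ w in δ..(1/2), (1/((N:ℝ)+1)) * w⁻¹ := by
    apply intervalIntegral.integral_mono_on hδ1 (hc.intervalIntegrable _ _)
    · apply ContinuousOn.intervalIntegrable
      rw [uIcc_of_le hδ1]
      apply continuousOn_const.mul
      exact continuousOn_inv₀.mono fun x hx => (hδ.trans_le hx.1).ne'
    · intro x hx
      have h0 := hδ.trans_le hx.1
      refine (del_le2 N h0 hx.2).trans (le_of_eq ?_)
      field_simp
  rw [intervalIntegral.integral_const_mul, integral_inv_of_pos hδ (by norm_num)] at a2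
  rw [intervalIntegral.integral_const, smul_eq_mul, sub_zero] at a1
  have e : (1/2:ℝ) / δ = N + 1 := by rw [hδd]; field_simp
  rw [e] at a2
  have e2 : δ * 3 = (3/2) / ((N:ℝ)+1) := by rw [hδd]; field_simp
  rw [e2] at a1
  rw [add_div]
  have e3 : 1 / ((N:ℝ)+1) * Real.log (N+1) = Real.log (N+1) / (N+1) := by ring
  linarith

theorem Low_abs (K : ℕ) : ∃ C : ℝ, 0 < C ∧ ∀ (g g' : ℝ → ℝ) (A : ℝ) (N : ℕ),
    (∀ w, HasDerivAt g (g' w) w) → Continuous g' → (∀ w, 0 < g' w) → (∀ w ∈ Icc (0:ℝ) (1/2), g' w ≤ A) →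
    0 < A → g 0 = 0 →
    |(∫ w in (0:ℝ)..(1/2), Bf K (g w) * Dk N w) - bernoulliFun K 0 / 2| ≤
      C * (A / (N+1)) * (2 + Real.log (N+1) + Real.log (A+1)) := by
  obtain ⟨c1, h1⟩ := (isCompact_Icc (a := (0:ℝ)) (b := 1)).exists_bound_of_continuousOn
    (continuous_bernoulliFun K).continuousOn
  obtain ⟨c2, h2⟩ := (isCompact_Icc (a := (0:ℝ)) (b := 1)).exists_bound_of_continuousOn
    ((continuous_const (y := (K:ℝ))).mul (continuous_bernoulliFun (K-1))).continuousOn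
  set c : ℝ := max (max c1 c2) 1
  have hc0 : 0 < c := by positivity
  have b1 : ∀ x ∈ Icc (0:ℝ) 1, |bernoulliFun K x| ≤ c := fun x hx =>
    (h1 x hx).trans ((le_max_left _ _).trans (le_max_left _ _))
  have b2 : ∀ x ∈ Icc (0:ℝ) 1, |K * bernoulliFun (K-1) x| ≤ c := fun x hx =>
    (h2 x hx).trans ((le_max_right _ _).trans (le_max_left _ _))
  refine ⟨3 * c, by positivity, ?_⟩
  intro g g' A N hg hg'c hg'0 hg'A hA hg0
  have hmono : StrictMono g := strictMono_of_hasDerivAt_pos hg hg'0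
  have hgc : Continuous g := continuous_iff_continuousAt.2 fun x => (hg x).continuousAt
  have hgA : ∀ w ∈ Icc (0:ℝ) (1/2), g w ≤ A * w := by
    intro w hw
    have := Convex.image_sub_le_mul_sub_of_deriv_le (convex_Icc (0:ℝ) (1/2)) hgc.continuousOn
      (fun x _ => (hg x).differentiableAt.differentiableWithinAt) (C := A)
      (fun x hx => by rw [(hg x).deriv]; exact hg'A x (interior_subset hx)) 0 (by simp) w hw hw.1
    simpa [hg0] using this
  set G := g (1/2) with hG
  have hG0 : 0 < G := by rw [hG, ← hg0]; exact hmono (by norm_num)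
  have hGA : G ≤ A := by have := hgA (1/2) (by norm_num); linarith
  set R := ⌈G⌉₊ with hR
  have hRpos : 0 < R := Nat.ceil_pos.2 hG0
  have hex : ∀ l : ℕ, ∃ w ∈ Icc (0:ℝ) (1/2), g w = min (l:ℝ) G := by
    intro l
    have := intermediate_value_Icc (by norm_num : (0:ℝ) ≤ 1/2) hgc.continuousOn
    have hm : min (l:ℝ) G ∈ Icc (g 0) (g (1/2)) := ⟨by rw [hg0]; positivity, min_le_right _ _⟩
    obtain ⟨w, hw, e⟩ := this hm
    exact ⟨w, hw, e⟩
  choose W hW hgW using hex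
  have hW0 : W 0 = 0 := by
    apply hmono.injective; rw [hgW, hg0]; simp [hG0.le]
  have hWR : W R = 1/2 := by
    apply hmono.injective; rw [hgW]; exact min_eq_right (Nat.le_ceil G)
  have hWm : ∀ l, W l ≤ W (l+1) := by
    intro l; rw [← hmono.le_iff_le, hgW, hgW]; gcongr; simp
  have hlG : ∀ l < R, (l:ℝ) < G := fun l hl => Nat.lt_ceil.1 hl
  have hgl : ∀ l < R, g (W l) = l := fun l hl => by rw [hgW, min_eq_left (hlG l hl).le]
  obtain ⟨cB, hcB, hB⟩ := Bf_bdd K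
  have hDk := Dk_cont N
  have hdel := del_cont N
  have hint : ∀ a b, IntervalIntegrable (fun w => Bf K (g w) * Dk N w) volume a b := by
    intro a b
    exact II_bdd ((Bf_meas K).comp hgc.measurable) (fun x => hB _) hDk a b
  have hsum := intervalIntegral.sum_integral_adjacent_intervals (f := fun w => Bf K (g w) * Dk N w) (a := W) (n := R) (μ := volume)
    (fun k _ => hint _ _)
  rw [hW0, hWR] at hsum
  have piece : ∀ l < R, |(∫ w in W l..W (l+1), Bf K (g w) * Dk N w) + bernoulliFun K 0 * del N (W l)| ≤
      c * |del N (W (l+1))| + c * A * ∫ w in W l..W (l+1), |del N w| := by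
    intro l hl
    have hrange : ∀ w ∈ Icc (W l) (W (l+1)), g w - l ∈ Icc (0:ℝ) 1 := by
      intro w hw
      have q1 := hmono.monotone hw.1
      have q2 := hmono.monotone hw.2
      rw [hgl l hl] at q1
      rw [hgW] at q2
      have := q2.trans (min_le_left _ _)
      push_cast at this
      exact ⟨by linarith, by linarith⟩
    have e1 : ∫ w in W l..W (l+1), Bf K (g w) * Dk N w = ∫ w in W l..W (l+1), bernoulliFun K (g w - l) * Dk N w := by
      apply intervalIntegral.integral_congr_Ioo_of_le (hWm l)
      intro w hw
      have q1 := hmono.monotone hw.1.le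
      have q2 := hmono hw.2
      rw [hgl l hl] at q1
      rw [hgW] at q2
      have := q2.trans_le (min_le_left _ _)
      push_cast at this
      have : Int.fract (g w) = g w - l := by
        rw [Int.fract_eq_iff]; exact ⟨by linarith, by linarith, l, by push_cast; ring⟩
      simp only [Bf, this]
    have e2 := intervalIntegral.integral_mul_deriv_eq_deriv_mul (a := W l) (b := W (l+1))
      (u := fun w => bernoulliFun K (g w - l)) (u' := fun w => K * bernoulliFun (K-1) (g w - l) * g' w)
      (v := del N) (v' := Dk N)
      (fun x _ => HasDerivAt.comp (h₂ := bernoulliFun K) x (hasDerivAt_bernoulliFun K (g x - l)) ((hg x).sub_const _))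
      (fun x _ => del_deriv N x)
      (by apply Continuous.intervalIntegrable; fun_prop) (hDk.intervalIntegrable _ _)
    rw [e1, e2, hgl l hl, sub_self]
    have e3 : ∀ x y z : ℝ, x - bernoulliFun K 0 * y - z + bernoulliFun K 0 * y = x - z := by intros; ring
    rw [e3]
    refine (abs_sub _ _).trans (add_le_add ?_ ?_)
    · rw [abs_mul]; gcongr; exact b1 _ (hrange _ ⟨hWm l, le_rfl⟩)
    · rw [← intervalIntegral.integral_const_mul]
      rw [← Real.norm_eq_abs]
      refine intervalIntegral.norm_integral_le_of_norm_le (E := ℝ) (μ := volume) (g := fun w => c * A * |del N w|) (hWm l) (Eventually.of_forall fun w hw => ?_)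
        (by apply Continuous.intervalIntegrable; fun_prop)
      rw [Real.norm_eq_abs, abs_mul, abs_mul]
      have hw' := Ioc_subset_Icc_self hw
      have : w ∈ Icc (0:ℝ) (1/2) := ⟨(hW l).1.trans hw'.1, hw'.2.trans (hW (l+1)).2⟩
      rw [abs_of_pos (hg'0 w)]
      gcongr
      · exact (hg'0 w).le
      · exact b2 _ (hrange w hw')
      · exact hg'A w this
  have hdl : ∀ l, l + 1 ≤ R → |del N (W (l+1))| ≤ A / (N+1) * ((l:ℝ)+1)⁻¹ := by
    intro l hl
    rcases hl.eq_or_lt with h | h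
    · rw [h, hWR, del_half, abs_zero]; positivity
    · have q := hgl _ h
      have q2 := hgA _ (hW (l+1))
      rw [q] at q2
      push_cast at q2
      have q3 : 0 < W (l+1) := by
        by_contra hh; push Not at hh
        have : A * W (l+1) ≤ 0 := mul_nonpos_of_nonneg_of_nonpos hA.le hh
        have : (0:ℝ) ≤ l := by positivity
        linarith
      refine (del_le2 N q3 (hW _).2).trans ?_
      rw [div_mul_eq_mul_div, ← div_eq_mul_inv, div_div, div_le_div_iff₀ (by positivity) (by positivity)]
      have : (0:ℝ) < (N:ℝ)+1 := by positivity
      nlinarith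
  have hH : ∑ l ∈ Finset.range R, |del N (W (l+1))| ≤ A / (N+1) * (1 + Real.log (A+1)) := by
    calc _ ≤ ∑ l ∈ Finset.range R, A / (N+1) * ((l:ℝ)+1)⁻¹ :=
          Finset.sum_le_sum fun l hl => hdl l (Finset.mem_range.1 hl)
      _ = A / (N+1) * (harmonic R : ℝ) := by
          rw [← Finset.mul_sum, harmonic]; push_cast; rfl
      _ ≤ _ := by
          gcongr
          refine (harmonic_le_one_add_log R).trans ?_
          gcongr
          have := Nat.ceil_lt_add_one hG0.le
          linarith
  have hdsum := intervalIntegral.sum_integral_adjacent_intervals (f := fun w => |del N w|) (a := W) (n := R) (μ := volume)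
    (fun k _ => hdel.abs.intervalIntegrable _ _)
  rw [hW0, hWR] at hdsum
  have hL1 := del_L1 N
  have hmain : |(∫ w in (0:ℝ)..(1/2), Bf K (g w) * Dk N w) + ∑ l ∈ Finset.range R, bernoulliFun K 0 * del N (W l)| ≤
     c * ∑ l ∈ Finset.range R, |del N (W (l+1))| + c * A * ∫ w in (0:ℝ)..(1/2), |del N w| := by
    rw [← hsum, ← hdsum, ← Finset.sum_add_distrib, Finset.mul_sum, Finset.mul_sum, ← Finset.sum_add_distrib]
    exact (Finset.abs_sum_le_sum_abs _ _).trans (Finset.sum_le_sum fun l hl => piece l (Finset.mem_range.1 hl))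
  obtain ⟨r, hr⟩ : ∃ r, R = r + 1 := ⟨R - 1, by omega⟩
  have htail : |∑ l ∈ Finset.range r, bernoulliFun K 0 * del N (W (l+1))| ≤ c * ∑ l ∈ Finset.range R, |del N (W (l+1))| := by
    rw [hr, Finset.sum_range_succ, mul_add, Finset.mul_sum]
    have : 0 ≤ c * |del N (W (r+1))| := by positivity
    refine le_trans ?_ (le_add_of_nonneg_right this)
    refine (Finset.abs_sum_le_sum_abs _ _).trans (Finset.sum_le_sum fun l hl => ?_)
    rw [abs_mul]; gcongr; exact b1 0 (by simp)
  rw [hr, Finset.sum_range_succ', hW0, del_zero, ← hr] at hmain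
  have hN : (0:ℝ) < (N:ℝ)+1 := by positivity
  have hA1 : c * A * ∫ w in (0:ℝ)..(1/2), |del N w| ≤ c * (A / (N+1)) * (3/2 + Real.log (N+1)) := by
    calc _ ≤ c * A * ((3/2 + Real.log (N+1)) / (N+1)) := by gcongr
      _ = _ := by ring
  have hl1 : 0 ≤ Real.log ((N:ℝ)+1) := Real.log_nonneg (by linarith [(Nat.cast_nonneg N : (0:ℝ) ≤ N)])
  have hl2 : 0 ≤ Real.log (A+1) := Real.log_nonneg (by linarith)
  have hcA : 0 < c * (A / (N+1)) := by positivity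
  have hH2 : c * ∑ l ∈ Finset.range R, |del N (W (l+1))| ≤ c * (A / (N+1)) * (1 + Real.log (A+1)) := by
    rw [mul_assoc]; gcongr
  have f := abs_le.1 hmain
  have f2 := abs_le.1 htail
  rw [abs_le]
  have hX : 0 ≤ c * (A / (N+1)) * Real.log ((N:ℝ)+1) := by positivity
  have hY : 0 ≤ c * (A / (N+1)) * Real.log (A+1) := by positivity
  constructor <;> nlinarith [f.1, f.2, f2.1, f2.2]

end Z6


namespace Z6
open MeasureTheory Set Filter Topology

noncomputable def beta (K : ℕ) : ℝ := (1 + (-1)^K) / 2 * bernoulliFun K 0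

noncomputable def Ap (L : ℝ) (K : ℕ) (M : ℝ) (N : ℕ) : ℝ :=
  ∫ w in (-(1/2):ℝ)..(1/2), Bf K (M * Real.exp (L * w)) * Dk N w

theorem Bf_sub_int (K : ℕ) (y : ℝ) (n : ℕ) : Bf K (y - n) = Bf K y := by
  unfold Bf; rw [Int.fract_sub_natCast]

theorem Bf_neg (K : ℕ) {y : ℝ} (hy : Int.fract y ≠ 0) : Bf K (-y) = (-1)^K * Bf K y := by
  unfold Bf; rw [Int.fract_neg hy, bernoulliFun_eval_one_sub]

theorem Bf_int (K : ℕ) {φ : ℝ → ℝ} (hφ : Continuous φ) (N : ℕ) (a b : ℝ) :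
    IntervalIntegrable (fun w => Bf K (φ w) * Dk N w) volume a b := by
  obtain ⟨cB, hcB, hB⟩ := Bf_bdd K
  exact II_bdd ((Bf_meas K).comp hφ.measurable) (fun x => hB _) (Dk_cont N) a b

theorem LowR {L : ℝ} (hL : 0 < L) (K : ℕ) : ∃ C : ℝ, 0 < C ∧ ∀ (M N : ℕ), 1 ≤ M →
    |(∫ w in (0:ℝ)..(1/2), Bf K (M * Real.exp (L * w)) * Dk N w) - bernoulliFun K 0 / 2| ≤
      C * (M / (N+1)) * (2 + Real.log (N+1) + Real.log (M * (L * Real.exp (L/2)) +1)) ∧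
    |(∫ w in (-(1/2):ℝ)..0, Bf K (M * Real.exp (L * w)) * Dk N w) - (-1)^K * (bernoulliFun K 0 / 2)| ≤
      C * (M / (N+1)) * (2 + Real.log (N+1) + Real.log (M * (L * Real.exp (L/2)) +1)) := by
  obtain ⟨C, hC, h⟩ := Low_abs K
  refine ⟨C * (L * Real.exp (L/2)), by positivity, fun M N hM => ?_⟩
  have hM0 : (0:ℝ) < M := by exact_mod_cast hM
  have e0 : C * (L * Real.exp (L/2)) * (M / ((N:ℝ)+1)) = C * ((M * (L * Real.exp (L/2))) / (N+1)) := by ring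
  rw [e0]
  have hd : ∀ κ w : ℝ, HasDerivAt (fun w => Real.exp (κ * w)) (κ * Real.exp (κ * w)) w := fun κ w => by
    have h1 : HasDerivAt (fun w => κ * w) κ w := by simpa using (hasDerivAt_id w).const_mul κ
    rw [mul_comm]; exact h1.exp
  constructor
  · have := h (fun w => M * (Real.exp (L * w) - 1)) (fun w => M * (L * Real.exp (L * w))) (M * (L * Real.exp (L/2))) N
      (fun w => ((hd L w).sub_const 1).const_mul _) (by fun_prop) (fun w => by positivity)
      (fun w hw => by
        have : L * w ≤ L/2 := by nlinarith [hw.2]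
        gcongr) (by positivity) (by simp)
    refine le_trans (le_of_eq ?_) this
    congr 3; ext w
    rw [mul_sub, mul_one, Bf_sub_int]
  · have := h (fun w => M * (1 - Real.exp (-L * w))) (fun w => M * (L * Real.exp (-L * w))) (M * (L * Real.exp (L/2))) N
      (fun w => by
        have := ((hd (-L) w).const_sub 1).const_mul (M:ℝ)
        simpa using this) (by fun_prop) (fun w => by positivity)
      (fun w hw => by
        have : -L * w ≤ L/2 := by nlinarith [hw.1]
        gcongr) (by positivity) (by simp)
    have e1 : ∫ w in (-(1/2):ℝ)..0, Bf K (M * Real.exp (L * w)) * Dk N w =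
       (-1)^K * ∫ w in (0:ℝ)..(1/2), Bf K (M * (1 - Real.exp (-L * w))) * Dk N w := by
      have q := intervalIntegral.integral_comp_neg (fun w => Bf K (M * Real.exp (L * w)) * Dk N w) (a := 0) (b := 1/2)
      rw [neg_zero] at q
      rw [← q, ← intervalIntegral.integral_const_mul]
      apply intervalIntegral.integral_congr_ae
      filter_upwards [ae_frac (neg_ne_zero.2 hL.ne') hM0.ne'] with w hw _
      rw [Dk_even, mul_neg, ← neg_mul]
      have hy : Int.fract ((M:ℝ) * (1 - Real.exp (-L * w))) ≠ 0 := by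
        have : (M:ℝ) * (1 - Real.exp (-L * w)) = -(M * Real.exp (-L * w)) + M := by ring
        rw [this, Int.fract_add_natCast, Ne, Int.fract_neg_eq_zero]; exact hw
      have q2 := Bf_neg K hy
      have q3 : -((M:ℝ) * (1 - Real.exp (-L * w))) = M * Real.exp (-L * w) - M := by ring
      rw [q3, Bf_sub_int] at q2
      rw [q2]; ring
    rw [e1, ← mul_sub, abs_mul, abs_pow, abs_neg, abs_one, one_pow, one_mul]
    exact this

theorem LowP {L : ℝ} (hL : 0 < L) (K : ℕ) : ∃ C : ℝ, 0 < C ∧ ∀ (M N : ℕ), 1 ≤ M →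
    |Ap L K M N - beta K| ≤
      C * (M / (N+1)) * (2 + Real.log (N+1) + Real.log (M * (L * Real.exp (L/2)) +1)) := by
  obtain ⟨C, hC, h⟩ := LowR hL K
  refine ⟨2 * C, by positivity, fun M N hM => ?_⟩
  obtain ⟨h1, h2⟩ := h M N hM
  have hi := Bf_int K (φ := fun w => M * Real.exp (L * w)) (by fun_prop) N
  rw [Ap, ← intervalIntegral.integral_add_adjacent_intervals (hi _ 0) (hi 0 _), beta]
  have := abs_le.1 h1
  have := abs_le.1 h2
  rw [abs_le]; constructor <;> nlinarith

theorem HighP {L : ℝ} (hL : 0 < L) {K : ℕ} (hK : 1 ≤ K) : ∃ C : ℝ, 0 < C ∧ ∀ M : ℝ, 1 ≤ M → ∀ N : ℕ, 1 ≤ N →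
    |Ap L K M N| ≤ C * √(N / M) := by
  obtain ⟨C, hC, h⟩ := High hL hK
  refine ⟨C, hC, fun M hM N hN => ?_⟩
  refine le_trans (le_of_eq ?_) (h M hM N hN)
  rw [Ap, ← Real.norm_eq_abs, ← Complex.norm_real, ← intervalIntegral.integral_ofReal]
  push_cast; rfl

/-- truncated coefficient -/
noncomputable def TT (L : ℝ) (K α : ℕ) (R : ℕ) (n : ℝ) : ℂ :=
  ∫ w in (0:ℝ)..((R:ℝ) + 1/2), (Bf K (α * Real.exp (L * w)) : ℂ) * ee (-(n * w))

theorem Bfe_int (K : ℕ) {φ : ℝ → ℝ} (hφ : Continuous φ) (n : ℝ) (a b : ℝ) :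
    IntervalIntegrable (fun w => (Bf K (φ w) : ℂ) * ee (-(n * w))) volume a b := by
  obtain ⟨cB, hcB, hB⟩ := Bf_bdd K
  have := ee_cont
  exact II_bdd (Complex.measurable_ofReal.comp ((Bf_meas K).comp hφ.measurable))
    (fun x => by simp only [Function.comp]; rw [Complex.norm_real]; exact hB _) (by fun_prop) a b

theorem exp_log_pow {b : ℕ} (hb : 2 ≤ b) (j : ℕ) (w : ℝ) (α : ℝ) :
    α * Real.exp (Real.log b * (w + j)) = (α * (b:ℝ)^j) * Real.exp (Real.log b * w) := by
  have : (0:ℝ) < b := by positivity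
  rw [mul_add, Real.exp_add, mul_comm (Real.log b) (j:ℝ), Real.exp_nat_mul, Real.exp_log this]; ring

theorem TT_lim {α : ℕ} (hα : 0 < α) {b : ℕ} (hb : 2 ≤ b) {K : ℕ} (hK : 1 ≤ K) :
    ∃ (Ih : ℝ → ℂ) (C q : ℝ), 0 < q ∧ q < 1 ∧
      (∀ n, Tendsto (fun R => TT (Real.log b) K α R n) atTop (𝓝 (Ih n))) ∧
      ∀ R n, ‖TT (Real.log b) K α R n - Ih n‖ ≤ C * q^R := by
  have hb1 : (1:ℝ) < b := by exact_mod_cast (by omega : 1 < b)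
  have hL : 0 < Real.log b := Real.log_pos hb1
  obtain ⟨C, hC, h⟩ := Tail hL hK
  have hα' : (1:ℝ) ≤ α := by exact_mod_cast hα
  set q : ℝ := (√b)⁻¹ with hq
  have hsb : 1 < √(b:ℝ) := by rw [Real.lt_sqrt (by norm_num)]; simpa using hb1
  have hq0 : 0 < q := by positivity
  have hq1 : q < 1 := inv_lt_one_of_one_lt₀ hsb
  have step : ∀ n R, dist (TT (Real.log b) K α R n) (TT (Real.log b) K α (R+1) n) ≤ C * q^R := by
    intro n R
    have hi := Bfe_int K (φ := fun w => α * Real.exp (Real.log b * w)) (by fun_prop) n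
    rw [dist_comm, dist_eq_norm, TT, TT, intervalIntegral.integral_interval_sub_left (hi _ _) (hi _ _)]
    have e : ∫ w in ((R:ℝ)+1/2)..(((R+1:ℕ):ℝ)+1/2), (Bf K (α * Real.exp (Real.log b * w)) : ℂ) * ee (-(n * w)) =
        ee (-(n * (R+1:ℕ))) * ∫ w in (-(1/2):ℝ)..(1/2), (Bf K ((α * (b:ℝ)^(R+1)) * Real.exp (Real.log b * w)) : ℂ) * ee (-n * w) := by
      have := intervalIntegral.integral_comp_add_right (fun w => (Bf K (α * Real.exp (Real.log b * w)) : ℂ) * ee (-(n * w)))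
        (((R+1:ℕ)):ℝ) (a := -(1/2)) (b := 1/2)
      rw [show ((R:ℝ)+1/2) = -(1/2) + ((R+1:ℕ):ℝ) by push_cast; ring, add_comm (((R+1:ℕ)):ℝ) (1/2), ← this,
        ← intervalIntegral.integral_const_mul]
      congr 1; ext w
      rw [exp_log_pow hb, show -(n * (w + ((R+1:ℕ):ℝ))) = -(n * ((R+1:ℕ):ℝ)) + -n * w by ring, ee_add]
      ring
    rw [e, norm_mul, ee_norm, one_mul]
    refine (h _ (by positivity) (-n) _ _ le_rfl (by norm_num) le_rfl).trans ?_
    rw [div_eq_mul_inv]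
    gcongr
    rw [hq, inv_pow]
    apply inv_anti₀ (by positivity)
    have : √(b:ℝ)^R = √((b:ℝ)^R) := by
      rw [eq_comm, Real.sqrt_eq_iff_eq_sq (by positivity) (by positivity), ← pow_mul, mul_comm, pow_mul, Real.sq_sqrt (by positivity)]
    rw [this]
    apply Real.sqrt_le_sqrt
    have : (b:ℝ)^R ≤ (b:ℝ)^(R+1) := by gcongr; · exact hb1.le
                                       · omega
    have h0 : (0:ℝ) < (b:ℝ)^(R+1) := by positivity
    nlinarith
  have hex : ∀ n, ∃ l, Tendsto (fun R => TT (Real.log b) K α R n) atTop (𝓝 l) := fun n =>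
    cauchySeq_tendsto_of_complete (cauchySeq_of_le_geometric q C hq1 (step n))
  choose Ih hIh using hex
  refine ⟨Ih, C / (1-q), q, hq0, hq1, hIh, fun R n => ?_⟩
  have := dist_le_of_le_geometric_of_tendsto q C hq1 (step n) (hIh n) R
  rw [dist_eq_norm] at this
  refine this.trans (le_of_eq (by ring))

end Z6


namespace Z6
open MeasureTheory Set Filter Topology

theorem TT_RL (L : ℝ) (K α R : ℕ) : Tendsto (fun n : ℝ => TT L K α R n) (cocompact ℝ) (𝓝 0) := by
  have := Real.tendsto_integral_exp_smul_cocompact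
    (fun v => (Ioc (0:ℝ) (R + 1/2)).indicator (fun w => (Bf K (α * Real.exp (L * w)) : ℂ)) v)
  refine this.congr fun n => ?_
  rw [TT, intervalIntegral.integral_of_le (by positivity), ← integral_indicator measurableSet_Ioc]
  congr 1; ext v
  by_cases hv : v ∈ Ioc (0:ℝ) (R + 1/2)
  · rw [indicator_of_mem hv, indicator_of_mem hv, Circle.smul_def, smul_eq_mul, Real.fourierChar_apply, ee, mul_comm (Complex.exp _)]
    congr 2; push_cast; ring
  · rw [indicator_of_notMem hv, indicator_of_notMem hv, smul_zero]

theorem Ih_RL {L : ℝ} {K α : ℕ} {Ih : ℝ → ℂ} {C q : ℝ} (hq0 : 0 < q) (hq : q < 1)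
    (h : ∀ R n, ‖TT L K α R n - Ih n‖ ≤ C * q^R) : Tendsto Ih (cocompact ℝ) (𝓝 0) := by
  rw [Metric.tendsto_nhds]
  intro ε hε
  have h1 : Tendsto (fun R : ℕ => C * q^R) atTop (𝓝 0) := by
    simpa using (tendsto_pow_atTop_nhds_zero_of_lt_one hq0.le hq).const_mul C
  obtain ⟨R, hR⟩ := (h1.eventually (gt_mem_nhds (half_pos hε))).exists
  have h2 := (Metric.tendsto_nhds.1 (TT_RL L K α R)) (ε/2) (half_pos hε)
  filter_upwards [h2] with n hn
  rw [dist_zero_right] at hn ⊢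
  have h3 := h R n
  calc ‖Ih n‖ = ‖TT L K α R n - (TT L K α R n - Ih n)‖ := by rw [sub_sub_cancel]
    _ ≤ ‖TT L K α R n‖ + ‖TT L K α R n - Ih n‖ := norm_sub_le _ _
    _ < ε := by linarith

theorem littleo_log {x y : ℕ → ℂ} {C : ℝ} (hx : Tendsto x atTop (𝓝 0)) (hy : ∀ n, ‖y n‖ ≤ C / (n+1)) :
    Tendsto (fun N : ℕ => (1 / (Real.log N : ℂ)) * ∑ n ∈ Finset.range N, y n * x n) atTop (𝓝 0) := by
  have hg : ∀ n : ℕ, ‖y n * x n‖ ≤ C * ‖x n‖ * (1 / ((n:ℝ)+1)) := fun n => by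
    rw [norm_mul]
    calc _ ≤ C / (n+1) * ‖x n‖ := by gcongr; exact hy n
      _ = _ := by ring
  have ho : (fun n => y n * x n) =o[atTop] (fun n : ℕ => 1 / ((n:ℝ)+1)) := by
    rw [Asymptotics.isLittleO_iff]
    intro c hc
    have h1 : Tendsto (fun n => C * ‖x n‖) atTop (𝓝 0) := by simpa using hx.norm.const_mul C
    filter_upwards [h1.eventually (gt_mem_nhds hc)] with n hn
    refine (hg n).trans ?_
    rw [Real.norm_of_nonneg (by positivity)]
    gcongr
  have h2 := ho.sum_range (fun n => by positivity) Real.tendsto_sum_range_one_div_nat_succ_atTop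
  have h3 : (fun N : ℕ => ∑ i ∈ Finset.range N, 1 / ((i:ℝ)+1)) =O[atTop] (fun N : ℕ => Real.log N) := by
    apply Asymptotics.IsBigO.of_bound 2
    have : Tendsto (fun N : ℕ => Real.log N) atTop atTop := Real.tendsto_log_atTop.comp tendsto_natCast_atTop_atTop
    filter_upwards [this.eventually_ge_atTop 1] with N hN
    rw [Real.norm_of_nonneg (by positivity), Real.norm_of_nonneg (by linarith)]
    have := harmonic_le_one_add_log N
    rw [harmonic] at this
    push_cast at this
    simp only [one_div]
    linarith
  have h4 := h2.trans_isBigO h3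
  have h5 : (fun N : ℕ => ∑ n ∈ Finset.range N, y n * x n) =o[atTop] (fun N : ℕ => (Real.log N : ℂ)) := by
    refine h4.trans_isBigO (Asymptotics.IsBigO.of_bound 1 (Eventually.of_forall fun N => ?_))
    rw [Complex.norm_real, one_mul]
  refine h5.tendsto_div_nhds_zero.congr fun N => ?_
  rw [div_eq_mul_inv, one_div, mul_comm]

theorem ee_Dk (N : ℕ) (w : ℝ) : (Dk N w : ℂ) = ee (-(0 * w)) + ∑ n ∈ Finset.range N, (ee (-(((n:ℝ)+1) * w)) + ee (-(-((n:ℝ)+1) * w))) := by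
  rw [Dk, Finset.mul_sum, Complex.ofReal_add, Complex.ofReal_sum]
  congr 1
  · simp [ee]
  · refine Finset.sum_congr rfl fun n _ => ?_
    rw [Complex.ofReal_mul, Complex.ofReal_cos, Complex.cos, ee, ee, add_comm (Complex.exp (Complex.I * _))]
    have a1 : (((2 * Real.pi * ((n:ℝ)+1) * w : ℝ)) : ℂ) * Complex.I = Complex.I * ((2 * Real.pi * (-(-((n:ℝ)+1) * w)) : ℝ) : ℂ) := by
      push_cast; ring
    have a2 : -(((2 * Real.pi * ((n:ℝ)+1) * w : ℝ)) : ℂ) * Complex.I = Complex.I * ((2 * Real.pi * (-(((n:ℝ)+1) * w)) : ℝ) : ℂ) := by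
      push_cast; ring
    rw [a1, a2]; push_cast; ring

theorem TT_sum {b : ℕ} (hb : 2 ≤ b) (K α R N : ℕ) :
    TT (Real.log b) K α R 0 + ∑ n ∈ Finset.range N, (TT (Real.log b) K α R ((n:ℝ)+1) + TT (Real.log b) K α R (-((n:ℝ)+1))) =
    (((∫ w in (0:ℝ)..(1/2), Bf K (α * Real.exp (Real.log b * w)) * Dk N w) +
      ∑ j ∈ Finset.range R, Ap (Real.log b) K (α * (b:ℝ)^(j+1)) N : ℝ) : ℂ) := by
  set L := Real.log b
  have hi := Bf_int K (φ := fun w => α * Real.exp (L * w)) (by fun_prop) N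
  have hie := Bfe_int K (φ := fun w => α * Real.exp (L * w)) (by fun_prop)
  have e1 : TT L K α R 0 + ∑ n ∈ Finset.range N, (TT L K α R ((n:ℝ)+1) + TT L K α R (-((n:ℝ)+1))) =
     ((∫ w in (0:ℝ)..((R:ℝ)+1/2), Bf K (α * Real.exp (L * w)) * Dk N w : ℝ) : ℂ) := by
    rw [← intervalIntegral.integral_ofReal]
    simp only [TT, ← intervalIntegral.integral_add (hie _ _ _) (hie _ _ _)]
    rw [← intervalIntegral.integral_finsetSum (fun n _ => (hie _ _ _).add (hie _ _ _)),
      ← intervalIntegral.integral_add (hie _ _ _)]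
    · congr 1; ext w
      rw [Complex.ofReal_mul, ee_Dk, mul_add, Finset.mul_sum]
      simp only [mul_add]
    · have := IntervalIntegrable.sum (Finset.range N) (fun n _ => (hie ((n:ℝ)+1) 0 ((R:ℝ)+1/2)).add (hie (-((n:ℝ)+1)) 0 ((R:ℝ)+1/2)))
      simpa only [Finset.sum_fn] using this
  rw [e1]
  congr 1
  clear e1 hie
  induction R with
  | zero => simp
  | succ R ih =>
    rw [Finset.sum_range_succ, ← add_assoc, ← ih, ← intervalIntegral.integral_add_adjacent_intervals (hi 0 ((R:ℝ)+1/2)) (hi _ _)]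
    congr 1
    rw [Ap]
    have := intervalIntegral.integral_comp_add_right (fun w => Bf K (α * Real.exp (L * w)) * Dk N w)
        (((R+1:ℕ)):ℝ) (a := -(1/2)) (b := 1/2)
    rw [show ((R:ℝ)+1/2) = -(1/2) + ((R+1:ℕ):ℝ) by push_cast; ring, add_comm (((R+1:ℕ)):ℝ) (1/2), ← this]
    congr 1; ext w
    rw [exp_log_pow hb]
    congr 1
    have := Dk_add_int N w ((R+1:ℕ):ℤ)
    rw [← this]; simp

end Z6


namespace Z6
open MeasureTheory Set Filter Topology

theorem geo_b {b : ℝ} (hb : 2 ≤ b) (J : ℕ) : ∑ j ∈ Finset.range J, b^(j+1) ≤ 2 * b^J := by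
  induction J with
  | zero => simp
  | succ J ih =>
    rw [Finset.sum_range_succ, pow_succ]
    have : 0 < b^J := by positivity
    nlinarith

theorem D_bound {α : ℕ} (hα : 0 < α) {b : ℕ} (hb : 2 ≤ b) {K : ℕ} (hK : 1 ≤ K) {Ih : ℝ → ℂ}
    (hI : ∀ n, Tendsto (fun R => TT (Real.log b) K α R n) atTop (𝓝 (Ih n))) :
    ∃ C1 : ℝ, 0 < C1 ∧ ∀ t : ℕ, ∃ C2 : ℝ, ∀ N J : ℕ, b^(J+t) ≤ N → N < b^(J+t+1) →
      ‖(∑ n ∈ Finset.range N, (Ih ((n:ℝ)+1) + Ih (-((n:ℝ)+1)))) - ((beta K * J : ℝ) : ℂ)‖ ≤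
        C2 + C1 * (1/2)^t * (1 + Real.log (N+1)) := by
  have hb2 : (2:ℝ) ≤ b := by exact_mod_cast hb
  have hb1 : (1:ℝ) < b := by linarith
  have hL : 0 < Real.log b := Real.log_pos hb1
  have hα' : (1:ℝ) ≤ α := by exact_mod_cast hα
  obtain ⟨Ca, hCa, ha⟩ := LowR hL K
  obtain ⟨Cb, hCb, hbd⟩ := LowP hL K
  obtain ⟨Cc, hCc, hc⟩ := HighP hL hK
  set L := Real.log b with hLd
  set a := L * Real.exp (L/2) with had
  have ha0 : 0 < a := by positivity
  set ℓ := Real.log (α * a + 1) with hℓ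
  have hℓ0 : 0 ≤ ℓ := Real.log_nonneg (by nlinarith)
  set q : ℝ := (√b)⁻¹ with hq
  have hsb : 1 < √(b:ℝ) := by rw [Real.lt_sqrt (by norm_num)]; simpa using hb1
  have hq0 : 0 < q := by positivity
  have hq1 : q < 1 := inv_lt_one_of_one_lt₀ hsb
  refine ⟨2 * Cb * α * (2 + ℓ), by positivity, fun t => ?_⟩
  refine ⟨‖Ih 0‖ + (|bernoulliFun K 0 / 2| + Ca * α * (3 + ℓ)) + Cc * √((b:ℝ)^t) * (1/(1-q)), fun N J h1 h2 => ?_⟩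
  have hN1 : 1 ≤ N := le_trans (Nat.one_le_pow _ _ (by omega)) h1
  have hN : (1:ℝ) ≤ N := by exact_mod_cast hN1
  have hlog0 : 0 ≤ Real.log ((N:ℝ)+1) := Real.log_nonneg (by linarith)
  have hN0 : (0:ℝ) < (N:ℝ)+1 := by linarith
  have H0 : |∫ w in (0:ℝ)..(1/2), Bf K (α * Real.exp (L * w)) * Dk N w| ≤ |bernoulliFun K 0 / 2| + Ca * α * (3 + ℓ) := by
    have := (ha α N hα).1
    have h3 : Ca * (α / ((N:ℝ)+1)) * (2 + Real.log (N+1) + ℓ) ≤ Ca * α * (3 + ℓ) := by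
      have e : Ca * (α / ((N:ℝ)+1)) * (2 + Real.log (N+1) + ℓ) = Ca * α * ((2 + Real.log (N+1) + ℓ) / (N+1)) := by ring
      rw [e]
      gcongr
      rw [div_le_iff₀ hN0]
      have := Real.log_le_sub_one_of_pos hN0
      nlinarith
    have h4 := this.trans h3
    have h5 := abs_sub_abs_le_abs_sub (∫ w in (0:ℝ)..(1/2), Bf K (α * Real.exp (L * w)) * Dk N w) (bernoulliFun K 0 / 2)
    linarith
  have hNb1 : (b:ℝ)^(J+t) ≤ N := by exact_mod_cast h1
  have hNb2 : (N:ℝ) ≤ (b:ℝ)^(J+t+1) := by exact_mod_cast h2.le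
  have hlow : ∑ j ∈ Finset.range J, |Ap L K (α * (b:ℝ)^(j+1)) N - beta K| ≤ 2 * Cb * α * (2 + ℓ) * (1/2)^t * (1 + Real.log (N+1)) := by
    have each : ∀ j ∈ Finset.range J, |Ap L K (α * (b:ℝ)^(j+1)) N - beta K| ≤
        (Cb * α / (N+1) * ((2+ℓ) * (1 + Real.log (N+1)))) * (b:ℝ)^(j+1) := by
      intro j hj
      have := hbd (α * b^(j+1)) N (Nat.mul_pos hα (by positivity))
      push_cast at this
      refine this.trans ?_
      have hM : (b:ℝ)^(j+1) ≤ N := by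
        refine le_trans ?_ hNb1
        exact pow_le_pow_right₀ (by exact_mod_cast (by omega : 1 ≤ b)) (by have := Finset.mem_range.1 hj; omega)
      have hlg : Real.log (α * (b:ℝ)^(j+1) * a + 1) ≤ ℓ + Real.log (N+1) := by
        rw [hℓ, ← Real.log_mul (by positivity) (by positivity)]
        apply Real.log_le_log (by positivity)
        have : α * (b:ℝ)^(j+1) * a ≤ α * N * a := by gcongr
        nlinarith [mul_pos (lt_of_lt_of_le one_pos hα') ha0]
      calc _ ≤ Cb * (α * (b:ℝ)^(j+1) / (N+1)) * ((2+ℓ) * (1 + Real.log (N+1))) := by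
            gcongr
            nlinarith
        _ = _ := by ring
    refine (Finset.sum_le_sum each).trans ?_
    rw [← Finset.mul_sum]
    have hg := geo_b hb2 J
    have hbJ : (b:ℝ)^J ≤ (N+1) * (1/2)^t := by
      rw [one_div, inv_pow, ← div_eq_mul_inv, le_div_iff₀ (by positivity)]
      calc (b:ℝ)^J * 2^t ≤ (b:ℝ)^J * b^t := by gcongr
        _ = (b:ℝ)^(J+t) := by rw [pow_add]
        _ ≤ _ := by linarith
    calc _ ≤ (Cb * α / (N+1) * ((2+ℓ) * (1 + Real.log (N+1)))) * (2 * ((N+1) * (1/2)^t)) := by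
          gcongr; linarith
      _ = _ := by field_simp
  have hhigh : ∀ n : ℕ, ∑ i ∈ Finset.range n, |Ap L K (α * (b:ℝ)^(J+i+1)) N| ≤ Cc * √((b:ℝ)^t) * (1/(1-q)) := by
    intro n
    have each : ∀ i ∈ Finset.range n, |Ap L K (α * (b:ℝ)^(J+i+1)) N| ≤ Cc * √((b:ℝ)^t) * q^i := by
      intro i _
      have hbp : (1:ℝ) ≤ (b:ℝ)^(J+i+1) := one_le_pow₀ hb1.le
      refine (hc _ (by nlinarith) N hN1).trans ?_
      rw [mul_assoc]
      gcongr
      have e : √((b:ℝ)^t) * q^i = √((b:ℝ)^t / b^i) := by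
        rw [Real.sqrt_div (by positivity), hq, inv_pow, div_eq_mul_inv]
        congr 2
        rw [eq_comm, Real.sqrt_eq_iff_eq_sq (by positivity) (by positivity), ← pow_mul, mul_comm, pow_mul, Real.sq_sqrt (by positivity)]
      rw [e]
      apply Real.sqrt_le_sqrt
      rw [div_le_div_iff₀ (by positivity) (by positivity)]
      calc (N:ℝ) * b^i ≤ (b:ℝ)^(J+t+1) * b^i := by gcongr
        _ = (b:ℝ)^t * (1 * b^(J+i+1)) := by rw [one_mul, ← pow_add, ← pow_add]; congr 1; omega
        _ ≤ _ := by gcongr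
    refine (Finset.sum_le_sum each).trans ?_
    rw [← Finset.mul_sum]
    gcongr
    have := (summable_geometric_of_lt_one hq0.le hq1).sum_le_tsum (Finset.range n) (fun i _ => by positivity)
    rw [tsum_geometric_of_lt_one hq0.le hq1] at this
    rw [one_div]; exact this
  set S : ℂ := ∑ n ∈ Finset.range N, (Ih ((n:ℝ)+1) + Ih (-((n:ℝ)+1)))
  have hlim : Tendsto (fun n : ℕ => TT L K α (n+J) 0 + ∑ m ∈ Finset.range N, (TT L K α (n+J) ((m:ℝ)+1) + TT L K α (n+J) (-((m:ℝ)+1)))) atTop (𝓝 (Ih 0 + S)) := by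
    have : Tendsto (fun R : ℕ => TT L K α R 0 + ∑ m ∈ Finset.range N, (TT L K α R ((m:ℝ)+1) + TT L K α R (-((m:ℝ)+1)))) atTop (𝓝 (Ih 0 + S)) :=
      (hI 0).add (tendsto_finsetSum _ fun m _ => (hI _).add (hI _))
    exact this.comp (tendsto_add_atTop_nat J)
  have hfin : ‖Ih 0 + S - ((beta K * J : ℝ) : ℂ)‖ ≤ (|bernoulliFun K 0 / 2| + Ca * α * (3 + ℓ)) +
      2 * Cb * α * (2 + ℓ) * (1/2)^t * (1 + Real.log (N+1)) + Cc * √((b:ℝ)^t) * (1/(1-q)) := by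
    refine le_of_tendsto (hlim.sub_const _).norm (Eventually.of_forall fun n => ?_)
    rw [TT_sum hb, ← Complex.ofReal_sub, Complex.norm_real, Real.norm_eq_abs, add_comm n J, Finset.sum_range_add]
    have e : ∀ X Y Z : ℝ, X + (Y + Z) - beta K * J = X + (Y - beta K * J) + Z := by intros; ring
    rw [e]
    have e2 : (∑ j ∈ Finset.range J, Ap L K (α * (b:ℝ)^(j+1)) N) - beta K * J =
        ∑ j ∈ Finset.range J, (Ap L K (α * (b:ℝ)^(j+1)) N - beta K) := by
      rw [Finset.sum_sub_distrib]; simp [mul_comm]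
    rw [e2]
    refine (abs_add_le _ _).trans (add_le_add ((abs_add_le _ _).trans (add_le_add H0 ?_)) ?_)
    · exact (Finset.abs_sum_le_sum_abs _ _).trans hlow
    · exact (Finset.abs_sum_le_sum_abs _ _).trans (hhigh n)
  have : S - ((beta K * J : ℝ) : ℂ) = (Ih 0 + S - ((beta K * J : ℝ) : ℂ)) - Ih 0 := by ring
  rw [this]
  refine (norm_sub_le _ _).trans ?_
  linarith

theorem D_lim {α : ℕ} (hα : 0 < α) {b : ℕ} (hb : 2 ≤ b) {K : ℕ} (hK : 1 ≤ K) {Ih : ℝ → ℂ}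
    (hI : ∀ n, Tendsto (fun R => TT (Real.log b) K α R n) atTop (𝓝 (Ih n))) :
    Tendsto (fun N : ℕ => (1 / (Real.log N : ℂ)) * ∑ n ∈ Finset.range N, (Ih ((n:ℝ)+1) + Ih (-((n:ℝ)+1))))
      atTop (𝓝 ((beta K / Real.log b : ℝ) : ℂ)) := by
  obtain ⟨C1, hC1, h⟩ := D_bound hα hb hK hI
  have hb1 : (1:ℝ) < b := by exact_mod_cast (by omega : 1 < b)
  have hL : 0 < Real.log b := Real.log_pos hb1
  set L := Real.log b with hLd
  rw [Metric.tendsto_nhds]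
  intro ε hε
  have ht0 : Tendsto (fun t : ℕ => 3 * C1 * (1/2:ℝ)^t) atTop (𝓝 0) := by
    simpa using (tendsto_pow_atTop_nhds_zero_of_lt_one (by norm_num : (0:ℝ) ≤ 1/2) (by norm_num)).const_mul (3 * C1)
  obtain ⟨t, ht⟩ := (ht0.eventually (gt_mem_nhds (half_pos hε))).exists
  obtain ⟨C2, h2⟩ := h t
  have hlog : Tendsto (fun N : ℕ => Real.log N) atTop atTop := Real.tendsto_log_atTop.comp tendsto_natCast_atTop_atTop
  have hsm : Tendsto (fun N : ℕ => (C2 + |beta K| * (t+1)) / Real.log N) atTop (𝓝 0) := hlog.const_div_atTop _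
  filter_upwards [eventually_ge_atTop (b^t), hlog.eventually_ge_atTop 1, hsm.eventually (gt_mem_nhds (half_pos hε))] with N hN hl1 hN2
  have hNpos : 0 < N := lt_of_lt_of_le (by positivity) hN
  have hN' : (1:ℝ) ≤ N := by exact_mod_cast hNpos
  obtain ⟨J, hJ⟩ : ∃ J, Nat.log b N = J + t := by
    have := Nat.le_log_of_pow_le (by omega) hN
    exact ⟨Nat.log b N - t, by omega⟩
  have p1 := Nat.pow_log_le_self b hNpos.ne'
  have p2 := Nat.lt_pow_succ_log_self (by omega : 1 < b) N
  rw [hJ] at p1 p2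
  have B := h2 N J p1 p2
  set S : ℂ := ∑ n ∈ Finset.range N, (Ih ((n:ℝ)+1) + Ih (-((n:ℝ)+1)))
  set lN := Real.log N with hlN
  have hlp : 0 < lN := by linarith
  have q1 : ((J:ℝ)+t) * L ≤ lN := by
    have : Real.log ((b:ℝ)^(J+t)) ≤ lN := Real.log_le_log (by positivity) (by exact_mod_cast p1)
    rw [Real.log_pow] at this; push_cast at this; exact this
  have q2 : lN ≤ ((J:ℝ)+t+1) * L := by
    have : lN ≤ Real.log ((b:ℝ)^(J+t+1)) := Real.log_le_log (by positivity) (by exact_mod_cast p2.le)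
    rw [Real.log_pow] at this; push_cast at this; exact this
  have q3 : |(J:ℝ) - lN / L| ≤ t + 1 := by
    have r1 : (J:ℝ) + t ≤ lN / L := by rw [le_div_iff₀ hL]; exact q1
    have r2 : lN / L ≤ (J:ℝ) + t + 1 := by rw [div_le_iff₀ hL]; exact q2
    have : (0:ℝ) ≤ t := by positivity
    rw [abs_le]; constructor <;> linarith
  have q4 : 1 + Real.log ((N:ℝ)+1) ≤ 3 * lN := by
    have : Real.log ((N:ℝ)+1) ≤ Real.log (N * 2) := Real.log_le_log (by positivity) (by linarith)
    rw [Real.log_mul (by positivity) (by norm_num)] at this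
    have := Real.log_two_lt_d9
    linarith
  have E : ‖S - ((beta K * (lN / L) : ℝ) : ℂ)‖ ≤ (C2 + |beta K| * (t+1)) + 3 * C1 * (1/2)^t * lN := by
    have e : S - ((beta K * (lN / L) : ℝ) : ℂ) = (S - ((beta K * J : ℝ) : ℂ)) + ((beta K * (J - lN / L) : ℝ) : ℂ) := by
      push_cast; ring
    rw [e]
    refine (norm_add_le _ _).trans ?_
    rw [Complex.norm_real, Real.norm_eq_abs, abs_mul]
    have : |beta K| * |(J:ℝ) - lN/L| ≤ |beta K| * (t+1) := by gcongr
    have : C1 * (1/2)^t * (1 + Real.log ((N:ℝ)+1)) ≤ C1 * (1/2)^t * (3 * lN) := by gcongr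
    nlinarith
  have e : (1 / (lN : ℂ)) * S - ((beta K / L : ℝ) : ℂ) = (1 / (lN : ℂ)) * (S - ((beta K * (lN / L) : ℝ) : ℂ)) := by
    have : (lN : ℂ) ≠ 0 := by exact_mod_cast hlp.ne'
    push_cast
    field_simp
  rw [dist_eq_norm, e, norm_mul, norm_div, norm_one, Complex.norm_real, Real.norm_of_nonneg hlp.le]
  calc _ ≤ 1 / lN * ((C2 + |beta K| * (t+1)) + 3 * C1 * (1/2)^t * lN) := by gcongr
    _ = (C2 + |beta K| * (t+1)) / lN + 3 * C1 * (1/2)^t := by field_simp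
    _ < ε := by linarith

end Z6


namespace Z6
open MeasureTheory Set Filter Topology

theorem Bf_cont {K : ℕ} (hK : K ≠ 1) : Continuous (Bf K) := by
  have := ContinuousOn.comp_fract'' (f := bernoulliFun K) (continuous_bernoulliFun K).continuousOn
    (bernoulliFun_endpoints_eq_of_ne_one hK).symm
  exact this

theorem Bf_rd (K : ℕ) (y : ℝ) : HasDerivWithinAt (Bf (K+1)) ((K+1) * Bf K y) (Ioi y) y := by
  have h1 : HasDerivAt (fun z : ℝ => bernoulliFun (K+1) (z - ⌊y⌋)) ((K+1) * bernoulliFun K (y - ⌊y⌋)) y := by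
    have := hasDerivAt_bernoulliFun (K+1) (y - ⌊y⌋)
    have h2 := this.comp_sub_const y (⌊y⌋ : ℝ)
    simpa using h2
  have h3 := h1.hasDerivWithinAt (s := Ioi y)
  have e : y - ⌊y⌋ = Int.fract y := rfl
  rw [e] at h3
  refine h3.congr_of_eventuallyEq ?_ rfl
  have : ∀ᶠ z in 𝓝[>] y, z < (⌊y⌋ : ℝ) + 1 := nhdsWithin_le_nhds (Iio_mem_nhds (Int.lt_floor_add_one y))
  filter_upwards [this, self_mem_nhdsWithin] with z hz hz2
  have hf : ⌊z⌋ = ⌊y⌋ := by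
    rw [Int.floor_eq_iff]
    exact ⟨(Int.floor_le y).trans (le_of_lt hz2), hz⟩
  simp only [Bf, Int.fract, hf]

theorem cp_deriv (r : ℂ) {y : ℝ} (hy : 0 < y) : HasDerivAt (fun t : ℝ => (t:ℂ)^r) (r * (y:ℂ)^(r-1)) y := by
  have h := (hasDerivAt_id (y:ℂ)).cpow_const (c := r) (Or.inl (by simpa using hy))
  have := h.comp_ofReal
  simpa using this

theorem cp_contOn (r : ℂ) {a X : ℝ} (ha : 0 < a) (hX : a ≤ X) : ContinuousOn (fun t : ℝ => (t:ℂ)^r) (uIcc a X) := by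
  rw [uIcc_of_le hX]
  intro t ht
  exact (cp_deriv r (lt_of_lt_of_le ha ht.1)).continuousAt.continuousWithinAt

theorem Bfc_II (K : ℕ) (r : ℂ) {a X : ℝ} (ha : 0 < a) (hX : a ≤ X) :
    IntervalIntegrable (fun t : ℝ => (t:ℂ)^r * (Bf K t : ℂ)) volume a X := by
  obtain ⟨C, hC, hB⟩ := Bf_bdd K
  have : IntervalIntegrable (fun t : ℝ => (Bf K t : ℂ) * 1) volume a X :=
    II_bdd (Complex.measurable_ofReal.comp (Bf_meas K)) (C := C) (fun x => by simp only [Function.comp]; rw [Complex.norm_real]; exact hB _)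
      continuous_const a X
  simp only [mul_one] at this
  exact this.continuousOn_mul (cp_contOn r ha hX)

theorem BP {K : ℕ} (hK : K ≠ 0) (r : ℂ) {a X : ℝ} (ha : 0 < a) (hX : a ≤ X) :
    ∫ y in a..X, (y:ℂ)^r * (Bf K y : ℂ) = ((X:ℂ)^r * (Bf (K+1) X : ℂ) - (a:ℂ)^r * (Bf (K+1) a : ℂ)) / (K+1)
      - r / (K+1) * ∫ y in a..X, (y:ℂ)^(r-1) * (Bf (K+1) y : ℂ) := by
  have hK1 : ((K:ℂ)+1) ≠ 0 := by exact_mod_cast Nat.succ_ne_zero K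
  have h := intervalIntegral.integral_mul_deriv_eq_deriv_mul_of_hasDeriv_right (a := a) (b := X)
    (u := fun t : ℝ => (t:ℂ)^r) (u' := fun t : ℝ => r * (t:ℂ)^(r-1))
    (v := fun t : ℝ => (Bf (K+1) t : ℂ)) (v' := fun t : ℝ => (((K+1) * Bf K t : ℝ) : ℂ))
    (cp_contOn r ha hX) (Complex.continuous_ofReal.comp (Bf_cont (by omega))).continuousOn
    (fun x hx => (cp_deriv r (by rw [min_eq_left hX] at hx; exact ha.trans hx.1)).hasDerivWithinAt)
    (fun x hx => (Bf_rd K x).ofReal_comp)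
    ((cp_contOn (r-1) ha hX).intervalIntegrable.const_mul r)
    (by
      have := (Bfc_II K 0 ha hX).const_mul ((K:ℂ)+1)
      simpa using this)
  have e1 : ∫ y in a..X, (y:ℂ)^r * ((((K:ℝ)+1) * Bf K y : ℝ) : ℂ) = ((K:ℂ)+1) * ∫ y in a..X, (y:ℂ)^r * (Bf K y : ℂ) := by
    rw [← intervalIntegral.integral_const_mul]; congr 1; ext y; push_cast; ring
  have e2 : ∫ y in a..X, r * (y:ℂ)^(r-1) * (Bf (K+1) y : ℂ) = r * ∫ y in a..X, (y:ℂ)^(r-1) * (Bf (K+1) y : ℂ) := by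
    rw [← intervalIntegral.integral_const_mul]; congr 1; ext y; ring
  rw [e1, e2] at h
  field_simp
  rw [← h]; ring

theorem base1 (r : ℂ) {m : ℕ} (hm : 1 ≤ m) : (m:ℂ)^r = (∫ y in (m:ℝ)..((m+1:ℕ):ℝ), (y:ℂ)^r) + ((m:ℂ)^r - ((m+1:ℕ):ℂ)^r)/2
    + r * ∫ y in (m:ℝ)..((m+1:ℕ):ℝ), (y:ℂ)^(r-1) * (Bf 1 y : ℂ) := by
  have ha : (0:ℝ) < m := by exact_mod_cast hm
  have hX : (m:ℝ) ≤ ((m+1:ℕ):ℝ) := by push_cast; linarith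
  have h := intervalIntegral.integral_mul_deriv_eq_deriv_mul_of_hasDeriv_right (a := m) (b := ((m+1:ℕ):ℝ))
    (u := fun t : ℝ => (t:ℂ)^r) (u' := fun t : ℝ => r * (t:ℂ)^(r-1))
    (v := fun t : ℝ => ((t - m - 1/2 : ℝ) : ℂ)) (v' := fun t : ℝ => ((1:ℝ):ℂ))
    (cp_contOn r ha hX) (by fun_prop)
    (fun x hx => (cp_deriv r (by rw [min_eq_left hX] at hx; exact ha.trans hx.1)).hasDerivWithinAt)
    (fun x hx => ((((hasDerivAt_id x).sub_const (m:ℝ)).sub_const (1/2)).ofReal_comp).hasDerivWithinAt)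
    ((cp_contOn (r-1) ha hX).intervalIntegrable.const_mul r)
    (by simp)
  have e1 : ∫ y in (m:ℝ)..((m+1:ℕ):ℝ), (y:ℂ)^(r-1) * (Bf 1 y : ℂ) = ∫ y in (m:ℝ)..((m+1:ℕ):ℝ), (y:ℂ)^(r-1) * ((y - m - 1/2 : ℝ) : ℂ) := by
    apply intervalIntegral.integral_congr_Ioo_of_le hX
    intro y hy
    have hf : ⌊y⌋ = (m:ℤ) := by
      rw [Int.floor_eq_iff]
      refine ⟨by exact_mod_cast hy.1.le, ?_⟩
      have := hy.2; push_cast at this ⊢; exact this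
    simp only [Bf, Int.fract, hf, bernoulliFun_one]
    push_cast; rfl
  rw [e1]
  simp only [Complex.ofReal_one, mul_one] at h
  rw [h, ← intervalIntegral.integral_const_mul]
  have e2 : (∫ y in (m:ℝ)..((m+1:ℕ):ℝ), r * (y:ℂ)^(r-1) * ((y - m - 1/2 : ℝ) : ℂ)) =
      ∫ y in (m:ℝ)..((m+1:ℕ):ℝ), r * ((y:ℂ)^(r-1) * ((y - m - 1/2 : ℝ) : ℂ)) := by
    congr 1; ext y; ring
  rw [e2]
  push_cast
  ring

theorem base (r : ℂ) {α : ℕ} (hα : 1 ≤ α) {M : ℕ} (hM : α ≤ M) :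
    ∑ m ∈ Finset.Ico α M, (m:ℂ)^r = (∫ y in (α:ℝ)..(M:ℝ), (y:ℂ)^r) + ((α:ℂ)^r - (M:ℂ)^r)/2
    + r * ∫ y in (α:ℝ)..(M:ℝ), (y:ℂ)^(r-1) * (Bf 1 y : ℂ) := by
  induction M, hM using Nat.le_induction with
  | base => simp
  | succ M hM ih =>
    have ha : (0:ℝ) < α := by exact_mod_cast hα
    have hM' : (α:ℝ) ≤ M := by exact_mod_cast hM
    have hM1 : (M:ℝ) ≤ ((M+1:ℕ):ℝ) := by push_cast; linarith
    rw [Finset.sum_Ico_succ_top hM, ih]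
    have b1 := base1 r (m := M) (by omega)
    rw [← intervalIntegral.integral_add_adjacent_intervals (f := fun y : ℝ => (y:ℂ)^r) (cp_contOn r ha hM').intervalIntegrable
      (cp_contOn r (ha.trans_le hM') hM1).intervalIntegrable,
      ← intervalIntegral.integral_add_adjacent_intervals (Bfc_II 1 (r-1) ha hM') (Bfc_II 1 (r-1) (ha.trans_le hM') hM1)]
    linear_combination b1

end Z6


namespace Z6
open MeasureTheory Set Filter Topology

theorem cp_tendsto {r : ℂ} (hr : r.re < 0) : Tendsto (fun X : ℝ => (X:ℂ)^r) atTop (𝓝 0) := by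
  rw [tendsto_zero_iff_norm_tendsto_zero]
  have h := tendsto_rpow_neg_atTop (y := -r.re) (by linarith)
  refine h.congr' ?_
  filter_upwards [eventually_gt_atTop 0] with x hx
  rw [Complex.norm_cpow_eq_rpow_re_of_pos hx, neg_neg]

theorem Bfc_Ioi (K : ℕ) {r : ℂ} (hr : r.re < -1) {a : ℝ} (ha : 0 < a) :
    IntegrableOn (fun t : ℝ => (t:ℂ)^r * (Bf K t : ℂ)) (Ioi a) := by
  obtain ⟨C, hC, hB⟩ := Bf_bdd K
  have := (integrableOn_Ioi_cpow_of_lt hr ha).bdd_mul (c := C) (f := fun t : ℝ => (Bf K t : ℂ))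
    (Complex.measurable_ofReal.comp (Bf_meas K)).aestronglyMeasurable (Eventually.of_forall fun x => by rw [Complex.norm_real]; exact hB _)
  simpa only [mul_comm, IntegrableOn] using this

noncomputable def GG (α : ℕ) (K : ℕ) (s : ℂ) : ℂ := ∫ y in Ioi (α:ℝ), (y:ℂ)^(-s-K) * (Bf K y : ℂ)

theorem GG_tendsto {α : ℕ} (hα : 1 ≤ α) (K : ℕ) {s : ℂ} (hs : 1 < s.re + K) :
    Tendsto (fun X : ℝ => ∫ y in (α:ℝ)..X, (y:ℂ)^(-s-K) * (Bf K y : ℂ)) atTop (𝓝 (GG α K s)) :=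
  intervalIntegral_tendsto_integral_Ioi _ (Bfc_Ioi K (by simp; linarith) (by exact_mod_cast hα)) tendsto_id

theorem BP_tendsto {α : ℕ} (hα : 1 ≤ α) {K : ℕ} (hK : K ≠ 0) {s : ℂ} (hs : 0 < s.re + K) :
    Tendsto (fun X : ℝ => ∫ y in (α:ℝ)..X, (y:ℂ)^(-s-K) * (Bf K y : ℂ)) atTop
      (𝓝 (-((α:ℂ)^(-s-K) * (Bf (K+1) 0 : ℂ)) / (K+1) + (s+K)/(K+1) * GG α (K+1) s)) := by
  have ha : (0:ℝ) < α := by exact_mod_cast hα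
  have h1 := GG_tendsto hα (K+1) (s := s) (by push_cast; linarith)
  have h2 : Tendsto (fun X : ℝ => (X:ℂ)^(-s-K) * (Bf (K+1) X : ℂ)) atTop (𝓝 0) := by
    obtain ⟨C, hC, hB⟩ := Bf_bdd (K+1)
    have h3 := (cp_tendsto (r := -s-K) (by simp; linarith)).norm.mul_const C
    rw [norm_zero, zero_mul] at h3
    refine squeeze_zero_norm (fun X => ?_) h3
    rw [norm_mul]
    gcongr
    rw [Complex.norm_real]; exact hB _
  have h4 := ((h2.sub_const ((α:ℂ)^(-s-K) * (Bf (K+1) 0 : ℂ))).div_const ((K:ℂ)+1)).add (h1.const_mul ((s+K)/(K+1)))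
  rw [zero_sub] at h4
  refine h4.congr' ?_
  filter_upwards [eventually_ge_atTop (α:ℝ)] with X hX
  rw [BP hK (-s-K) ha hX]
  have e : Bf (K+1) (α:ℝ) = Bf (K+1) 0 := by simp [Bf]
  have e2 : -s - (K:ℂ) - 1 = -s - ((K+1:ℕ):ℂ) := by push_cast; ring
  rw [e, e2]
  simp only [Complex.ofReal_natCast]
  ring

noncomputable def QQ (α : ℕ) : ℕ → ℂ → ℂ
  | 0, _ => 1/2
  | (j+1), s => QQ α j s + (∏ r ∈ Finset.range (j+1), (s + r)) / ((j+1).factorial * (j+2)) * (Bf (j+2) 0 : ℂ) * (α:ℂ)⁻¹^(j+1)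

theorem EM1 {α : ℕ} (hα : 1 ≤ α) {s : ℂ} (hs : 1 < s.re) :
    riemannZeta s = ∑ m ∈ Finset.Ico 1 α, (m:ℂ)^(-s) + (α:ℂ)^(-s) * (α/(s-1) + 1/2) - s * GG α 1 s := by
  have ha : (0:ℝ) < α := by exact_mod_cast hα
  have hac : (α:ℂ) ≠ 0 := by exact_mod_cast ha.ne'
  have hs0 : s ≠ 0 := by rintro rfl; simp at hs; linarith
  have hs1 : s ≠ 1 := by rintro rfl; simp at hs
  have hs1' : s - 1 ≠ 0 := sub_ne_zero.2 hs1
  have hz : Tendsto (fun M : ℕ => ∑ m ∈ Finset.range M, 1 / (m:ℂ)^s) atTop (𝓝 (riemannZeta s)) := by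
    rw [zeta_eq_tsum_one_div_nat_cpow hs]
    exact (Complex.summable_one_div_nat_cpow.2 hs).hasSum.tendsto_sum_nat
  have hcast := tendsto_natCast_atTop_atTop (R := ℝ)
  have hI : Tendsto (fun M : ℕ => ∫ y in (α:ℝ)..(M:ℝ), (y:ℂ)^(-s)) atTop (𝓝 ((α:ℂ)^(-s) * (α/(s-1)))) := by
    have h := intervalIntegral_tendsto_integral_Ioi (α:ℝ) (integrableOn_Ioi_cpow_of_lt (a := -s) (by simpa using hs) ha) hcast
    rw [integral_Ioi_cpow_of_lt (by simpa using hs) ha] at h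
    convert h using 2
    rw [Complex.ofReal_natCast, Complex.cpow_add _ _ hac, Complex.cpow_one]
    have : -s + 1 ≠ 0 := by intro h; apply hs1'; linear_combination -h
    field_simp
    ring
  have hM : Tendsto (fun M : ℕ => ((M:ℂ))^(-s)) atTop (𝓝 0) := by
    have := (cp_tendsto (r := -s) (by simp; linarith)).comp hcast
    refine this.congr fun M => by simp
  have hG := ((GG_tendsto hα 1 (s := s) (by simp; linarith)).comp hcast)
  have htot := ((hI.add ((hM.const_sub ((α:ℂ)^(-s))).div_const 2)).add (hG.const_mul (-s))).const_add (∑ m ∈ Finset.Ico 1 α, (m:ℂ)^(-s))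
  have := tendsto_nhds_unique hz (htot.congr' ?_)
  · rw [this]; ring
  filter_upwards [eventually_ge_atTop α] with M hMα
  have hb := base (-s) hα hMα
  have e : ∑ m ∈ Finset.range M, 1 / (m:ℂ)^s = ∑ m ∈ Finset.Ico 1 α, (m:ℂ)^(-s) + ∑ m ∈ Finset.Ico α M, (m:ℂ)^(-s) := by
    rw [Finset.sum_Ico_consecutive _ hα hMα, Finset.range_eq_Ico, Finset.sum_eq_sum_Ico_succ_bot (by omega)]
    simp [hs0, Complex.cpow_neg]
  rw [e, hb]
  simp [Function.comp]

theorem EMK {α : ℕ} (hα : 1 ≤ α) (j : ℕ) {s : ℂ} (hs : 1 < s.re) :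
    riemannZeta s = ∑ m ∈ Finset.Ico 1 α, (m:ℂ)^(-s) + (α:ℂ)^(-s) * (α/(s-1) + QQ α j s)
      - (∏ r ∈ Finset.range (j+1), (s + r)) / (j+1).factorial * GG α (j+1) s := by
  induction j with
  | zero => rw [EM1 hα hs]; simp [QQ]
  | succ j ih =>
    have hac : (α:ℂ) ≠ 0 := by exact_mod_cast (by omega : α ≠ 0)
    have h1 := tendsto_nhds_unique (GG_tendsto hα (j+1) (s := s) (by push_cast; linarith [(Nat.cast_nonneg j : (0:ℝ) ≤ j)]))
      (BP_tendsto hα (by omega) (by push_cast; linarith [(Nat.cast_nonneg j : (0:ℝ) ≤ j)]))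
    rw [ih, h1, QQ, Finset.prod_range_succ _ (j+1), Nat.factorial_succ (j+1)]
    have e : (α:ℂ)^(-s-((j+1:ℕ):ℂ)) = (α:ℂ)^(-s) * (α:ℂ)⁻¹^(j+1) := by
      rw [Complex.cpow_sub _ _ hac, Complex.cpow_natCast, inv_pow, div_eq_mul_inv]
    rw [e]
    have hf : ((j+1).factorial : ℂ) ≠ 0 := by exact_mod_cast Nat.factorial_ne_zero _
    have hj : (j:ℂ) + 1 + 1 ≠ 0 := by exact_mod_cast Nat.succ_ne_zero (j+1)
    have hj2 : (j:ℂ) + 2 ≠ 0 := by exact_mod_cast Nat.succ_ne_zero (j+1)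
    push_cast
    generalize (α:ℂ)⁻¹^(j+1) = A
    generalize ∏ r ∈ Finset.range (j+1), (s + r) = P
    generalize GG α (j+1+1) s = G
    field_simp
    ring

end Z6


namespace Z6
open MeasureTheory Set Filter Topology

theorem GG_diff {α : ℕ} (hα : 1 ≤ α) (K : ℕ) {s : ℂ} (hs : 1 < s.re + K) : DifferentiableAt ℂ (GG α K) s := by
  have ha : (0:ℝ) < α := by exact_mod_cast hα
  obtain ⟨C, hC, hB⟩ := Bf_bdd K
  set f : ℝ → ℂ := (Ioi (α:ℝ)).indicator (fun y => (Bf K y : ℂ)) with hf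
  have hfb : ∀ y, ‖f y‖ ≤ C := by
    intro y
    refine (norm_indicator_le_norm_self _ _).trans ?_
    rw [Complex.norm_real]; exact hB _
  have hfm : Measurable f := (Complex.measurable_ofReal.comp (Bf_meas K)).indicator measurableSet_Ioi
  have e : GG α K = fun s => mellin f (1 - s - K) := by
    ext s
    unfold GG mellin
    have : ∀ t : ℝ, (t:ℂ)^((1 - s - K) - 1) • f t = (Ioi (α:ℝ)).indicator (fun y : ℝ => (y:ℂ)^(-s-K) * (Bf K y : ℂ)) t := by
      intro t
      rw [hf]
      by_cases ht : t ∈ Ioi (α:ℝ)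
      · rw [indicator_of_mem ht, indicator_of_mem ht, smul_eq_mul]; congr 2; ring
      · rw [indicator_of_notMem ht, indicator_of_notMem ht, smul_zero]
    simp_rw [this]
    rw [setIntegral_indicator measurableSet_Ioi, Ioi_inter_Ioi, max_eq_right ha.le]
  rw [e]
  have hm : DifferentiableAt ℂ (mellin f) (1 - s - K) := by
    apply mellin_differentiableAt_of_isBigO_rpow (a := 0) (b := (1 - s - K).re - 1)
    · apply LocallyIntegrable.locallyIntegrableOn
      have := (locallyIntegrable_const (μ := (volume : Measure ℝ)) (C:ℝ))
      refine this.mono hfm.aestronglyMeasurable (Eventually.of_forall fun x => ?_)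
      rw [Real.norm_of_nonneg hC.le]; exact hfb x
    · simp only [neg_zero, Real.rpow_zero]
      exact Asymptotics.IsBigO.of_bound C (Eventually.of_forall fun x => by simpa using hfb x)
    · simp; linarith
    · have : f =ᶠ[𝓝[>] 0] 0 := by
        have : ∀ᶠ z in 𝓝[>] (0:ℝ), z < (α:ℝ) := nhdsWithin_le_nhds (Iio_mem_nhds ha)
        filter_upwards [this] with z hz
        rw [hf, indicator_of_notMem (by simpa using hz.le)]; rfl
      exact this.trans_isBigO (Asymptotics.isBigO_zero _ _)
    · linarith
  exact DifferentiableAt.comp (g := mellin f) (f := fun s : ℂ => 1 - s - K) s hm (by fun_prop)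

theorem PP_diff (j : ℕ) : Differentiable ℂ (fun s : ℂ => ∏ r ∈ Finset.range j, (s + r)) := by
  fun_prop

theorem QQ_diff (α j : ℕ) : Differentiable ℂ (QQ α j) := by
  induction j with
  | zero => have : QQ α 0 = fun _ => 1/2 := by ext s; rw [QQ]
            rw [this]; fun_prop
  | succ j ih =>
    have : QQ α (j+1) = fun s => QQ α j s + (∏ r ∈ Finset.range (j+1), (s + r)) / ((j+1).factorial * (j+2)) * (Bf (j+2) 0 : ℂ) * (α:ℂ)⁻¹^(j+1) := by
      ext s; rw [QQ]
    rw [this]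
    have := PP_diff (j+1)
    fun_prop

theorem EMext {α : ℕ} (hα : 1 ≤ α) (j : ℕ) {s : ℂ} (hs : 0 < s.re + j) (hs1 : s ≠ 1) :
    riemannZeta s = ∑ m ∈ Finset.Ico 1 α, (m:ℂ)^(-s) + (α:ℂ)^(-s) * (α/(s-1) + QQ α j s)
      - (∏ r ∈ Finset.range (j+1), (s + r)) / (j+1).factorial * GG α (j+1) s := by
  have hac : (α:ℂ) ≠ 0 := by exact_mod_cast (by omega : α ≠ 0)
  set U : Set ℂ := {z | -(j:ℝ) < z.re} with hU
  have hUo : IsOpen U := isOpen_lt continuous_const Complex.continuous_re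
  have hUc : IsPreconnected U := (convex_halfSpace_re_gt _).isPreconnected
  set g : ℂ → ℂ := fun s => (s - 1) * ∑ m ∈ Finset.Ico 1 α, (m:ℂ)^(-s) + (α:ℂ)^(-s) * (α + (s-1) * QQ α j s)
      - (s-1) * ((∏ r ∈ Finset.range (j+1), (s + r)) / (j+1).factorial * GG α (j+1) s) with hg
  have hcp : ∀ m : ℕ, m ≠ 0 → Differentiable ℂ (fun s : ℂ => (m:ℂ)^(-s)) := by
    intro m hm s
    exact (differentiableAt_id.neg).const_cpow (Or.inl (by exact_mod_cast hm))
  have hgd : DifferentiableOn ℂ g U := by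
    intro z hz
    apply DifferentiableAt.differentiableWithinAt
    have h1 : DifferentiableAt ℂ (fun s : ℂ => ∑ m ∈ Finset.Ico 1 α, (m:ℂ)^(-s)) z := by
      apply DifferentiableAt.fun_sum
      intro m hm
      exact hcp m (by have := (Finset.mem_Ico.1 hm).1; omega) z
    have h2 := hcp α (by omega) z
    have h3 := QQ_diff α j z
    have h4 := PP_diff (j+1) z
    have hz' : -(j:ℝ) < z.re := hz
    have h5 := GG_diff hα (j+1) (s := z) (by push_cast; linarith)
    fun_prop
  have hz : DifferentiableOn ℂ riemannZeta₁ U := differentiable_riemannZeta₁.differentiableOn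
  have key : EqOn riemannZeta₁ g U := by
    apply AnalyticOnNhd.eqOn_of_preconnected_of_eventuallyEq (hz.analyticOnNhd hUo) (hgd.analyticOnNhd hUo) hUc (z₀ := 2)
    · rw [hU]; simp only [Set.mem_ofPred_eq, Complex.re_ofNat]
      have : (0:ℝ) ≤ j := Nat.cast_nonneg j
      linarith
    · have : ∀ᶠ z : ℂ in 𝓝 2, 1 < z.re := (isOpen_lt continuous_const Complex.continuous_re).mem_nhds (by simp)
      filter_upwards [this] with z hz
      have hz1 : z ≠ 1 := by rintro rfl; simp at hz
      have hz1' : z - 1 ≠ 0 := sub_ne_zero.2 hz1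
      have h1 := riemannZeta_eq_inv_sub_mul hz1
      have h2 : riemannZeta₁ z = (z-1) * riemannZeta z := by rw [h1]; field_simp
      rw [h2, EMK hα j hz, hg]
      field_simp
  have hsU : s ∈ U := by rw [hU]; simp only [Set.mem_ofPred_eq]; linarith
  have hs1' : s - 1 ≠ 0 := sub_ne_zero.2 hs1
  rw [riemannZeta_eq_inv_sub_mul hs1, key hsU, hg]
  field_simp

theorem EM {α : ℕ} (hα : 1 ≤ α) (k : ℕ) {s : ℂ} (hs : s.re = -(k:ℝ)) (hs1 : s ≠ 1) {ℓ : ℂ}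
    (hℓ : ∃ X : ℕ → ℝ, Tendsto X atTop atTop ∧ Tendsto (fun R => ∫ y in (α:ℝ)..(X R), (y:ℂ)^(-s-(k+1:ℕ)) * (Bf (k+1) y : ℂ)) atTop (𝓝 ℓ)) :
    riemannZeta s = ∑ m ∈ Finset.Ico 1 α, (m:ℂ)^(-s) + (α:ℂ)^(-s) * (α/(s-1) + QQ α k s)
      - (∏ r ∈ Finset.range (k+1), (s + r)) / (k+1).factorial * ℓ := by
  obtain ⟨X, hX, hXl⟩ := hℓ
  have h1 := tendsto_nhds_unique hXl ((BP_tendsto hα (K := k+1) (by omega) (s := s) (by push_cast; linarith)).comp hX)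
  have hac : (α:ℂ) ≠ 0 := by exact_mod_cast (by omega : α ≠ 0)
  rw [EMext hα (k+1) (by push_cast; linarith) hs1, h1, QQ, Finset.prod_range_succ _ (k+1), Nat.factorial_succ (k+1)]
  have e : (α:ℂ)^(-s-((k+1:ℕ):ℂ)) = (α:ℂ)^(-s) * (α:ℂ)⁻¹^(k+1) := by
    rw [Complex.cpow_sub _ _ hac, Complex.cpow_natCast, inv_pow, div_eq_mul_inv]
  rw [e]
  have hf : ((k+1).factorial : ℂ) ≠ 0 := by exact_mod_cast Nat.factorial_ne_zero _
  have hj : (k:ℂ) + 1 + 1 ≠ 0 := by exact_mod_cast Nat.succ_ne_zero (k+1)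
  have hj2 : (k:ℂ) + 2 ≠ 0 := by exact_mod_cast Nat.succ_ne_zero (k+1)
  push_cast
  generalize (α:ℂ)⁻¹^(k+1) = A
  generalize ∏ r ∈ Finset.range (k+1), (s + r) = P
  generalize GG α (k+1+1) s = G
  field_simp
  ring

end Z6


namespace Z6
open MeasureTheory Set Filter Topology

noncomputable def zz (L ν : ℝ) : ℂ := 2 * (Real.pi : ℂ) * Complex.I * (ν : ℂ) / (L : ℂ)

theorem CoV {L : ℝ} (hL : 0 < L) {α : ℕ} (hα : 1 ≤ α) (K R : ℕ) (ν : ℝ) :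
    ∫ y in (α:ℝ)..(α * Real.exp (L * ((R:ℝ)+1/2))), (y:ℂ)^(-1 - zz L ν) * (Bf K y : ℂ) =
      (α:ℂ)^(-zz L ν) * (L * TT L K α R ν) := by
  have ha : (0:ℝ) < α := by exact_mod_cast hα
  have hW : (0:ℝ) ≤ (R:ℝ) + 1/2 := by positivity
  set W := (R:ℝ) + 1/2 with hWd
  set f : ℝ → ℝ := fun w => α * Real.exp (L * w) with hf
  have hfm : StrictMono f := by
    intro x y hxy
    simp only [hf]
    gcongr
  have him : f '' (Ioc 0 W) = Ioc (α:ℝ) (f W) := by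
    ext y
    simp only [mem_image, mem_Ioc]
    constructor
    · rintro ⟨x, ⟨h0, h1⟩, rfl⟩
      have := hfm h0
      refine ⟨by simpa [hf] using this, hfm.monotone h1⟩
    · rintro ⟨h0, h1⟩
      have hy : 0 < y := ha.trans h0
      have e : f (Real.log (y/α) / L) = y := by
        simp only [hf]
        rw [mul_div_cancel₀ _ hL.ne', Real.exp_log (by positivity)]
        field_simp
      refine ⟨Real.log (y/α) / L, ⟨?_, ?_⟩, e⟩
      · apply div_pos _ hL
        apply Real.log_pos
        rwa [lt_div_iff₀ ha, one_mul]
      · rw [← hfm.le_iff_le, e]; exact h1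
  have hle : (α:ℝ) ≤ f W := by
    have := hfm.monotone hW
    simpa [hf] using this
  have hder : ∀ x ∈ Ioc 0 W, HasDerivWithinAt f (L * f x) (Ioc 0 W) x := by
    intro x _
    apply HasDerivAt.hasDerivWithinAt
    have h1 : HasDerivAt (fun w : ℝ => L * w) L x := by simpa using (hasDerivAt_id x).const_mul L
    have := (h1.exp).const_mul (α:ℝ)
    have e : L * f x = α * (Real.exp (L * x) * L) := by simp only [hf]; ring
    rw [e]; exact this
  have := integral_image_eq_integral_abs_deriv_smul measurableSet_Ioc hder hfm.injective.injOn
    (fun y : ℝ => (y:ℂ)^(-1 - zz L ν) * (Bf K y : ℂ))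
  rw [him] at this
  change ∫ y in (α:ℝ)..(f W), _ = _
  rw [intervalIntegral.integral_of_le hle, this, TT, intervalIntegral.integral_of_le hW, ← integral_const_mul, ← integral_const_mul]
  apply setIntegral_congr_fun measurableSet_Ioc
  intro w _
  have hfp : 0 < f w := by simp only [hf]; positivity
  have hfc : ((f w : ℝ) : ℂ) ≠ 0 := by exact_mod_cast hfp.ne'
  have hac : (α:ℂ) ≠ 0 := by exact_mod_cast ha.ne'
  have hLc : (L:ℂ) ≠ 0 := by exact_mod_cast hL.ne'
  simp only
  rw [abs_of_pos (by positivity), Complex.real_smul]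
  have e1 : ((f w : ℝ):ℂ)^(-1 - zz L ν) = ((f w : ℝ):ℂ)⁻¹ * ((α:ℂ)^(-zz L ν) * ee (-(ν * w))) := by
    rw [sub_eq_add_neg, Complex.cpow_add _ _ hfc, Complex.cpow_neg_one]
    congr 1
    rw [Complex.cpow_def_of_ne_zero hfc, Complex.cpow_def_of_ne_zero hac, ← Complex.ofReal_log hfp.le]
    simp only [hf]
    rw [Real.log_mul ha.ne' (Real.exp_pos _).ne', Real.log_exp, ee, ← Complex.exp_add]
    congr 1
    unfold zz
    push_cast [Complex.natCast_log]
    field_simp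
    ring
  rw [e1]
  push_cast
  field_simp
  simp only [hf, mul_comm L w]

theorem zf {α : ℕ} (hα : 1 ≤ α) {b : ℕ} (hb : 2 ≤ b) (k : ℕ) {Ih : ℝ → ℂ}
    (hI : ∀ n, Tendsto (fun R => TT (Real.log b) (k+1) α R n) atTop (𝓝 (Ih n))) {ν : ℝ} (hν : ν ≠ 0) :
    riemannZeta (-(k:ℂ) + zz (Real.log b) ν) * Complex.exp (zz (Real.log b) ν * (Real.log α : ℂ)) =
      ∑ m ∈ Finset.Ico 1 α, (m:ℂ)^k * Complex.exp (zz (Real.log b) ν * ((Real.log α - Real.log m : ℝ) : ℂ))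
      + (α:ℂ)^k * (α / (-(k:ℂ) + zz (Real.log b) ν - 1) + QQ α k (-(k:ℂ) + zz (Real.log b) ν))
      - (∏ r ∈ Finset.range (k+1), (-(k:ℂ) + zz (Real.log b) ν + r)) / (k+1).factorial * (Real.log b * Ih ν) := by
  have hb1 : (1:ℝ) < b := by exact_mod_cast (by omega : 1 < b)
  have hL : 0 < Real.log b := Real.log_pos hb1
  set L := Real.log b with hLd
  have ha : (0:ℝ) < α := by exact_mod_cast hα
  have hac : (α:ℂ) ≠ 0 := by exact_mod_cast ha.ne'
  set z := zz L ν with hz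
  have hzz : z = ((2 * Real.pi * ν / L : ℝ) : ℂ) * Complex.I := by
    rw [hz, zz]; push_cast; ring
  have hzre : z.re = 0 := by rw [hzz, Complex.re_ofReal_mul]; simp
  have hzim : z.im ≠ 0 := by
    rw [hzz, Complex.im_ofReal_mul, Complex.I_im, mul_one]
    have := Real.pi_pos
    positivity
  have hs1 : -(k:ℂ) + z ≠ 1 := by
    intro h
    have := congrArg Complex.im h
    simp at this
    exact hzim this
  have hX : Tendsto (fun R : ℕ => (α:ℝ) * Real.exp (L * ((R:ℝ)+1/2))) atTop atTop := by
    apply Tendsto.const_mul_atTop ha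
    apply Real.tendsto_exp_atTop.comp
    apply Tendsto.const_mul_atTop hL
    exact tendsto_atTop_add_const_right _ _ tendsto_natCast_atTop_atTop
  have hlim : Tendsto (fun R : ℕ => ∫ y in (α:ℝ)..(α * Real.exp (L * ((R:ℝ)+1/2))), (y:ℂ)^(-(-(k:ℂ)+z)-(k+1:ℕ)) * (Bf (k+1) y : ℂ))
      atTop (𝓝 ((α:ℂ)^(-z) * (L * Ih ν))) := by
    refine (((hI ν).const_mul (L:ℂ)).const_mul ((α:ℂ)^(-z))).congr fun R => ?_
    rw [← CoV hL hα]
    have : -(-(k:ℂ)+z)-(k+1:ℕ) = -1 - z := by push_cast; ring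
    rw [this]
  rw [EM hα k (by simp [hzre]) hs1 ⟨_, hX, hlim⟩]
  have ez : ∀ m : ℕ, m ≠ 0 → (m:ℂ)^(-(-(k:ℂ)+z)) = (m:ℂ)^k * Complex.exp (-(z * (Real.log m : ℂ))) := by
    intro m hm
    have hmc : (m:ℂ) ≠ 0 := by exact_mod_cast hm
    have : -(-(k:ℂ)+z) = (k:ℂ) + (-z) := by ring
    rw [this, Complex.cpow_add _ _ hmc, Complex.cpow_natCast, Complex.cpow_def_of_ne_zero hmc, Complex.natCast_log]
    congr 2; ring
  have ea : (α:ℂ)^(-z) = Complex.exp (-(z * (Real.log α : ℂ))) := by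
    rw [Complex.cpow_def_of_ne_zero hac, Complex.natCast_log]; congr 1; ring
  have hE : Complex.exp (-(z * (Real.log α : ℂ))) * Complex.exp (z * (Real.log α : ℂ)) = 1 := by
    rw [← Complex.exp_add]; simp
  rw [ez α (by omega), ea]
  have hsum : (∑ m ∈ Finset.Ico 1 α, (m:ℂ)^(-(-(k:ℂ)+z))) * Complex.exp (z * (Real.log α : ℂ)) =
      ∑ m ∈ Finset.Ico 1 α, (m:ℂ)^k * Complex.exp (z * ((Real.log α - Real.log m : ℝ) : ℂ)) := by
    rw [Finset.sum_mul]
    apply Finset.sum_congr rfl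
    intro m hm
    rw [ez m (by have := (Finset.mem_Ico.1 hm).1; omega), mul_assoc, ← Complex.exp_add]
    congr 2; push_cast; ring
  rw [← hsum]
  linear_combination ((α:ℂ)^k * (α / (-(k:ℂ) + z - 1) + QQ α k (-(k:ℂ) + z))
      - (∏ r ∈ Finset.range (k+1), (-(k:ℂ) + z + r)) / (k+1).factorial * (L * Ih ν)) * hE

end Z6


namespace Z6
open MeasureTheory Set Filter Topology

theorem prod_bd (c : ℂ) (d : ℕ → ℂ) (j : ℕ) : ∃ C : ℝ, 0 ≤ C ∧ ∀ x : ℂ, ‖x‖ ≤ 1 →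
    ‖∏ r ∈ Finset.range j, (c + d r * x) - c^j‖ ≤ C * ‖x‖ := by
  induction j with
  | zero => exact ⟨0, le_rfl, fun x _ => by simp⟩
  | succ j ih =>
    obtain ⟨C, hC, h⟩ := ih
    refine ⟨C * (‖c‖ + ‖d j‖) + ‖c‖^j * ‖d j‖, by positivity, fun x hx => ?_⟩
    rw [Finset.prod_range_succ, pow_succ]
    have e : (∏ r ∈ Finset.range j, (c + d r * x)) * (c + d j * x) - c^j * c =
      (∏ r ∈ Finset.range j, (c + d r * x) - c^j) * (c + d j * x) + c^j * (d j * x) := by ring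
    rw [e]
    have h1 : ‖c + d j * x‖ ≤ ‖c‖ + ‖d j‖ := by
      refine (norm_add_le _ _).trans ?_
      rw [norm_mul]
      nlinarith [norm_nonneg (d j)]
    calc _ ≤ ‖(∏ r ∈ Finset.range j, (c + d r * x) - c^j)‖ * ‖c + d j * x‖ + ‖c‖^j * (‖d j‖ * ‖x‖) := by
          refine (norm_add_le _ _).trans ?_
          rw [norm_mul, norm_mul, norm_pow, norm_mul]
      _ ≤ C * ‖x‖ * (‖c‖ + ‖d j‖) + ‖c‖^j * (‖d j‖ * ‖x‖) := by
          gcongr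
          exact h x hx
      _ = _ := by ring

theorem PP_bd (c : ℂ) (k j : ℕ) : ∃ C : ℝ, 0 ≤ C ∧ ∀ ν : ℝ, 1 ≤ |ν| →
    ‖(∏ r ∈ Finset.range j, (-(k:ℂ) + c * ν + r)) / (ν:ℂ)^j - c^j‖ ≤ C / |ν| := by
  obtain ⟨C, hC, h⟩ := prod_bd c (fun r => (r:ℂ) - k) j
  refine ⟨C, hC, fun ν hν => ?_⟩
  have hν0 : 0 < |ν| := by linarith
  have hνc : (ν:ℂ) ≠ 0 := by exact_mod_cast abs_pos.1 hν0
  have hn : ‖(ν:ℂ)⁻¹‖ = |ν|⁻¹ := by rw [norm_inv, Complex.norm_real, Real.norm_eq_abs]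
  have := h ((ν:ℂ)⁻¹) (by rw [hn]; exact inv_le_one_of_one_le₀ hν)
  rw [hn, ← div_eq_mul_inv] at this
  have e : (∏ r ∈ Finset.range j, (-(k:ℂ) + c * ν + r)) / (ν:ℂ)^j = ∏ r ∈ Finset.range j, (c + ((r:ℂ) - k) * (ν:ℂ)⁻¹) := by
    have : (ν:ℂ)^j = ∏ r ∈ Finset.range j, (ν:ℂ) := by simp
    rw [this, ← Finset.prod_div_distrib]
    apply Finset.prod_congr rfl
    intro r _
    field_simp
    ring
  rw [e]; exact this

theorem QQ_bd (c : ℂ) (α k j : ℕ) : ∃ (q : ℂ) (C : ℝ), 0 ≤ C ∧ ∀ ν : ℝ, 1 ≤ |ν| →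
    ‖QQ α j (-(k:ℂ) + c * ν) / (ν:ℂ)^j - q‖ ≤ C / |ν| := by
  induction j with
  | zero => exact ⟨1/2, 0, le_rfl, fun ν _ => by simp [QQ]⟩
  | succ j ih =>
    obtain ⟨q, C, hC, h⟩ := ih
    obtain ⟨C', hC', h'⟩ := PP_bd c k (j+1)
    set A : ℂ := 1 / ((j+1).factorial * (j+2)) * (Bf (j+2) 0 : ℂ) * (α:ℂ)⁻¹^(j+1) with hA
    refine ⟨A * c^(j+1), ‖q‖ + C + ‖A‖ * C', by positivity, fun ν hν => ?_⟩
    have hν0 : 0 < |ν| := by linarith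
    have hνc : (ν:ℂ) ≠ 0 := by exact_mod_cast abs_pos.1 hν0
    have hn : ‖(ν:ℂ)⁻¹‖ = |ν|⁻¹ := by rw [norm_inv, Complex.norm_real, Real.norm_eq_abs]
    have e : QQ α (j+1) (-(k:ℂ) + c * ν) / (ν:ℂ)^(j+1) - A * c^(j+1) =
        QQ α j (-(k:ℂ) + c * ν) / (ν:ℂ)^j * (ν:ℂ)⁻¹ + A * ((∏ r ∈ Finset.range (j+1), (-(k:ℂ) + c * ν + r)) / (ν:ℂ)^(j+1) - c^(j+1)) := by
      rw [QQ, hA]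
      generalize (∏ r ∈ Finset.range (j+1), (-(k:ℂ) + c * ν + r)) = P
      rw [add_div, pow_succ (ν:ℂ) j]
      ring
    have hq : ‖QQ α j (-(k:ℂ) + c * ν) / (ν:ℂ)^j‖ ≤ ‖q‖ + C := by
      have h1 := h ν hν
      have h2 : C / |ν| ≤ C := div_le_self hC hν
      have := norm_sub_norm_le (QQ α j (-(k:ℂ) + c * ν) / (ν:ℂ)^j) q
      linarith
    rw [e]
    refine (norm_add_le _ _).trans ?_
    rw [norm_mul, norm_mul, hn]
    calc _ ≤ (‖q‖ + C) * |ν|⁻¹ + ‖A‖ * (C' / |ν|) := by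
          gcongr
          exact h' ν hν
      _ = _ := by rw [div_eq_mul_inv, div_eq_mul_inv]; ring

theorem sq_sum : ∃ S : ℝ, 0 ≤ S ∧ ∀ N : ℕ, ∑ n ∈ Finset.range N, 1 / ((n:ℝ)+1)^2 ≤ S := by
  have hs : Summable (fun n : ℕ => 1 / ((n:ℝ)+1)^2) := by
    have := (summable_nat_add_iff 1).2 (Real.summable_one_div_nat_pow.2 (by norm_num : 1 < 2))
    simpa using this
  exact ⟨∑' n : ℕ, 1 / ((n:ℝ)+1)^2, tsum_nonneg fun n => by positivity, fun N => hs.sum_le_tsum _ fun n _ => by positivity⟩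

theorem sq_bd {f : ℕ → ℂ} {C : ℝ} (hC : 0 ≤ C) (h : ∀ n : ℕ, ‖f n‖ ≤ C / ((n:ℝ)+1)^2) :
    ∃ B : ℝ, ∀ N : ℕ, ‖∑ n ∈ Finset.range N, f n‖ ≤ B := by
  obtain ⟨S, hS, hb⟩ := sq_sum
  refine ⟨C * S, fun N => (norm_sum_le _ _).trans ?_⟩
  calc _ ≤ ∑ n ∈ Finset.range N, C * (1 / ((n:ℝ)+1)^2) := Finset.sum_le_sum fun n _ => (h n).trans (by rw [mul_one_div])
    _ = C * ∑ n ∈ Finset.range N, 1 / ((n:ℝ)+1)^2 := by rw [Finset.mul_sum]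
    _ ≤ _ := by gcongr; exact hb N

theorem sin_bd (u : ℝ) (N : ℕ) : |∑ n ∈ Finset.range N, Real.sin (2 * Real.pi * ((n:ℝ)+1) * u) / (Real.pi * ((n:ℝ)+1))| ≤ 4 := by
  have e : ∑ n ∈ Finset.range N, Real.sin (2 * Real.pi * ((n:ℝ)+1) * u) / (Real.pi * ((n:ℝ)+1)) = del N (Int.fract u) - (Int.fract u - 1/2) := by
    unfold del
    rw [add_sub_cancel_left]
    apply Finset.sum_congr rfl
    intro n _
    congr 1
    have : 2 * Real.pi * ((n:ℝ)+1) * u = 2 * Real.pi * ((n:ℝ)+1) * Int.fract u + ((((n:ℤ)+1) * ⌊u⌋ : ℤ) : ℝ) * (2 * Real.pi) := by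
      conv_lhs => rw [← Int.floor_add_fract u]
      push_cast; ring
    rw [this, Real.sin_add_int_mul_two_pi]
  rw [e]
  have h0 := Int.fract_nonneg u
  have h1 := (Int.fract_lt_one u).le
  have h2 := abs_le.1 (del_le1' N h0 h1)
  rw [abs_le]
  constructor <;> linarith [h2.1, h2.2]

theorem m_bd (u : ℝ) (k : ℕ) : ∃ B : ℝ, ∀ N : ℕ, ‖∑ n ∈ Finset.range N,
    (ee (((n:ℝ)+1) * u) / (((n:ℝ)+1 : ℝ):ℂ)^(k+1) + ee ((-((n:ℝ)+1)) * u) / ((-((n:ℝ)+1) : ℝ):ℂ)^(k+1))‖ ≤ B := by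
  rcases Nat.eq_zero_or_pos k with rfl | hk
  · refine ⟨2 * Real.pi * 4, fun N => ?_⟩
    have e : ∑ n ∈ Finset.range N,
      (ee (((n:ℝ)+1) * u) / (((n:ℝ)+1 : ℝ):ℂ)^(0+1) + ee ((-((n:ℝ)+1)) * u) / ((-((n:ℝ)+1) : ℝ):ℂ)^(0+1)) =
      2 * Real.pi * Complex.I * ((∑ n ∈ Finset.range N, Real.sin (2 * Real.pi * ((n:ℝ)+1) * u) / (Real.pi * ((n:ℝ)+1)) : ℝ) : ℂ) := by
      push_cast
      rw [Finset.mul_sum]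
      apply Finset.sum_congr rfl
      intro n _
      have hn : (n:ℂ) + 1 ≠ 0 := by exact_mod_cast Nat.succ_ne_zero n
      have hp : (Real.pi:ℂ) ≠ 0 := by exact_mod_cast Real.pi_ne_zero
      unfold ee
      rw [Complex.sin]
      push_cast
      have e1 : Complex.I * (2 * (Real.pi:ℂ) * (((n:ℂ)+1) * u)) = 2 * Real.pi * ((n:ℂ)+1) * u * Complex.I := by ring
      have e2 : Complex.I * (2 * (Real.pi:ℂ) * (-((n:ℂ)+1) * u)) = -(2 * Real.pi * ((n:ℂ)+1) * u) * Complex.I := by ring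
      have e3 : Complex.I * (2 * (Real.pi:ℂ) * ((-1 + -(n:ℂ)) * u)) = -(2 * Real.pi * ((n:ℂ)+1) * u) * Complex.I := by ring
      simp only [e1, e2, zero_add, pow_one]
      generalize Complex.exp (2 * Real.pi * ((n:ℂ)+1) * u * Complex.I) = E1
      generalize Complex.exp (-(2 * Real.pi * ((n:ℂ)+1) * u) * Complex.I) = E2
      rw [div_neg]
      field_simp
      linear_combination (E1 - E2) * Complex.I_sq
    rw [e]
    rw [norm_mul, Complex.norm_real, Real.norm_eq_abs]
    have : ‖(2:ℂ) * Real.pi * Complex.I‖ = 2 * Real.pi := by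
      simp [abs_of_pos Real.pi_pos]
    rw [this]
    have := Real.pi_pos
    gcongr
    exact sin_bd u N
  · apply sq_bd (C := 2) (by norm_num)
    intro n
    refine (norm_add_le _ _).trans ?_
    rw [norm_div, norm_div, ee_norm, ee_norm, norm_pow, norm_pow, Complex.norm_real, Complex.norm_real, norm_neg,
      Real.norm_of_nonneg (by positivity)]
    have : 1 / ((n:ℝ)+1)^(k+1) ≤ 1 / ((n:ℝ)+1)^2 := by
      apply one_div_le_one_div_of_le (by positivity)
      exact pow_le_pow_right₀ (by linarith [(Nat.cast_nonneg n : (0:ℝ) ≤ n)]) (by omega)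
    calc _ ≤ 1 / ((n:ℝ)+1)^2 + 1 / ((n:ℝ)+1)^2 := by gcongr
      _ = _ := by ring

end Z6


namespace Z6
open MeasureTheory Set Filter Topology

theorem zz_eq (L ν : ℝ) : zz L ν = (2 * (Real.pi:ℂ) * Complex.I / L) * ν := by unfold zz; ring

theorem exp_zz {L : ℝ} (ν θ : ℝ) : Complex.exp (zz L ν * (θ:ℂ)) = ee (ν * (θ / L)) := by
  unfold zz ee; congr 1; push_cast; ring

noncomputable def R1 (L : ℝ) (α k : ℕ) (ν : ℝ) : ℂ :=
  (∑ m ∈ Finset.Ico 1 α, (m:ℂ)^k * Complex.exp (zz L ν * ((Real.log α - Real.log m : ℝ) : ℂ))) / (ν:ℂ)^(k+1)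

noncomputable def R2 (L : ℝ) (α k : ℕ) (ν : ℝ) : ℂ :=
  ((α:ℂ)^k * (α / (-(k:ℂ) + zz L ν - 1) + QQ α k (-(k:ℂ) + zz L ν))) / (ν:ℂ)^(k+1)

theorem R1_bd (L : ℝ) (α k : ℕ) : ∃ B : ℝ, ∀ N : ℕ, ‖∑ n ∈ Finset.range N, (R1 L α k ((n:ℝ)+1) + R1 L α k (-((n:ℝ)+1)))‖ ≤ B := by
  choose B hB using fun m : ℕ => m_bd ((Real.log α - Real.log m) / L) k
  refine ⟨∑ m ∈ Finset.Ico 1 α, ‖(m:ℂ)^k‖ * B m, fun N => ?_⟩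
  have e : ∑ n ∈ Finset.range N, (R1 L α k ((n:ℝ)+1) + R1 L α k (-((n:ℝ)+1))) =
      ∑ m ∈ Finset.Ico 1 α, (m:ℂ)^k * ∑ n ∈ Finset.range N,
        (ee (((n:ℝ)+1) * ((Real.log α - Real.log m) / L)) / (((n:ℝ)+1 : ℝ):ℂ)^(k+1) + ee ((-((n:ℝ)+1)) * ((Real.log α - Real.log m) / L)) / ((-((n:ℝ)+1) : ℝ):ℂ)^(k+1)) := by
    simp_rw [Finset.mul_sum]
    rw [Finset.sum_comm]
    apply Finset.sum_congr rfl
    intro n _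
    unfold R1
    rw [Finset.sum_div, Finset.sum_div, ← Finset.sum_add_distrib]
    apply Finset.sum_congr rfl
    intro m _
    rw [exp_zz, exp_zz]
    ring
  rw [e]
  refine (norm_sum_le _ _).trans (Finset.sum_le_sum fun m _ => ?_)
  rw [norm_mul]
  gcongr
  exact hB m N

theorem R2_bd {L : ℝ} (hL : 0 < L) (α k : ℕ) : ∃ B : ℝ, ∀ N : ℕ, ‖∑ n ∈ Finset.range N, (R2 L α k ((n:ℝ)+1) + R2 L α k (-((n:ℝ)+1)))‖ ≤ B := by
  set c : ℂ := 2 * (Real.pi:ℂ) * Complex.I / L with hc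
  have hp := Real.pi_pos
  obtain ⟨q, C, hC, hq⟩ := QQ_bd c α k k
  have main : ∀ ν : ℝ, 1 ≤ |ν| → ‖R2 L α k ν - (α:ℂ)^k * q / ν‖ ≤ ((α:ℝ)^k * (α * L + C)) / ν^2 := by
    intro ν hν
    have hν0 : 0 < |ν| := by linarith
    have hνc : (ν:ℂ) ≠ 0 := by exact_mod_cast abs_pos.1 hν0
    have hn : ‖(ν:ℂ)‖ = |ν| := by rw [Complex.norm_real, Real.norm_eq_abs]
    have e : R2 L α k ν - (α:ℂ)^k * q / ν = (α:ℂ)^k * ((α / (-(k:ℂ) + zz L ν - 1)) / (ν:ℂ)^(k+1) + (QQ α k (-(k:ℂ) + c * ν) / (ν:ℂ)^k - q) / ν) := by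
      rw [R2, zz_eq, ← hc]
      rw [pow_succ (ν:ℂ) k]
      ring
    rw [e, norm_mul, norm_pow, Complex.norm_natCast, mul_div_assoc]
    gcongr
    have him : (-(k:ℂ) + zz L ν - 1).im = 2 * Real.pi * ν / L := by
      have : zz L ν = ((2 * Real.pi * ν / L : ℝ) : ℂ) * Complex.I := by unfold zz; push_cast; ring
      rw [this]; simp
    have h1 : |ν| / L ≤ ‖-(k:ℂ) + zz L ν - 1‖ := by
      refine le_trans ?_ (Complex.abs_im_le_norm _)
      rw [him, abs_div, abs_of_pos hL, abs_mul, abs_of_pos (by positivity : 0 < 2 * Real.pi)]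
      gcongr
      nlinarith [Real.pi_gt_three]
    have h2 : ‖(α:ℂ) / (-(k:ℂ) + zz L ν - 1) / (ν:ℂ)^(k+1)‖ ≤ α * L / ν^2 := by
      rw [norm_div, norm_div, norm_pow, hn, Complex.norm_natCast]
      have h3 : |ν| ≤ |ν|^(k+1) := le_self_pow₀ hν (by omega)
      calc _ ≤ (α:ℝ) / (|ν| / L) / |ν| := by gcongr
        _ = _ := by rw [← sq_abs]; field_simp
    have h4 : ‖(QQ α k (-(k:ℂ) + c * ν) / (ν:ℂ)^k - q) / ν‖ ≤ C / ν^2 := by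
      rw [norm_div, hn]
      calc _ ≤ C / |ν| / |ν| := by gcongr; exact hq ν hν
        _ = _ := by rw [← sq_abs]; field_simp
    refine (norm_add_le _ _).trans ?_
    rw [add_div]
    exact add_le_add h2 h4
  apply sq_bd (C := 2 * ((α:ℝ)^k * (α * L + C))) (by positivity)
  intro n
  have hn0 : (0:ℝ) ≤ n := Nat.cast_nonneg n
  have h1 := main ((n:ℝ)+1) (by rw [abs_of_pos (by positivity)]; linarith)
  have h2 := main (-((n:ℝ)+1)) (by rw [abs_neg, abs_of_pos (by positivity)]; linarith)
  rw [neg_sq] at h2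
  have e : R2 L α k ((n:ℝ)+1) + R2 L α k (-((n:ℝ)+1)) = (R2 L α k ((n:ℝ)+1) - (α:ℂ)^k * q / (((n:ℝ)+1 : ℝ):ℂ)) +
      (R2 L α k (-((n:ℝ)+1)) - (α:ℂ)^k * q / ((-((n:ℝ)+1) : ℝ):ℂ)) := by
    rw [Complex.ofReal_neg, div_neg]; ring
  rw [e]
  refine (norm_add_le _ _).trans ((add_le_add h1 h2).trans (le_of_eq ?_))
  ring

theorem bd_log {f : ℕ → ℂ} {B : ℝ} (h : ∀ N, ‖f N‖ ≤ B) : Tendsto (fun N : ℕ => (1 / (Real.log N : ℂ)) * f N) atTop (𝓝 0) := by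
  have h1 : Tendsto (fun N : ℕ => (Real.log N)⁻¹) atTop (𝓝 0) :=
    (Real.tendsto_log_atTop.comp tendsto_natCast_atTop_atTop).inv_tendsto_atTop
  have h2 := h1.norm.mul_const B
  rw [norm_zero, zero_mul] at h2
  refine squeeze_zero_norm (fun N => ?_) h2
  rw [norm_mul, one_div, norm_inv, Complex.norm_real, norm_inv]
  gcongr
  exact h N

theorem sum_pm (f : ℤ → ℂ) (N : ℕ) : ∑ n ∈ (Finset.Icc (-(N:ℤ)) (N:ℤ)).erase 0, f n =
    ∑ n ∈ Finset.range N, (f ((n:ℤ)+1) + f (-((n:ℤ)+1))) := by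
  induction N with
  | zero => simp
  | succ N ih =>
    rw [Finset.sum_range_succ, ← ih]
    have e : (Finset.Icc (-((N+1:ℕ):ℤ)) ((N+1:ℕ):ℤ)).erase 0 =
        insert ((N:ℤ)+1) (insert (-((N:ℤ)+1)) ((Finset.Icc (-(N:ℤ)) (N:ℤ)).erase 0)) := by
      ext x
      simp only [Finset.mem_erase, Finset.mem_Icc, Finset.mem_insert]
      push_cast
      omega
    rw [e, Finset.sum_insert, Finset.sum_insert]
    · ring
    · simp only [Finset.mem_erase, Finset.mem_Icc]; omega
    · simp only [Finset.mem_erase, Finset.mem_Icc, Finset.mem_insert]; omega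

theorem final_val (L : ℝ) (hL : 0 < L) (k : ℕ) :
    -((L:ℂ) / (k+1).factorial) * (2 * (Real.pi:ℂ) * Complex.I / L)^(k+1) * ((beta (k+1) / L : ℝ) : ℂ) =
    (if Odd k then -((-1 : ℂ) ^ ((k + 1) / 2) * (2 * (Real.pi : ℂ)) ^ (k + 1) * ((bernoulli (k + 1) : ℚ) : ℂ) /
            ((Nat.factorial (k + 1) : ℂ) * (L : ℂ) ^ (k + 1))) else 0) := by
  have hLc : (L:ℂ) ≠ 0 := by exact_mod_cast hL.ne'
  have hf : ((k+1).factorial : ℂ) ≠ 0 := by exact_mod_cast Nat.factorial_ne_zero _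
  split_ifs with h
  · obtain ⟨t, rfl⟩ := h
    have e1 : (2*t+1+1)/2 = t+1 := by omega
    have e2 : 2*t+1+1 = 2*(t+1) := by ring
    have hb : beta (2*t+1+1) = ((bernoulli (2*t+1+1) : ℚ) : ℝ) := by
      rw [beta, bernoulliFun_eval_zero, e2, pow_mul]; norm_num
    have hI : Complex.I^(2*t+1+1) = (-1)^(t+1) := by rw [e2, pow_mul, Complex.I_sq]
    rw [hb, e1, div_pow, mul_pow, hI]
    push_cast
    field_simp
  · have hk : Even k := Nat.not_odd_iff_even.1 h
    have : beta (k+1) = 0 := by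
      rw [beta, pow_succ, hk.neg_one_pow]; norm_num
    rw [this]; simp

theorem main6 (α : ℕ) (hα : 0 < α) (b : ℕ) (hb : 2 ≤ b) (k : ℕ) :
    Tendsto (fun N : ℕ => (1 / (Real.log N : ℂ)) * ∑ n ∈ Finset.range N,
      (riemannZeta (-(k:ℂ) + zz (Real.log b) ((n:ℝ)+1)) * Complex.exp (zz (Real.log b) ((n:ℝ)+1) * (Real.log α : ℂ)) / (((n:ℝ)+1 : ℝ):ℂ)^(k+1)
      + riemannZeta (-(k:ℂ) + zz (Real.log b) (-((n:ℝ)+1))) * Complex.exp (zz (Real.log b) (-((n:ℝ)+1)) * (Real.log α : ℂ)) / ((-((n:ℝ)+1) : ℝ):ℂ)^(k+1)))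
      atTop (𝓝 (-((Real.log b:ℂ) / (k+1).factorial) * (2 * (Real.pi:ℂ) * Complex.I / Real.log b)^(k+1) * ((beta (k+1) / Real.log b : ℝ) : ℂ))) := by
  have hb1 : (1:ℝ) < b := by exact_mod_cast (by omega : 1 < b)
  have hL : 0 < Real.log b := Real.log_pos hb1
  obtain ⟨Ih, C0, q, hq0, hq1, hI, hIb⟩ := TT_lim hα hb (K := k+1) (by omega)
  have hRL := Ih_RL hq0 hq1 hIb
  have hD := D_lim hα hb (by omega) hI
  have hzf := fun ν : ℝ => fun hν : ν ≠ 0 => zf (ν := ν) hα hb k hI hν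
  set L := Real.log b with hLd
  set c : ℂ := 2 * (Real.pi:ℂ) * Complex.I / L with hc
  obtain ⟨C, hC, hP⟩ := PP_bd c k (k+1)
  obtain ⟨B1, hB1⟩ := R1_bd L α k
  obtain ⟨B2, hB2⟩ := R2_bd hL α k
  set ep : ℝ → ℂ := fun ν => (∏ r ∈ Finset.range (k+1), (-(k:ℂ) + c * ν + r)) / (ν:ℂ)^(k+1) - c^(k+1) with hep
  have hat : Tendsto (fun n : ℕ => (n:ℝ) + 1) atTop atTop := tendsto_atTop_add_const_right _ _ tendsto_natCast_atTop_atTop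
  have hx1 : Tendsto (fun n : ℕ => Ih ((n:ℝ)+1)) atTop (𝓝 0) := hRL.comp (hat.mono_right atTop_le_cocompact)
  have hx2 : Tendsto (fun n : ℕ => Ih (-((n:ℝ)+1))) atTop (𝓝 0) :=
    hRL.comp ((tendsto_neg_atTop_atBot.comp hat).mono_right atBot_le_cocompact)
  have hy1 : ∀ n : ℕ, ‖ep ((n:ℝ)+1)‖ ≤ C / (n+1) := by
    intro n
    have hn0 : (0:ℝ) ≤ n := Nat.cast_nonneg n
    have := hP ((n:ℝ)+1) (by rw [abs_of_pos (by positivity)]; linarith)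
    rwa [abs_of_pos (by positivity)] at this
  have hy2 : ∀ n : ℕ, ‖ep (-((n:ℝ)+1))‖ ≤ C / (n+1) := by
    intro n
    have hn0 : (0:ℝ) ≤ n := Nat.cast_nonneg n
    have := hP (-((n:ℝ)+1)) (by rw [abs_neg, abs_of_pos (by positivity)]; linarith)
    rwa [abs_neg, abs_of_pos (by positivity)] at this
  have l1 := littleo_log hx1 hy1
  have l2 := littleo_log hx2 hy2
  have l3 := bd_log hB1
  have l4 := bd_log hB2
  have tot := (((hD.const_mul (-((L:ℂ) / (k+1).factorial) * c^(k+1))).add ((l1.add l2).const_mul (-((L:ℂ) / (k+1).factorial)))).add l3).add l4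
  simp only [add_zero, mul_zero] at tot
  refine tot.congr fun N => ?_
  have key : ∀ ν : ℝ, ν ≠ 0 → riemannZeta (-(k:ℂ) + zz L ν) * Complex.exp (zz L ν * (Real.log α : ℂ)) / (ν:ℂ)^(k+1) =
      R1 L α k ν + R2 L α k ν - ((L:ℂ) / (k+1).factorial) * ((c^(k+1) + ep ν) * Ih ν) := by
    intro ν hν
    rw [hzf ν hν, R1, R2, hep]
    simp only
    rw [zz_eq L ν, ← hc]
    ring
  have hsum : ∑ n ∈ Finset.range N,
      (riemannZeta (-(k:ℂ) + zz L ((n:ℝ)+1)) * Complex.exp (zz L ((n:ℝ)+1) * (Real.log α : ℂ)) / (((n:ℝ)+1 : ℝ):ℂ)^(k+1)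
      + riemannZeta (-(k:ℂ) + zz L (-((n:ℝ)+1))) * Complex.exp (zz L (-((n:ℝ)+1)) * (Real.log α : ℂ)) / ((-((n:ℝ)+1) : ℝ):ℂ)^(k+1)) =
      (-((L:ℂ) / (k+1).factorial) * c^(k+1)) * ∑ n ∈ Finset.range N, (Ih ((n:ℝ)+1) + Ih (-((n:ℝ)+1)))
      + (-((L:ℂ) / (k+1).factorial)) * (∑ n ∈ Finset.range N, ep ((n:ℝ)+1) * Ih ((n:ℝ)+1) + ∑ n ∈ Finset.range N, ep (-((n:ℝ)+1)) * Ih (-((n:ℝ)+1)))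
      + ∑ n ∈ Finset.range N, (R1 L α k ((n:ℝ)+1) + R1 L α k (-((n:ℝ)+1)))
      + ∑ n ∈ Finset.range N, (R2 L α k ((n:ℝ)+1) + R2 L α k (-((n:ℝ)+1))) := by
    rw [← Finset.sum_add_distrib, Finset.mul_sum, Finset.mul_sum, ← Finset.sum_add_distrib, ← Finset.sum_add_distrib, ← Finset.sum_add_distrib]
    apply Finset.sum_congr rfl
    intro n _
    have hn : (n:ℝ) + 1 ≠ 0 := by positivity
    rw [key _ hn, key _ (neg_ne_zero.2 hn)]
    ring
  rw [hsum]
  ring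

end Z6

theorem statement6 (α : ℕ) (hα : 0 < α) (b : ℕ) (hb : 2 ≤ b) (k : ℕ) :
    Filter.Tendsto
      (fun N : ℕ =>
        (1 / (Real.log N : ℂ)) *
          ∑ n ∈ (Finset.Icc (-(N : ℤ)) (N : ℤ)).erase 0,
            riemannZeta (-(k : ℂ) + 2 * (Real.pi : ℂ) * Complex.I * (n : ℂ) /
                (Real.log b : ℂ)) *
              Complex.exp (2 * (Real.pi : ℂ) * Complex.I * (n : ℂ) * (Real.log α : ℂ) /
                (Real.log b : ℂ)) / (n : ℂ) ^ (k + 1))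
      Filter.atTop
      (nhds (if Odd k then
          -((-1 : ℂ) ^ ((k + 1) / 2) * (2 * (Real.pi : ℂ)) ^ (k + 1) *
              ((bernoulli (k + 1) : ℚ) : ℂ) /
            ((Nat.factorial (k + 1) : ℂ) * (Real.log b : ℂ) ^ (k + 1)))
        else 0)) := by
  have hL : 0 < Real.log b := Real.log_pos (by exact_mod_cast (by omega : 1 < b))
  rw [← Z6.final_val _ hL k]
  refine (Z6.main6 α hα b hb k).congr fun N => ?_
  rw [Z6.sum_pm]
  congr 1
  apply Finset.sum_congr rfl
  intro n _
  unfold Z6.zz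
  push_cast
  simp only [div_mul_eq_mul_div]
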